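/- Let u ∈ C^0(Ω;ℝ^n) ∩ W^{n/(n+1),n+1}(Ω;ℝ^n) with |Ju|_TV < ∞, and let F ∈ C^∞(ℝ^n;ℝ^n) be globally Lipschitz. Then |J(F∘u)|_TV < ∞, and for every ψ ∈ C^1_c(Ω) and every sequence (u_k) of maps continuously differentiable up to the boundary of Ω with ‖u_k − u‖_{W^{n/(n+1),n+1}(Ω)} → 0, one has ⟨J(F∘u),ψ⟩ = lim_k ⟨Ju_k, ψ·(det∇F)∘u_k⟩ = lim_k (−∫_Ω j u_k(x) · ∇(ψ(x) det∇F(u_k(x))) dx); i.e., ⟨J(F∘u),ψ⟩ equals the value at ψ·(det∇F)∘u of the continuous extension of Ju to W^{n/(n+1),n+1}(Ω). -/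

import Mathlib

open MeasureTheory Metric Filter Topology

noncomputable section

abbrev Euc (n : ℕ) := EuclideanSpace ℝ (Fin n)

/-- The Jacobian matrix `∇u(x)` of a map `u : ℝⁿ → ℝⁿ`, with entries `∂_j u_i (x)`. -/
def jacMat (n : ℕ) (u : Euc n → Euc n) (x : Euc n) : Matrix (Fin n) (Fin n) ℝ :=
  Matrix.of fun i j => fderiv ℝ u x (EuclideanSpace.single j 1) i

/-- The vector field `j u := (1/n) (cof ∇u)ᵀ u` (componentwise); note that
`(cof A)ᵀ = adjugate A`. -/
def jvec (n : ℕ) (u : Euc n → Euc n) (x : Euc n) : Fin n → ℝ :=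
  fun i => (n : ℝ)⁻¹ * Matrix.mulVec (Matrix.adjugate (jacMat n u x)) (fun j => u x j) i

/-- The pointwise pairing `j u (x) · ∇ψ(x)`. -/
def jPair (n : ℕ) (u : Euc n → Euc n) (ψ : Euc n → ℝ) (x : Euc n) : ℝ :=
  ∑ i, jvec n u x i * fderiv ℝ ψ x (EuclideanSpace.single i 1)

/-- `ψ ∈ C¹_c(Ω)`. -/
def Cc1 (n : ℕ) (Ω : Set (Euc n)) (ψ : Euc n → ℝ) : Prop :=
  ContDiff ℝ 1 ψ ∧ HasCompactSupport ψ ∧ tsupport ψ ⊆ Ω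

/-- The fractional Sobolev seminorm `[u]_{W^{s,p}(Ω)}`. -/
def sobSemi (n : ℕ) (s p : ℝ) (Ω : Set (Euc n)) {F : Type*} [NormedAddCommGroup F]
    (u : Euc n → F) : ℝ :=
  (∫ x in Ω, ∫ y in Ω, ‖u x - u y‖ ^ p / dist x y ^ ((n : ℝ) + s * p)) ^ (1 / p)

/-- The fractional Sobolev norm `‖u‖_{W^{s,p}(Ω)} = ‖u‖_{L^p(Ω)} + [u]_{W^{s,p}(Ω)}`. -/
def sobNorm (n : ℕ) (s p : ℝ) (Ω : Set (Euc n)) {F : Type*} [NormedAddCommGroup F]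
    (u : Euc n → F) : ℝ :=
  (∫ x in Ω, ‖u x‖ ^ p) ^ (1 / p) + sobSemi n s p Ω u

/-- Membership `u ∈ W^{s,p}(Ω; F)`: `u ∈ L^p(Ω)` and the double integral defining
`[u]_{W^{s,p}(Ω)}^p` is finite. -/
def MemWsp (n : ℕ) (s p : ℝ) (Ω : Set (Euc n)) {F : Type*} [NormedAddCommGroup F]
    (u : Euc n → F) : Prop :=
  AEStronglyMeasurable u (volume.restrict Ω) ∧
  Integrable (fun x => ‖u x‖ ^ p) (volume.restrict Ω) ∧
  Integrable (fun q : Euc n × Euc n => ‖u q.1 - u q.2‖ ^ p / dist q.1 q.2 ^ ((n : ℝ) + s * p))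
    ((volume.restrict Ω).prod (volume.restrict Ω))

/-- `Ω` has smooth boundary: it is a sublevel set of a smooth function whose
differential does not vanish on the boundary. -/
def SmoothBoundary (n : ℕ) (Ω : Set (Euc n)) : Prop :=
  ∃ f : Euc n → ℝ, ContDiff ℝ (⊤ : ℕ∞) f ∧ Ω = f ⁻¹' Set.Iio 0 ∧
    ∀ x ∈ frontier Ω, fderiv ℝ f x ≠ 0

/-- `u^a(x) = (u(x) - a)/|u(x) - a|`. -/
def proj (n : ℕ) (u : Euc n → Euc n) (a : Euc n) : Euc n → Euc n :=
  fun x => ‖u x - a‖⁻¹ • (u x - a)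

/-- The set of Hölder quotients of `u` on `Ω`. -/
def holderSet (n : ℕ) (α : ℝ) (Ω : Set (Euc n)) {F : Type*} [NormedAddCommGroup F]
    (u : Euc n → F) : Set ℝ :=
  {r | ∃ x ∈ Ω, ∃ y ∈ Ω, x ≠ y ∧ r = ‖u x - u y‖ / dist x y ^ α}

/-- The Hölder seminorm `[u]_{C^{0,α}(Ω)}`. -/
def holderSemi (n : ℕ) (α : ℝ) (Ω : Set (Euc n)) {F : Type*} [NormedAddCommGroup F]
    (u : Euc n → F) : ℝ :=
  sSup (holderSet n α Ω u)

/-- The Hölder norm `‖u‖_{C^{0,α}(Ω)} = sup_Ω ‖u‖ + [u]_{C^{0,α}(Ω)}`. -/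
def holderNorm (n : ℕ) (α : ℝ) (Ω : Set (Euc n)) {F : Type*} [NormedAddCommGroup F]
    (u : Euc n → F) : ℝ :=
  sSup {r | ∃ x ∈ Ω, r = ‖u x‖} + holderSemi n α Ω u

/-- the volume `ω_n` of the unit ball of `ℝⁿ`. -/
def ballVol (n : ℕ) : ℝ := (volume (ball (0 : Euc n) 1)).toReal

/-- `⟨Jv, ψ⟩ = J` for `v ∈ W^{(n-1)/n, n}(Ω; ℝⁿ)`: approximating sequences of maps which are
`C¹` up to the boundary exist, and for every such sequence the Jacobian integrals converge
to `J`. -/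
def JPairing (n : ℕ) (Ω : Set (Euc n)) (v : Euc n → Euc n) (ψ : Euc n → ℝ) (J : ℝ) : Prop :=
  (∃ vk : ℕ → Euc n → Euc n, (∀ k, ContDiffOn ℝ 1 (vk k) (closure Ω)) ∧
      Tendsto (fun k => sobNorm n (((n : ℝ) - 1) / n) n Ω (vk k - v)) atTop (𝓝 0) ∧
      Tendsto (fun k => ∫ x in Ω, (jacMat n (vk k) x).det * ψ x) atTop (𝓝 J)) ∧
  (∀ vk : ℕ → Euc n → Euc n, (∀ k, ContDiffOn ℝ 1 (vk k) (closure Ω)) →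
      Tendsto (fun k => sobNorm n (((n : ℝ) - 1) / n) n Ω (vk k - v)) atTop (𝓝 0) →
      Tendsto (fun k => ∫ x in Ω, (jacMat n (vk k) x).det * ψ x) atTop (𝓝 J))

/-- The set of values `⟨Jv, ψ⟩` over test functions `ψ ∈ C¹_c(Ω)` with `|ψ| ≤ 1`;
its supremum is the total variation `|Jv|_{TV}`. -/
def TVset (n : ℕ) (Ω : Set (Euc n)) (v : Euc n → Euc n) : Set ℝ :=
  {r | ∃ ψ : Euc n → ℝ, Cc1 n Ω ψ ∧ (∀ x, |ψ x| ≤ 1) ∧ JPairing n Ω v ψ r}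

/-- `⟨Jv, ψ⟩ = -∫_Ω j v · ∇ψ` for (pointwise defined) `v`. -/
def jpairOn (n : ℕ) (Ω : Set (Euc n)) (v : Euc n → Euc n) (ψ : Euc n → ℝ) : ℝ :=
  -∫ x in Ω, jPair n v ψ x

/-- The `W^{-1,1}(Ω)` distance between two functionals on test functions:
`sup { S ψ - T ψ : ψ ∈ C¹_c(Ω), Lip ψ ≤ 1 }`. -/
def Wm11dist (n : ℕ) (Ω : Set (Euc n)) (S T : (Euc n → ℝ) → ℝ) : ℝ :=
  sSup {r | ∃ ψ : Euc n → ℝ, Cc1 n Ω ψ ∧ LipschitzWith 1 ψ ∧ r = S ψ - T ψ}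

section NullLag
variable {E : Type*} [NormedAddCommGroup E] [NormedSpace ℝ E] [FiniteDimensional ℝ E]

lemma det_interp (r0 : ℝ) : ∃ c : ℕ → ℝ, (∀ A : E →L[ℝ] E,
    A.det = ∑ i ∈ Finset.range (Module.finrank ℝ E + 1),
      c i * ((r0 + i) • ContinuousLinearMap.id ℝ E + A).det) ∧
    (0 : ℝ) ^ (Module.finrank ℝ E) = ∑ i ∈ Finset.range (Module.finrank ℝ E + 1),
      c i * (r0 + i) ^ (Module.finrank ℝ E) := by
  set N := Module.finrank ℝ E with hN
  set s := Finset.range (N + 1)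
  set v : ℕ → ℝ := fun i => r0 + i with hv
  have hinj : Set.InjOn v (s : Set ℕ) := by
    intro a _ b _ h
    simpa [hv] using h
  refine ⟨fun i => (Lagrange.basis s v i).eval 0, ?_, ?_⟩
  · intro A
    have hdeg : ((-(A : E →ₗ[ℝ] E)).charpoly).degree < (s.card : WithBot ℕ) := by
      rw [Polynomial.degree_eq_natDegree (LinearMap.charpoly_monic _).ne_zero,
        LinearMap.charpoly_natDegree]
      simp [s]
      exact_mod_cast Nat.lt_succ_self _
    have h := Lagrange.eq_interpolate (v := v) hinj hdeg
    have h2 := congrArg (Polynomial.eval 0) h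
    rw [Lagrange.interpolate_apply, Polynomial.eval_finsetSum, LinearMap.eval_charpoly] at h2
    have e0 : LinearMap.det ((algebraMap ℝ (Module.End ℝ E)) 0 - -(A : E →ₗ[ℝ] E)) = A.det := by
      simp [ContinuousLinearMap.det]
    rw [e0] at h2
    rw [h2]
    refine Finset.sum_congr rfl fun i _ => ?_
    rw [Polynomial.eval_mul, Polynomial.eval_C, LinearMap.eval_charpoly, mul_comm]
    congr 1
    rw [ContinuousLinearMap.det]
    congr 1
    ext x
    simp [hv, Module.algebraMap_end_apply, add_smul, Nat.cast_smul_eq_nsmul]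
  · have hdeg : ((Polynomial.X ^ N : Polynomial ℝ)).degree < (s.card : WithBot ℕ) := by
      simp [s]
      exact_mod_cast Nat.lt_succ_self _
    have h := Lagrange.eq_interpolate (v := v) hinj hdeg
    have h2 := congrArg (Polynomial.eval 0) h
    rw [Lagrange.interpolate_apply, Polynomial.eval_finsetSum] at h2
    simp only [Polynomial.eval_pow, Polynomial.eval_X, Polynomial.eval_mul, Polynomial.eval_C] at h2
    rw [h2]
    exact Finset.sum_congr rfl fun i _ => by rw [mul_comm]

variable [MeasurableSpace E] [BorelSpace E] (μ : Measure E) [μ.IsAddHaarMeasure]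

lemma perturb_int (g : E → E) (hg : ContDiff ℝ 1 g) {R : ℝ} (hR : ∀ x, x ∉ ball (0:E) R → g x = 0)
    (L : NNReal) (hL : LipschitzWith L g) :
    ∃ r0 : ℝ, 0 < r0 ∧ ∀ r ≥ r0,
      ∫ x in ball (0:E) R, (r • ContinuousLinearMap.id ℝ E + fderiv ℝ g x).det ∂μ
        = r ^ (Module.finrank ℝ E) * μ.real (ball (0:E) R) := by
  have hcont : ContinuousAt (fun A : E →L[ℝ] E => A.det) (ContinuousLinearMap.id ℝ E) :=
    ContinuousLinearMap.continuous_det.continuousAt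
  have hpos : ∀ᶠ A in 𝓝 (ContinuousLinearMap.id ℝ E), 0 < A.det := by
    apply hcont.eventually
    apply lt_mem_nhds
    simp [ContinuousLinearMap.det]
  obtain ⟨δ, hδ, hdet⟩ := Metric.eventually_nhds_iff.1 hpos
  refine ⟨(2 * (L + 1)) / min δ 1, by positivity, fun r hr => ?_⟩
  have hm : 0 < min δ 1 := by positivity
  have hr0 : 0 < r := lt_of_lt_of_le (by positivity) hr
  have hLr : r⁻¹ * L < min δ 1 := by
    rw [ge_iff_le, div_le_iff₀ hm] at hr
    rw [inv_mul_lt_iff₀ hr0]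
    have : (0:ℝ) ≤ L := L.2
    linarith
  have hd1 : r⁻¹ * L < δ := hLr.trans_le (min_le_left _ _)
  have hd2 : r⁻¹ * L < 1 := hLr.trans_le (min_le_right _ _)
  set f : E → E := fun x => x + r⁻¹ • g x with hf
  have hgd : ∀ x, DifferentiableAt ℝ g x := fun x => (hg.differentiable (by norm_num)) x
  have hfd : ∀ x, HasFDerivAt f (ContinuousLinearMap.id ℝ E + r⁻¹ • fderiv ℝ g x) x := fun x =>
    (hasFDerivAt_id x).add ((hgd x).hasFDerivAt.const_smul r⁻¹)
  have hnb : ∀ x, ‖fderiv ℝ g x‖ ≤ L := fun x => norm_fderiv_le_of_lipschitz ℝ hL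
  have happ : ApproximatesLinearOn f ((ContinuousLinearEquiv.refl ℝ E : E ≃L[ℝ] E) : E →L[ℝ] E) Set.univ
      (Real.toNNReal (r⁻¹ * L)) := by
    intro x _ y _
    simp only [hf, ContinuousLinearEquiv.coe_refl, ContinuousLinearMap.coe_id', id]
    rw [Real.coe_toNNReal _ (by positivity)]
    have : x + r⁻¹ • g x - (y + r⁻¹ • g y) - (x - y) = r⁻¹ • (g x - g y) := by
      rw [smul_sub]; abel
    rw [this, norm_smul, Real.norm_of_nonneg (by positivity), mul_assoc]
    gcongr
    exact hL.norm_sub_le x y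
  have hcond : Subsingleton E ∨ Real.toNNReal (r⁻¹ * L) < ‖((ContinuousLinearEquiv.refl ℝ E).symm : E →L[ℝ] E)‖₊⁻¹ := by
    by_cases h : Subsingleton E
    · exact Or.inl h
    · right
      have := not_subsingleton_iff_nontrivial.1 h
      have h1 : ‖((ContinuousLinearEquiv.refl ℝ E).symm : E →L[ℝ] E)‖₊ = 1 := by
        rw [ContinuousLinearEquiv.refl_symm, ContinuousLinearEquiv.coe_refl]
        ext; simp
      rw [h1, inv_one]
      rw [← NNReal.coe_lt_coe, Real.coe_toNNReal _ (by positivity)]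
      simpa using hd2
  have hbij : Function.Bijective f := (happ.toHomeomorph f hcond).bijective
  have himg : Set.image f (ball (0:E) R) = ball (0:E) R := by
    apply Set.Subset.antisymm
    · rintro y ⟨x, hx, rfl⟩
      by_contra hcon
      have h1 : f (f x) = f x := by
        have h0 : f (f x) = f x + r⁻¹ • g (f x) := rfl
        rw [h0, hR _ hcon]; simp
      have h2 := hbij.1 h1
      rw [h2] at hcon; exact hcon hx
    · intro y hy
      obtain ⟨x, hx⟩ := hbij.2 y
      by_cases hxb : x ∈ ball (0:E) R
      · exact ⟨x, hxb, hx⟩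
      · exfalso
        have : f x = x := by simp [hf, hR x hxb]
        rw [this] at hx; rw [hx] at hxb; exact hxb hy
  have hcv := integral_image_eq_integral_abs_det_fderiv_smul μ (measurableSet_ball (x := (0:E)) (ε := R))
    (fun x _ => (hfd x).hasFDerivWithinAt) (hbij.1.injOn) (fun _ => (1:ℝ))
  rw [himg] at hcv
  simp only [smul_eq_mul, mul_one] at hcv
  rw [setIntegral_const, smul_eq_mul, mul_one] at hcv
  rw [hcv, ← integral_const_mul]
  refine setIntegral_congr_fun measurableSet_ball fun x _ => ?_
  have hp : 0 < (ContinuousLinearMap.id ℝ E + r⁻¹ • fderiv ℝ g x).det := by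
    apply hdet
    rw [dist_eq_norm, add_sub_cancel_left, norm_smul, Real.norm_of_nonneg (by positivity)]
    refine lt_of_le_of_lt ?_ hd1
    gcongr
    exact hnb x
  rw [abs_of_pos hp]
  have : r • ContinuousLinearMap.id ℝ E + fderiv ℝ g x = r • (ContinuousLinearMap.id ℝ E + r⁻¹ • fderiv ℝ g x) := by
    rw [smul_add, smul_smul, mul_inv_cancel₀ hr0.ne', one_smul]
  rw [this, ContinuousLinearMap.det, ContinuousLinearMap.toLinearMap_smul, LinearMap.det_smul,
    ← ContinuousLinearMap.det]

theorem null_lag [Nontrivial E] (g : E → E) (hg : ContDiff ℝ 1 g) (hc : HasCompactSupport g) :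
    ∫ x, (fderiv ℝ g x).det ∂μ = 0 := by
  obtain ⟨L, hL⟩ := hg.lipschitzWith_of_hasCompactSupport hc (by norm_num)
  obtain ⟨R, hR⟩ := (hc.isCompact.isBounded).subset_ball (0:E)
  have hR' : ∀ x, x ∉ ball (0:E) R → g x = 0 := fun x hx =>
    image_eq_zero_of_notMem_tsupport (fun h => hx (hR h))
  obtain ⟨r0, hr0, H⟩ := perturb_int μ g hg hR' L hL
  obtain ⟨c, hc1, hc2⟩ := det_interp (E := E) r0
  have hN : Module.finrank ℝ E ≠ 0 := Module.finrank_pos.ne'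
  have hcont : Continuous (fun x => fderiv ℝ g x) := hg.continuous_fderiv (by norm_num)
  have hset : ∫ x, (fderiv ℝ g x).det ∂μ = ∫ x in ball (0:E) R, (fderiv ℝ g x).det ∂μ := by
    rw [setIntegral_eq_integral_of_forall_compl_eq_zero]
    intro x hx
    have hx' : x ∉ tsupport g := fun h => hx (hR h)
    have : fderiv ℝ g x = 0 := by
      have := (notMem_tsupport_iff_eventuallyEq.1 hx').fderiv_eq (𝕜 := ℝ)
      rw [this]; simp
    rw [this, ContinuousLinearMap.det]
    simp only [ContinuousLinearMap.toLinearMap_zero]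
    exact LinearMap.det_zero'' (R := ℝ) (M := E)
  rw [hset]
  have : ∀ x, (fderiv ℝ g x).det = _ := fun x => hc1 (fderiv ℝ g x)
  rw [integral_congr_ae (Eventually.of_forall this), integral_finsetSum]
  · rw [zero_pow hN] at hc2
    calc _ = ∑ i ∈ Finset.range (Module.finrank ℝ E + 1), c i * (r0 + i) ^ (Module.finrank ℝ E) * μ.real (ball (0:E) R) := by
          refine Finset.sum_congr rfl fun i _ => ?_
          rw [integral_const_mul, H (r0 + i) (by simp), mul_assoc]
      _ = 0 := by rw [← Finset.sum_mul, ← hc2, zero_mul]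
  · intro i _
    apply Integrable.const_mul
    have : Continuous fun x => ((r0 + (i:ℝ)) • ContinuousLinearMap.id ℝ E + fderiv ℝ g x).det :=
      ContinuousLinearMap.continuous_det.comp (continuous_const.add hcont)
    exact (this.continuousOn.integrableOn_compact (isCompact_closedBall (0:E) R)).mono_set ball_subset_closedBall
end NullLag

section DetProd
variable {n : ℕ}

def bProd (n : ℕ) : Module.Basis (Fin n ⊕ Unit) ℝ (Euc n × ℝ) :=
  (EuclideanSpace.basisFun (Fin n) ℝ).toBasis.prod (Module.Basis.singleton Unit ℝ)

lemma toMatrix_prod (A : (Euc n × ℝ) →L[ℝ] Euc n) (B : (Euc n × ℝ) →L[ℝ] ℝ) :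
    LinearMap.toMatrix (bProd n) (bProd n) ((A.prod B : (Euc n × ℝ) →L[ℝ] (Euc n × ℝ)) : (Euc n × ℝ) →ₗ[ℝ] (Euc n × ℝ)) =
    Matrix.fromBlocks (Matrix.of fun i j => A (EuclideanSpace.single j 1, 0) i)
      (Matrix.of fun i _ => A (0, 1) i)
      (Matrix.of fun _ j => B (EuclideanSpace.single j 1, 0))
      (Matrix.of fun _ _ => B (0, 1)) := by
  ext i j
  rcases i with i | i <;> rcases j with j | j <;>
  simp [bProd, LinearMap.toMatrix_apply, Module.Basis.prod_apply]

lemma det_prod_eq (A : (Euc n × ℝ) →L[ℝ] Euc n) (B : (Euc n × ℝ) →L[ℝ] ℝ) :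
    (A.prod B).det = (Matrix.fromBlocks (Matrix.of fun i j => A (EuclideanSpace.single j 1, 0) i)
      (Matrix.of fun i (_ : Unit) => A (0, 1) i)
      (Matrix.of fun (_ : Unit) j => B (EuclideanSpace.single j 1, 0))
      (Matrix.of fun (_ : Unit) (_ : Unit) => B (0, 1))).det := by
  rw [← toMatrix_prod, LinearMap.det_toMatrix]

lemma det_prod_add (A : (Euc n × ℝ) →L[ℝ] Euc n) (B B' : (Euc n × ℝ) →L[ℝ] ℝ) :
    (A.prod (B + B')).det = (A.prod B).det + (A.prod B').det := by
  have key : ∀ B : (Euc n × ℝ) →L[ℝ] ℝ, (A.prod B).det =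
      ((Matrix.fromBlocks (Matrix.of fun i j => A (EuclideanSpace.single j 1, 0) i)
      (Matrix.of fun i (_ : Unit) => A (0, 1) i) 0 0).updateRow (Sum.inr ())
        (Sum.elim (fun j => B (EuclideanSpace.single j 1, 0)) (fun _ => B (0, 1)))).det := by
    intro B
    rw [det_prod_eq]
    congr 1
    ext i j
    rcases i with i | i <;> rcases j with j | j <;> simp [Matrix.updateRow_apply]
  rw [key, key, key, ← Matrix.det_updateRow_add]
  congr 2
  ext j
  rcases j with j | j <;> simp

lemma det_prod_smul (A : (Euc n × ℝ) →L[ℝ] Euc n) (B : (Euc n × ℝ) →L[ℝ] ℝ) (a c : ℝ) :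
    ((a • A).prod (c • B)).det = a ^ n * c * (A.prod B).det := by
  have : (((a • A).prod (c • B) : (Euc n × ℝ) →L[ℝ] (Euc n × ℝ)) : (Euc n × ℝ) →ₗ[ℝ] (Euc n × ℝ)) =
    (LinearMap.prodMap (a • LinearMap.id) (c • LinearMap.id)) ∘ₗ ((A.prod B : (Euc n × ℝ) →L[ℝ] (Euc n × ℝ)) : (Euc n × ℝ) →ₗ[ℝ] (Euc n × ℝ)) := by
    ext <;> simp
  rw [ContinuousLinearMap.det, this, LinearMap.det_comp, LinearMap.det_prodMap, LinearMap.det_smul, LinearMap.det_smul,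
    ← ContinuousLinearMap.det]
  simp

lemma det_jac (w : Euc n → Euc n) (x : Euc n) : (fderiv ℝ w x).det = (jacMat n w x).det := by
  rw [ContinuousLinearMap.det, ← LinearMap.det_toMatrix (EuclideanSpace.basisFun (Fin n) ℝ).toBasis]
  rfl

lemma det_prod_snd (A : (Euc n × ℝ) →L[ℝ] Euc n) :
    (A.prod (ContinuousLinearMap.snd ℝ (Euc n) ℝ)).det = (A.comp (ContinuousLinearMap.inl ℝ (Euc n) ℝ)).det := by
  rw [det_prod_eq]
  have h0 : (Matrix.of fun (_ : Unit) j => (ContinuousLinearMap.snd ℝ (Euc n) ℝ) (EuclideanSpace.single j 1, 0) : Matrix Unit (Fin n) ℝ) = 0 := by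
    ext; simp
  rw [h0, Matrix.det_fromBlocks_zero₂₁]
  rw [ContinuousLinearMap.det, ← LinearMap.det_toMatrix (EuclideanSpace.basisFun (Fin n) ℝ).toBasis]
  have h1 : (Matrix.of fun (_ : Unit) (_ : Unit) => (ContinuousLinearMap.snd ℝ (Euc n) ℝ) ((0 : Euc n), (1:ℝ)) : Matrix Unit Unit ℝ) = 1 := by
    ext; simp
  rw [h1, Matrix.det_one, mul_one]
  rfl
end DetProd

section IBP
variable {n : ℕ}

lemma fderiv_comp_apply {w : Euc n → Euc n} {x : Euc n} (hw : DifferentiableAt ℝ w x) (v : Euc n) (i : Fin n) :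
    fderiv ℝ (fun y => w y i) x v = fderiv ℝ w x v i := by
  have := (EuclideanSpace.proj (𝕜 := ℝ) i).hasFDerivAt.comp x hw.hasFDerivAt
  have h2 : HasFDerivAt (fun y => w y i) ((EuclideanSpace.proj (𝕜 := ℝ) i).comp (fderiv ℝ w x)) x := this
  rw [h2.fderiv]; simp

lemma jacMat_apply' {w : Euc n → Euc n} {x : Euc n} (hw : DifferentiableAt ℝ w x) (i j : Fin n) :
    jacMat n w x i j = fderiv ℝ (fun y => w y i) x (EuclideanSpace.single j 1) := by
  rw [fderiv_comp_apply hw]; rfl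

/-- Integration by parts for compactly supported maps. -/
lemma ibp (hn : 2 ≤ n) (w : Euc n → Euc n) (hw : ContDiff ℝ 1 w) (hwc : HasCompactSupport w)
    (φ : Euc n → ℝ) (hφ : ContDiff ℝ 1 φ) :
    ∫ x, (jacMat n w x).det * φ x = -∫ x, ∑ i, jvec n w x i * fderiv ℝ φ x (EuclideanSpace.single i 1) := by
  have : Nonempty (Fin n) := ⟨⟨0, by omega⟩⟩
  have hwd : ∀ x, DifferentiableAt ℝ w x := fun x => hw.differentiable (by norm_num) x
  have hφd : ∀ x, DifferentiableAt ℝ φ x := fun x => hφ.differentiable (by norm_num) x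
  have hwi : ∀ i, ContDiff ℝ 1 (fun y => w y i) := fun i => contDiff_euclidean.1 hw i
  have hwid : ∀ i x, DifferentiableAt ℝ (fun y => w y i) x := fun i x => (hwi i).differentiable (by norm_num) x
  set g : Fin n → Euc n → Euc n := fun i y => WithLp.toLp 2 (fun j => if j = i then φ y * w y i else w y j) with hg
  have hgC : ∀ i, ContDiff ℝ 1 (g i) := by
    intro i
    rw [contDiff_euclidean]
    intro j
    by_cases h : j = i
    · simp only [hg, h, if_true]; exact hφ.mul (hwi i)
    · simp only [hg, h, if_false]; exact hwi j
  have hgc : ∀ i, HasCompactSupport (g i) := by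
    intro i
    apply hwc.mono'
    refine (Function.support_subset_iff'.2 ?_)
    intro x hx
    have : w x = 0 := image_eq_zero_of_notMem_tsupport hx
    ext j
    simp [hg, this]
  have hdet : ∀ i x, (fderiv ℝ (g i) x).det = φ x * (jacMat n w x).det +
      ∑ j, w x i * (Matrix.adjugate (jacMat n w x) j i * fderiv ℝ φ x (EuclideanSpace.single j 1)) := by
    intro i x
    rw [det_jac]
    have hm : jacMat n (g i) x = (jacMat n w x).updateRow i
        (φ x • (jacMat n w x i) + w x i • (fun j => fderiv ℝ φ x (EuclideanSpace.single j 1))) := by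
      ext k j
      rw [jacMat_apply' ((hgC i).differentiable (by norm_num) x)]
      by_cases h : k = i
      · subst h
        simp only [Matrix.updateRow_self, hg, if_true, Pi.add_apply, Pi.smul_apply, smul_eq_mul]
        rw [fderiv_fun_mul (hφd x) (hwid k x), jacMat_apply' (hwd x)]
        simp
      · rw [Matrix.updateRow_ne h, jacMat_apply' (hwd x)]
        simp only [hg, h, if_false]
    rw [hm, Matrix.det_updateRow_add, Matrix.det_updateRow_smul, Matrix.det_updateRow_smul]
    congr 1
    · rw [Matrix.updateRow_eq_self]
    · rw [← Finset.mul_sum]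
      congr 1
      have hb : (fun j => fderiv ℝ φ x (EuclideanSpace.single j 1)) =
        ∑ j, (fderiv ℝ φ x (EuclideanSpace.single j 1)) • (Pi.single j (1:ℝ) : Fin n → ℝ) := by
        ext j; simp [Finset.sum_apply, Pi.single_apply]
      rw [← Matrix.cramer_transpose_apply, hb, map_sum, Finset.sum_apply]
      refine Finset.sum_congr rfl fun j _ => ?_
      rw [map_smul, Pi.smul_apply, Matrix.cramer_transpose_apply, ← Matrix.adjugate_apply]
      rw [smul_eq_mul, mul_comm]
  have hnt : Nontrivial (Euc n) := inferInstance
  have hz : ∀ i, ∫ x, (fderiv ℝ (g i) x).det = 0 := fun i => null_lag volume (g i) (hgC i) (hgc i)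
  have hgcont : ∀ i, Integrable (fun x => (fderiv ℝ (g i) x).det) := by
    intro i
    apply Continuous.integrable_of_hasCompactSupport
    · exact ContinuousLinearMap.continuous_det.comp ((hgC i).continuous_fderiv (by norm_num))
    · apply ((hgc i).fderiv (𝕜 := ℝ)).comp_left (g := fun A : Euc n →L[ℝ] Euc n => A.det)
      rw [ContinuousLinearMap.det, ContinuousLinearMap.toLinearMap_zero]
      exact LinearMap.det_zero'' (R := ℝ) (M := Euc n)
  have hsum : ∫ x, ∑ i, (fderiv ℝ (g i) x).det = 0 := by
    rw [integral_finsetSum _ (fun i _ => hgcont i)]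
    simp [hz]
  have hn0 : (n:ℝ) ≠ 0 := by positivity
  have hpt : ∀ x, ∑ i, (fderiv ℝ (g i) x).det = n * ((jacMat n w x).det * φ x +
      ∑ i, jvec n w x i * fderiv ℝ φ x (EuclideanSpace.single i 1)) := by
    intro x
    simp only [hdet, Finset.sum_add_distrib, Finset.sum_const, Finset.card_univ, Fintype.card_fin, nsmul_eq_mul, mul_add]
    congr 1
    · ring
    · rw [Finset.sum_comm, Finset.mul_sum]
      refine Finset.sum_congr rfl fun j _ => ?_
      simp only [jvec, Matrix.mulVec, dotProduct]
      rw [← mul_assoc, ← mul_assoc, mul_inv_cancel₀ hn0, one_mul, Finset.sum_mul]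
      refine Finset.sum_congr rfl fun i _ => by ring
  simp_rw [hpt] at hsum
  rw [integral_const_mul] at hsum
  have hsum' := (mul_eq_zero.1 hsum).resolve_left hn0
  have hi1 : Integrable (fun x => (jacMat n w x).det * φ x) := by
    have e : (fun x => (jacMat n w x).det * φ x) = fun x => (fderiv ℝ w x).det * φ x := by
      ext x; rw [det_jac]
    rw [e]
    apply Continuous.integrable_of_hasCompactSupport
    · exact (ContinuousLinearMap.continuous_det.comp (hw.continuous_fderiv (by norm_num))).mul hφ.continuous
    · apply HasCompactSupport.mul_right
      apply (hwc.fderiv (𝕜 := ℝ)).comp_left (g := fun A : Euc n →L[ℝ] Euc n => A.det)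
      rw [ContinuousLinearMap.det, ContinuousLinearMap.toLinearMap_zero]
      exact LinearMap.det_zero'' (R := ℝ) (M := Euc n)
  have hi2 : Integrable (fun x => ∑ i, jvec n w x i * fderiv ℝ φ x (EuclideanSpace.single i 1)) := by
    have h3 : Integrable (fun x => (n:ℝ)⁻¹ * ∑ i, (fderiv ℝ (g i) x).det - (jacMat n w x).det * φ x) :=
      ((integrable_finsetSum _ (fun i _ => hgcont i)).const_mul _).sub hi1
    refine h3.congr (Eventually.of_forall fun x => ?_)
    simp only [hpt]
    rw [← mul_assoc, inv_mul_cancel₀ hn0]; ring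
  rw [integral_add hi1 hi2] at hsum'
  linarith
end IBP

lemma exists_cutoff {E : Type*} [NormedAddCommGroup E] [NormedSpace ℝ E] [FiniteDimensional ℝ E] {S U : Set E}
    (hS : IsCompact S) (hU : IsOpen U) (hSU : S ⊆ U) :
    ∃ χ : E → ℝ, ContDiff ℝ 1 χ ∧ HasCompactSupport χ ∧ tsupport χ ⊆ U ∧ (∀ x, χ x ∈ Set.Icc (0:ℝ) 1) ∧
      ∀ x ∈ S, ∀ᶠ y in 𝓝 x, χ y = 1 := by
  obtain ⟨L, hL, hSL, hLU⟩ := exists_compact_between hS hU hSU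
  obtain ⟨f, hf1, hf2, hf3⟩ := exists_contMDiffMap_one_nhds_of_subset_interior (n := 1) (modelWithCornersSelf ℝ E)
    hS.isClosed hSL
  have hsub : tsupport f ⊆ L := by
    apply closure_minimal _ hL.isClosed
    intro x hx
    by_contra h
    exact hx (hf2 x h)
  refine ⟨f, f.contMDiff.contDiff, hL.of_isClosed_subset (isClosed_tsupport _) hsub, hsub.trans hLU, hf3, ?_⟩
  intro x hx
  exact eventually_nhdsSet_iff_forall.1 hf1 x hx

section HalfSpace
variable {n : ℕ}

lemma continuous_det_prod : Continuous (fun q : ((Euc n × ℝ) →L[ℝ] Euc n) × ((Euc n × ℝ) →L[ℝ] ℝ) => (q.1.prod q.2).det) := by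
  have h : Continuous (fun q : ((Euc n × ℝ) →L[ℝ] Euc n) × ((Euc n × ℝ) →L[ℝ] ℝ) => q.1.prod q.2) := by
    exact (ContinuousLinearMap.prodₗᵢ (𝕜 := ℝ) (E := Euc n × ℝ) (F := Euc n) (G := ℝ) ℝ).continuous
  exact ContinuousLinearMap.continuous_det.comp h

lemma det_prod_zero (A : (Euc n × ℝ) →L[ℝ] Euc n) : (A.prod (0 : (Euc n × ℝ) →L[ℝ] ℝ)).det = 0 := by
  have := det_prod_smul A 0 1 0
  simpa using this

/-- null Lagrangian where only the scalar part has compact support -/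
lemma null_lag_prod (W : Euc n × ℝ → Euc n) (hW : ContDiff ℝ 1 W) (Ψ : Euc n × ℝ → ℝ) (hΨ : ContDiff ℝ 1 Ψ)
    (hc : HasCompactSupport Ψ) :
    ∫ q, ((fderiv ℝ W q).prod (fderiv ℝ Ψ q)).det = 0 := by
  obtain ⟨R, hR⟩ := (hc.isCompact.isBounded).subset_closedBall (0 : Euc n × ℝ)
  obtain ⟨χ, hχ3, hχ2, -, -, hχ1⟩ := exists_cutoff hc.isCompact isOpen_univ (Set.subset_univ _)
  have hg : ContDiff ℝ 1 (fun q => (χ q • W q, Ψ q)) := (hχ3.smul hW).prodMk hΨ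
  have hgc : HasCompactSupport (fun q => (χ q • W q, Ψ q)) := by
    apply HasCompactSupport.of_support_subset_isCompact (hχ2.isCompact.union hc.isCompact)
    intro x hx
    by_contra h
    rw [Set.mem_union, not_or] at h
    apply hx
    simp [image_eq_zero_of_notMem_tsupport h.1, image_eq_zero_of_notMem_tsupport h.2]
  have : (volume : Measure (Euc n × ℝ)).IsAddHaarMeasure := by
    rw [Measure.volume_eq_prod]; infer_instance
  rw [← null_lag (volume : Measure (Euc n × ℝ)) _ hg hgc]
  congr 1
  ext q
  have hWd : DifferentiableAt ℝ W q := hW.differentiable (by norm_num) q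
  have hΨd : DifferentiableAt ℝ Ψ q := hΨ.differentiable (by norm_num) q
  have hχd : DifferentiableAt ℝ χ q := hχ3.differentiable (by norm_num) q
  rw [DifferentiableAt.fderiv_prodMk (hχd.fun_smul hWd) hΨd]
  by_cases hq : q ∈ tsupport Ψ
  · have : (fun q => χ q • W q) =ᶠ[𝓝 q] W := by
      filter_upwards [hχ1 q hq] with y hy
      rw [hy, one_smul]
    rw [this.fderiv_eq]
  · have : fderiv ℝ Ψ q = 0 := by
      have := (notMem_tsupport_iff_eventuallyEq.1 hq).fderiv_eq (𝕜 := ℝ)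
      rw [this]; simp
    rw [this, det_prod_zero, det_prod_zero]

lemma smoothTrans_contDiff : ContDiff ℝ 1 Real.smoothTransition := Real.smoothTransition.contDiff

lemma deriv_smoothTrans_zero {s : ℝ} (hs : s ∉ Set.Icc (0:ℝ) 1) : deriv Real.smoothTransition s = 0 := by
  rw [Set.mem_Icc, not_and_or, not_le, not_le] at hs
  rcases hs with h | h
  · have : Real.smoothTransition =ᶠ[𝓝 s] fun _ => 0 := by
      filter_upwards [gt_mem_nhds h] with y hy
      exact Real.smoothTransition.zero_of_nonpos (le_of_lt hy)
    rw [this.deriv_eq]; simp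
  · have : Real.smoothTransition =ᶠ[𝓝 s] fun _ => 1 := by
      filter_upwards [lt_mem_nhds h] with y hy
      exact Real.smoothTransition.one_of_one_le (le_of_lt hy)
    rw [this.deriv_eq]; simp

lemma integral_deriv_smoothTrans : ∫ s, deriv Real.smoothTransition s = 1 := by
  have h1 : ∫ s, deriv Real.smoothTransition s = ∫ s in (0:ℝ)..1, deriv Real.smoothTransition s := by
    rw [intervalIntegral.integral_of_le zero_le_one, ← integral_Icc_eq_integral_Ioc]
    rw [setIntegral_eq_integral_of_forall_compl_eq_zero]
    intro x hx; exact deriv_smoothTrans_zero hx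
  rw [h1, intervalIntegral.integral_deriv_eq_sub]
  · rw [Real.smoothTransition.one_of_one_le le_rfl, Real.smoothTransition.zero_of_nonpos le_rfl]; norm_num
  · intro x _; exact smoothTrans_contDiff.differentiable (by norm_num) x
  · exact (smoothTrans_contDiff.continuous_deriv (by norm_num)).intervalIntegrable _ _

lemma delta_limit (H : Euc n × ℝ → ℝ) (hH : Continuous H) (hHc : HasCompactSupport H) :
    Tendsto (fun k : ℕ => ∫ q : Euc n × ℝ, ((k+1:ℝ) * deriv Real.smoothTransition ((k+1) * q.2)) * H q) atTop
      (𝓝 (∫ x, H (x, 0))) := by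
  set ζ := deriv Real.smoothTransition with hζ
  have hζc : Continuous ζ := smoothTrans_contDiff.continuous_deriv (by norm_num)
  obtain ⟨C, hC⟩ := hH.bounded_above_of_compact_support hHc
  obtain ⟨R, hR⟩ := (hHc.isCompact.isBounded).subset_closedBall (0 : Euc n × ℝ)
  have hIntg : ∀ k : ℕ, ∫ q : Euc n × ℝ, ((k+1:ℝ) * ζ ((k+1) * q.2)) * H q =
      ∫ q : Euc n × ℝ, ζ q.2 * H (q.1, (k+1:ℝ)⁻¹ * q.2) := by
    intro k
    have hk : (0:ℝ) < k + 1 := by positivity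
    rw [Measure.volume_eq_prod, integral_prod, integral_prod]
    · congr 1
      ext x
      have := Measure.integral_comp_mul_left (fun s => ζ s * H (x, (k+1:ℝ)⁻¹ * s)) (k+1:ℝ)
      have e : ∀ t : ℝ, (k+1:ℝ)⁻¹ * ((k+1) * t) = t := fun t => by field_simp
      simp only [e] at this
      simp_rw [mul_assoc]
      rw [integral_const_mul, this, abs_of_pos (by positivity), smul_eq_mul, ← mul_assoc,
        mul_inv_cancel₀ hk.ne', one_mul]
    · rw [← Measure.volume_eq_prod]
      apply Continuous.integrable_of_hasCompactSupport (by fun_prop)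
      apply HasCompactSupport.of_support_subset_isCompact
        ((isCompact_closedBall (0 : Euc n) R).prod (isCompact_Icc (a := (0:ℝ)) (b := 1)))
      intro q hq
      rw [Function.mem_support] at hq
      have hq1 : ζ q.2 ≠ 0 := left_ne_zero_of_mul hq
      have hq2 := right_ne_zero_of_mul hq
      refine ⟨?_, by_contra fun h => hq1 (deriv_smoothTrans_zero h)⟩
      have := hR (subset_tsupport _ hq2)
      rw [mem_closedBall, dist_zero_right, Prod.norm_def] at this
      simpa using (le_max_left _ _).trans this
    · rw [← Measure.volume_eq_prod]
      apply Continuous.integrable_of_hasCompactSupport (by fun_prop)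
      exact hHc.mul_left
  simp_rw [hIntg]
  have hlim : ∫ x, H (x, 0) = ∫ q : Euc n × ℝ, ζ q.2 * H (q.1, 0) := by
    have := integral_prod_mul (μ := (volume : Measure (Euc n))) (ν := (volume : Measure ℝ)) (fun x => H (x, 0)) ζ
    rw [Measure.volume_eq_prod]
    rw [hζ, integral_deriv_smoothTrans, mul_one] at this
    rw [← this]
    congr 1; ext q; ring
  rw [hlim]
  apply tendsto_integral_of_dominated_convergence
    (fun q : Euc n × ℝ => |ζ q.2| * (closedBall (0 : Euc n) R).indicator (fun _ => C) q.1)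
  · intro k; exact (by fun_prop : Continuous fun q : Euc n × ℝ => ζ q.2 * H (q.1, (k+1:ℝ)⁻¹ * q.2)).aestronglyMeasurable
  · have h1 : Integrable (fun x : Euc n => (closedBall (0 : Euc n) R).indicator (fun _ => C) x) := by
      rw [integrable_indicator_iff measurableSet_closedBall]
      exact integrableOn_const (by exact measure_closedBall_lt_top.ne)
    have h2 : Integrable (fun s => |ζ s|) := by
      apply Continuous.integrable_of_hasCompactSupport (by fun_prop)
      apply HasCompactSupport.of_support_subset_isCompact (isCompact_Icc (a := (0:ℝ)) (b := 1))
      intro q hq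
      by_contra h
      exact hq (by simp [hζ, deriv_smoothTrans_zero h])
    have := h1.mul_prod h2
    rw [Measure.volume_eq_prod]
    refine this.congr (Eventually.of_forall fun q => ?_)
    simp only; ring
  · intro k
    refine Eventually.of_forall fun q => ?_
    rw [norm_mul, Real.norm_eq_abs]
    gcongr
    by_cases h : q.1 ∈ closedBall (0 : Euc n) R
    · rw [Set.indicator_of_mem h]; exact hC _
    · rw [Set.indicator_of_notMem h]
      have : H (q.1, (k+1:ℝ)⁻¹ * q.2) = 0 := by
        by_contra h2
        apply h
        have := hR (subset_tsupport _ h2)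
        rw [mem_closedBall, dist_zero_right, Prod.norm_def] at this
        simpa using (le_max_left _ _).trans this
      simp [this]
  · refine Eventually.of_forall fun q => ?_
    apply Tendsto.mul tendsto_const_nhds
    apply (hH.tendsto _).comp
    apply Tendsto.prodMk_nhds tendsto_const_nhds
    have : Tendsto (fun k : ℕ => ((k:ℝ)+1)⁻¹) atTop (𝓝 0) := tendsto_inv_atTop_zero.comp
      (tendsto_atTop_add_const_right _ _ tendsto_natCast_atTop_atTop)
    simpa using this.mul_const q.2

/-- Trace formula. -/
theorem half_space (W : Euc n × ℝ → Euc n) (hW : ContDiff ℝ 1 W) (Ψ : Euc n × ℝ → ℝ) (hΨ : ContDiff ℝ 1 Ψ)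
    (hc : HasCompactSupport Ψ) :
    ∫ x, (fderiv ℝ (fun y => W (y, 0)) x).det * Ψ (x, 0) =
      - ∫ q in {q : Euc n × ℝ | 0 < q.2}, ((fderiv ℝ W q).prod (fderiv ℝ Ψ q)).det := by
  set D : Euc n × ℝ → ℝ := fun q => ((fderiv ℝ W q).prod (fderiv ℝ Ψ q)).det with hD
  set H : Euc n × ℝ → ℝ := fun q => Ψ q * ((fderiv ℝ W q).comp (ContinuousLinearMap.inl ℝ (Euc n) ℝ)).det with hH
  have hWc : Continuous (fderiv ℝ W) := hW.continuous_fderiv (by norm_num)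
  have hΨc : Continuous (fderiv ℝ Ψ) := hΨ.continuous_fderiv (by norm_num)
  have hDc : Continuous D := continuous_det_prod.comp (hWc.prodMk hΨc)
  have hDs : HasCompactSupport D := by
    apply HasCompactSupport.of_support_subset_isCompact (hc.fderiv (𝕜 := ℝ)).isCompact
    intro q hq
    by_contra h
    apply hq
    have : fderiv ℝ Ψ q = 0 := image_eq_zero_of_notMem_tsupport h
    simp only [hD]; rw [this, det_prod_zero]
  have hHc : Continuous H := hΨ.continuous.mul (ContinuousLinearMap.continuous_det.comp (hWc.clm_comp continuous_const))
  have hHs : HasCompactSupport H := hc.mul_right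
  have hDi : Integrable D := hDc.integrable_of_hasCompactSupport hDs
  have hζc : Continuous (deriv Real.smoothTransition) := smoothTrans_contDiff.continuous_deriv (by norm_num)
  have key : ∀ k : ℕ, ∫ q : Euc n × ℝ, ((k+1:ℝ) * deriv Real.smoothTransition ((k+1) * q.2)) * H q =
      - ∫ q : Euc n × ℝ, Real.smoothTransition ((k+1) * q.2) * D q := by
    intro k
    have hz : ContDiff ℝ 1 (fun q : Euc n × ℝ => Real.smoothTransition ((k+1) * q.2)) :=
      smoothTrans_contDiff.comp (by fun_prop)
    have h := null_lag_prod W hW (fun q => Real.smoothTransition ((k+1) * q.2) * Ψ q)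
      (hz.mul hΨ) (hc.mul_left)
    have hpt : ∀ q, ((fderiv ℝ W q).prod (fderiv ℝ (fun q => Real.smoothTransition ((k+1) * q.2) * Ψ q) q)).det =
        ((k+1:ℝ) * deriv Real.smoothTransition ((k+1) * q.2)) * H q + Real.smoothTransition ((k+1) * q.2) * D q := by
      intro q
      have h1 : HasFDerivAt (fun q : Euc n × ℝ => ((k:ℝ)+1) * q.2) (((k:ℝ)+1) • ContinuousLinearMap.snd ℝ (Euc n) ℝ) q :=
        (hasFDerivAt_snd).const_mul _
      have h2 : HasFDerivAt (fun q : Euc n × ℝ => Real.smoothTransition ((k+1) * q.2))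
          (deriv Real.smoothTransition ((k+1) * q.2) • (((k:ℝ)+1) • ContinuousLinearMap.snd ℝ (Euc n) ℝ)) q := by
        have := (smoothTrans_contDiff.differentiable (by norm_num) ((k+1) * q.2)).hasDerivAt.comp_hasFDerivAt q h1
        exact this
      have h3 := h2.fun_mul (hΨ.differentiable (by norm_num) q).hasFDerivAt
      rw [h3.fderiv, det_prod_add]
      have a1 := det_prod_smul (fderiv ℝ W q) (fderiv ℝ Ψ q) 1 (Real.smoothTransition ((k+1) * q.2))
      have a2 := det_prod_smul (fderiv ℝ W q) (ContinuousLinearMap.snd ℝ (Euc n) ℝ) 1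
        (Ψ q * deriv Real.smoothTransition ((k+1) * q.2) * (k+1))
      rw [one_smul] at a1 a2
      rw [smul_smul, smul_smul, a1, a2, det_prod_snd]
      simp only [hH, hD]
      ring
    simp_rw [hpt] at h
    rw [integral_add] at h
    · linarith
    · apply Continuous.integrable_of_hasCompactSupport (by fun_prop)
      exact hHs.mul_left
    · apply Continuous.integrable_of_hasCompactSupport (hz.continuous.mul hDc)
      exact hDs.mul_left
  have hl1 := delta_limit H hHc hHs
  simp_rw [key] at hl1
  have hl2 : Tendsto (fun k : ℕ => ∫ q : Euc n × ℝ, Real.smoothTransition ((k+1) * q.2) * D q) atTop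
      (𝓝 (∫ q in {q : Euc n × ℝ | 0 < q.2}, D q)) := by
    have hm : MeasurableSet {q : Euc n × ℝ | 0 < q.2} := measurableSet_lt measurable_const measurable_snd
    rw [← integral_indicator hm]
    apply tendsto_integral_of_dominated_convergence (fun q => |D q|)
    · intro k
      exact ((Real.smoothTransition.continuous.comp (by fun_prop)).mul hDc).aestronglyMeasurable
    · exact hDi.abs
    · intro k
      refine Eventually.of_forall fun q => ?_
      rw [norm_mul, Real.norm_eq_abs, Real.norm_eq_abs, abs_of_nonneg (Real.smoothTransition.nonneg _)]
      exact mul_le_of_le_one_left (abs_nonneg _) (Real.smoothTransition.le_one _)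
    · refine Eventually.of_forall fun q => ?_
      by_cases hq : 0 < q.2
      · rw [Set.indicator_of_mem (by exact hq)]
        have ht : Tendsto (fun k : ℕ => ((k:ℝ)+1) * q.2) atTop atTop :=
          (tendsto_atTop_add_const_right _ _ tendsto_natCast_atTop_atTop).atTop_mul_const hq
        refine tendsto_const_nhds.congr' ?_
        filter_upwards [ht.eventually_ge_atTop 1] with k hk
        rw [Real.smoothTransition.one_of_one_le hk, one_mul]
      · rw [Set.indicator_of_notMem (by exact hq)]
        refine tendsto_const_nhds.congr ?_
        intro k
        rw [Real.smoothTransition.zero_of_nonpos, zero_mul]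
        have : (0:ℝ) ≤ k + 1 := by positivity
        nlinarith [not_lt.1 hq]
  have hu := tendsto_nhds_unique hl1 hl2.neg
  rw [← hu]
  congr 1
  ext x
  have : fderiv ℝ (fun y => W (y, 0)) x = (fderiv ℝ W (x, 0)).comp (ContinuousLinearMap.inl ℝ (Euc n) ℝ) := by
    have h1 : HasFDerivAt (fun y : Euc n => (y, (0:ℝ))) (ContinuousLinearMap.inl ℝ (Euc n) ℝ) x :=
      hasFDerivAt_prodMk_left x 0
    exact ((hW.differentiable (by norm_num) (x, 0)).hasFDerivAt.comp x h1).fderiv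
  rw [this]
  simp only [hH]; ring
end HalfSpace

/-- homogeneous functions: perturbation inequality -/
lemma homog_perturb {X Y : Type*} [NormedAddCommGroup X] [NormedSpace ℝ X] [FiniteDimensional ℝ X]
    [PseudoMetricSpace Y] (P : X × Y → ℝ) (hP : Continuous P) (p : ℕ) (hp : p ≠ 0)
    (hhom : ∀ (r : ℝ) a y, P (r • a, y) = r ^ p * P (a, y)) (S : Set Y) (hS : IsCompact S)
    (ε : ℝ) (hε : 0 < ε) :
    ∃ C : ℝ, 0 ≤ C ∧ ∀ a b, ∀ y ∈ S, |P (a, y) - P (b, y)| ≤ ε * ‖b‖ ^ p + C * ‖a - b‖ ^ p := by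
  have hK : IsCompact ((closedBall (0 : X) 2) ×ˢ S) := (isCompact_closedBall _ _).prod hS
  obtain ⟨M, hM⟩ := hK.exists_bound_of_continuousOn hP.continuousOn
  have huc := hK.uniformContinuousOn_of_continuous hP.continuousOn
  rw [Metric.uniformContinuousOn_iff_le] at huc
  obtain ⟨δ0, hδ0, huc⟩ := huc ε hε
  set δ := min δ0 1 with hδdef
  have hδ : 0 < δ := lt_min hδ0 one_pos
  have hscale : ∀ a : X, ∀ y ∈ S, |P (a, y)| ≤ |M| * ‖a‖ ^ p := by
    intro a y hy
    by_cases ha : a = 0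
    · have := hhom 0 a y
      rw [zero_smul, zero_pow hp, zero_mul] at this
      rw [ha, this]; simp [hp]
    · have hna : 0 < ‖a‖ := norm_pos_iff.2 ha
      have h1 := hhom ‖a‖ (‖a‖⁻¹ • a) y
      rw [smul_smul, mul_inv_cancel₀ hna.ne', one_smul] at h1
      rw [h1, abs_mul, abs_of_nonneg (by positivity : (0:ℝ) ≤ ‖a‖ ^ p), mul_comm]
      refine mul_le_mul_of_nonneg_right ?_ (by positivity)
      refine (hM (‖a‖⁻¹ • a, y) ⟨?_, hy⟩).trans (le_abs_self _)
      rw [mem_closedBall, dist_zero_right, norm_smul, norm_inv, norm_norm, inv_mul_cancel₀ hna.ne']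
      norm_num
  refine ⟨|M| * (1 + δ⁻¹) ^ p + |M| * (δ⁻¹) ^ p, by positivity, ?_⟩
  intro a b y hy
  by_cases hab : ‖a - b‖ ≤ δ * ‖b‖ ∧ b ≠ 0
  · obtain ⟨h1, h2⟩ := hab
    have hnb : 0 < ‖b‖ := norm_pos_iff.2 h2
    have e1 := hhom ‖b‖ (‖b‖⁻¹ • a) y
    have e2 := hhom ‖b‖ (‖b‖⁻¹ • b) y
    rw [smul_smul, mul_inv_cancel₀ hnb.ne', one_smul] at e1 e2
    have hd : ‖‖b‖⁻¹ • a - ‖b‖⁻¹ • b‖ ≤ δ := by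
      rw [← smul_sub, norm_smul, norm_inv, norm_norm, inv_mul_le_iff₀ hnb, mul_comm]; exact h1
    have hb1 : ‖‖b‖⁻¹ • b‖ = 1 := by
      rw [norm_smul, norm_inv, norm_norm, inv_mul_cancel₀ hnb.ne']
    have ha1 : ‖‖b‖⁻¹ • a‖ ≤ 2 := by
      have := norm_le_norm_add_norm_sub (‖b‖⁻¹ • b) (‖b‖⁻¹ • a)
      rw [norm_sub_rev] at this
      have h1 : δ ≤ 1 := min_le_right _ _
      linarith
    have := huc (‖b‖⁻¹ • a, y) ⟨by simpa using ha1, hy⟩ (‖b‖⁻¹ • b, y) ⟨by rw [mem_closedBall, dist_zero_right, hb1]; norm_num, hy⟩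
      (by rw [dist_prod_same_right, dist_eq_norm]; exact hd.trans (min_le_left _ _))
    rw [e1, e2, ← mul_sub, abs_mul, abs_of_nonneg (by positivity : (0:ℝ) ≤ ‖b‖ ^ p)]
    rw [Real.dist_eq] at this
    have h3 : ‖b‖ ^ p * |P (‖b‖⁻¹ • a, y) - P (‖b‖⁻¹ • b, y)| ≤ ‖b‖ ^ p * ε := by gcongr
    have h4 : 0 ≤ (|M| * (1 + δ⁻¹) ^ p + |M| * (δ⁻¹) ^ p) * ‖a - b‖ ^ p := by positivity
    linarith
  · have hb : ‖b‖ ≤ δ⁻¹ * ‖a - b‖ := by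
      rw [not_and_or, not_le, not_not] at hab
      rcases hab with h | h
      · rw [le_inv_mul_iff₀ hδ]; exact h.le
      · rw [h, norm_zero]; positivity
    have ha : ‖a‖ ≤ (1 + δ⁻¹) * ‖a - b‖ := by
      have := norm_le_norm_add_norm_sub b a
      rw [norm_sub_rev] at this
      rw [norm_sub_rev a b] at *
      nlinarith [norm_sub_rev a b]
    calc |P (a, y) - P (b, y)| ≤ |P (a, y)| + |P (b, y)| := abs_sub _ _
      _ ≤ |M| * ‖a‖ ^ p + |M| * ‖b‖ ^ p := add_le_add (hscale a y hy) (hscale b y hy)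
      _ ≤ |M| * ((1 + δ⁻¹) * ‖a - b‖) ^ p + |M| * (δ⁻¹ * ‖a - b‖) ^ p := by gcongr
      _ = (|M| * (1 + δ⁻¹) ^ p + |M| * (δ⁻¹) ^ p) * ‖a - b‖ ^ p := by rw [mul_pow, mul_pow]; ring
      _ ≤ _ := by
        have : 0 ≤ ε * ‖b‖ ^ p := by positivity
        linarith

lemma jensen_pow {α : Type*} [MeasurableSpace α] (μ : Measure α) (f : α → ENNReal) (hf : AEMeasurable f μ) (k : ℕ) :
    (∫⁻ x, f x ∂μ) ^ (k+1) ≤ μ Set.univ ^ k * ∫⁻ x, f x ^ (k+1) ∂μ := by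
  have h := eLpNorm'_le_eLpNorm'_mul_rpow_measure_univ (p := 1) (q := (k+1:ℝ)) (μ := μ) (f := f) one_pos
    (by linarith [Nat.cast_nonneg (α := ℝ) k]) hf.aestronglyMeasurable
  have h1 : eLpNorm' f 1 μ = ∫⁻ x, f x ∂μ := by simp [eLpNorm']
  have hk : (0:ℝ) < k + 1 := by positivity
  have e : ∀ x : ENNReal, x ^ (k+1) = x ^ ((k:ℝ)+1) := by
    intro x; rw [← ENNReal.rpow_natCast]; push_cast; rfl
  have h2 : eLpNorm' f (k+1:ℝ) μ = (∫⁻ x, f x ^ (k+1) ∂μ) ^ (1 / (k+1:ℝ)) := by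
    simp only [eLpNorm', enorm_eq_self, e]
  rw [h1, h2] at h
  calc (∫⁻ x, f x ∂μ) ^ (k+1) ≤ ((∫⁻ x, f x ^ (k+1) ∂μ) ^ (1 / (k+1:ℝ)) * μ Set.univ ^ ((1:ℝ) / 1 - 1 / (k+1:ℝ))) ^ (k+1) := by
        gcongr
    _ = μ Set.univ ^ k * ∫⁻ x, f x ^ (k+1) ∂μ := by
        rw [mul_pow, e, e, ← ENNReal.rpow_mul, ← ENNReal.rpow_mul, mul_comm]
        congr 1
        · rw [← ENNReal.rpow_natCast]; congr 1; field_simp; ring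
        · rw [one_div, inv_mul_cancel₀ hk.ne', ENNReal.rpow_one]


section Ext
variable {n : ℕ}

def bumpE (n : ℕ) : ContDiffBump (0 : Euc n) := ⟨1/2, 1, by norm_num, by norm_num⟩
def rho (n : ℕ) : Euc n → ℝ := (bumpE n).normed volume

lemma rho_contDiff : ContDiff ℝ 1 (rho n) := (bumpE n).contDiff_normed (n := 1)
lemma rho_nonneg (z : Euc n) : 0 ≤ rho n z := (bumpE n).nonneg_normed z
lemma rho_int : ∫ z, rho n z = 1 := (bumpE n).integral_normed
lemma rho_zero {z : Euc n} (hz : 1 ≤ ‖z‖) : rho n z = 0 := by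
  by_contra h
  have h1 : z ∈ Function.support (rho n) := h
  rw [rho, ContDiffBump.support_normed_eq] at h1
  have : ‖z‖ < 1 := by simpa [bumpE] using h1
  linarith
lemma rho_cs : HasCompactSupport (rho n) := (bumpE n).hasCompactSupport_normed
lemma rho_cont : Continuous (rho n) := rho_contDiff.continuous

variable {F : Type*} [NormedAddCommGroup F] [NormedSpace ℝ F] [FiniteDimensional ℝ F]

def ext (w : Euc n → F) (q : Euc n × ℝ) : F := ∫ z, rho n z • w (q.1 - q.2 • z)

lemma ext_integrable (w : Euc n → F) (hw : Continuous w) (x : Euc n) (t : ℝ) :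
    Integrable (fun z => rho n z • w (x - t • z)) := by
  apply Continuous.integrable_of_hasCompactSupport
  · have := rho_cont (n := n); fun_prop
  · exact rho_cs.smul_right

lemma ext_zero (w : Euc n → F) (x : Euc n) : ext w (x, 0) = w x := by
  simp [ext, integral_smul_const, rho_int]

lemma ext_sub (w v : Euc n → F) (hw : Continuous w) (hv : Continuous v) (q : Euc n × ℝ) :
    ext (fun y => w y - v y) q = ext w q - ext v q := by
  rw [ext, ext, ext, ← integral_sub (ext_integrable w hw _ _) (ext_integrable v hv _ _)]
  simp_rw [smul_sub]

lemma ext_const (c : F) (q : Euc n × ℝ) : ext (fun _ : Euc n => c) q = c := by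
  simp [ext, integral_smul_const, rho_int]

lemma ext_contDiff (w : Euc n → F) (hw : ContDiff ℝ 1 w) : ContDiff ℝ 1 (ext w) := by
  have h := contDiffOn_convolution_right_with_param (μ := (volume : Measure (Euc n))) (n := 1)
    (ContinuousLinearMap.lsmul ℝ ℝ : ℝ →L[ℝ] F →L[ℝ] F) (f := fun _ : Euc n => (1:ℝ))
    (g := fun (q : Euc n × ℝ) (z : Euc n) => rho n (-z) • w (q.1 + q.2 • z)) (s := Set.univ) (k := closedBall 0 1)
    isOpen_univ (isCompact_closedBall _ _) ?_ (locallyIntegrable_const _) ?_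
  · rw [Set.univ_prod_univ, contDiffOn_univ] at h
    have h2 : ContDiff ℝ 1 (fun q : Euc n × ℝ => (q, (0 : Euc n))) := by fun_prop
    have h3 := h.comp h2
    have e : ext w = ((fun q : (Euc n × ℝ) × Euc n =>
        convolution (fun _ : Euc n => (1:ℝ)) (fun z : Euc n => rho n (-z) • w (q.1.1 + q.1.2 • z))
          (ContinuousLinearMap.lsmul ℝ ℝ : ℝ →L[ℝ] F →L[ℝ] F) volume q.2) ∘ fun q => (q, 0)) := by
      ext1 q
      simp [ext, convolution, sub_eq_add_neg]
    rw [e]; exact h3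
  · intro q z _ hz
    rw [rho_zero, zero_smul]
    rw [norm_neg]
    simp at hz
    exact hz.le
  · apply ContDiff.contDiffOn
    change ContDiff ℝ 1 (fun p : (Euc n × ℝ) × Euc n => rho n (-p.2) • w (p.1.1 + p.1.2 • p.2))
    exact (rho_contDiff.comp (by fun_prop)).smul (hw.comp (by fun_prop))

def kfun (n : ℕ) (q : ℝ × Euc n) : ℝ := (q.1⁻¹)^n * rho n (q.1⁻¹ • q.2)

lemma kfun_contDiffOn : ContDiffOn ℝ 1 (kfun n) (Set.Ioi 0 ×ˢ Set.univ) := by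
  have h1 : ContDiffOn ℝ 1 (fun q : ℝ × Euc n => q.1⁻¹) (Set.Ioi 0 ×ˢ Set.univ) :=
    contDiff_fst.contDiffOn.inv (fun q hq => (ne_of_gt hq.1))
  exact (h1.pow n).mul (rho_contDiff.comp_contDiffOn (h1.smul contDiff_snd.contDiffOn))

lemma kfun_zero {t : ℝ} (ht : 0 < t) {z : Euc n} (hz : t ≤ ‖z‖) : kfun n (t, z) = 0 := by
  rw [kfun, rho_zero, mul_zero]
  rw [norm_smul, norm_inv, Real.norm_eq_abs, abs_of_pos ht, le_inv_mul_iff₀ ht, mul_one]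
  exact hz

lemma isOpen_ht : IsOpen (Set.Ioi (0:ℝ) ×ˢ (Set.univ : Set (Euc n))) := isOpen_Ioi.prod isOpen_univ

lemma kfun_fderiv_zero {t : ℝ} (ht : 0 < t) {z : Euc n} (hz : t < ‖z‖) : fderiv ℝ (kfun n) (t, z) = 0 := by
  have : kfun n =ᶠ[𝓝 (t, z)] fun _ => 0 := by
    have h1 : ∀ᶠ q : ℝ × Euc n in 𝓝 (t, z), 0 < q.1 := continuous_fst.continuousAt.eventually (lt_mem_nhds ht)
    have h2 : ∀ᶠ q : ℝ × Euc n in 𝓝 (t, z), q.1 < ‖q.2‖ :=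
      (continuous_fst.continuousAt).eventually_lt (continuous_snd.norm.continuousAt) hz
    filter_upwards [h1, h2] with q h1 h2
    exact kfun_zero h1 h2.le
  rw [this.fderiv_eq]; simp

lemma kfun_fderiv_bound : ∃ C : ℝ, 0 ≤ C ∧ ∀ t : ℝ, 0 < t → ∀ z : Euc n,
    ‖fderiv ℝ (kfun n) (t, z)‖ ≤ C * (t⁻¹)^(n+1) := by
  have hc : ContinuousOn (fderiv ℝ (kfun n)) (Set.Ioi 0 ×ˢ Set.univ) :=
    (kfun_contDiffOn (n := n)).continuousOn_fderiv_of_isOpen isOpen_ht (by norm_num)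
  have hK : IsCompact (({1} : Set ℝ) ×ˢ closedBall (0 : Euc n) 1) := isCompact_singleton.prod (isCompact_closedBall _ _)
  obtain ⟨C, hC⟩ := hK.exists_bound_of_continuousOn (hc.mono (by
    rintro ⟨a, b⟩ ⟨h1, h2⟩
    simp at h1; simp [h1]))
  refine ⟨|C|, abs_nonneg _, ?_⟩
  intro t ht z
  by_cases hz : t < ‖z‖
  · rw [kfun_fderiv_zero ht hz, norm_zero]; positivity
  have e : kfun n = fun q => (t⁻¹)^n • kfun n (t⁻¹ • q) := by
    ext q
    simp only [kfun, Prod.smul_fst, Prod.smul_snd, smul_eq_mul, mul_inv, inv_inv, smul_smul]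
    have h1 : t * q.1⁻¹ * t⁻¹ = q.1⁻¹ := by field_simp
    rw [h1, mul_pow, ← mul_assoc, ← mul_assoc, ← mul_pow, inv_mul_cancel₀ ht.ne', one_pow, one_mul]
  have hd : DifferentiableAt ℝ (kfun n) (t⁻¹ • (t, z)) := by
    have := (kfun_contDiffOn (n := n)).contDiffAt (x := t⁻¹ • (t, z)) (isOpen_ht.mem_nhds (by simp [ht]))
    exact this.differentiableAt (by norm_num)
  have h1 : HasFDerivAt (fun q => (t⁻¹)^n • kfun n (t⁻¹ • q))
      ((t⁻¹)^n • ((fderiv ℝ (kfun n) (t⁻¹ • (t, z))).comp (t⁻¹ • ContinuousLinearMap.id ℝ (ℝ × Euc n)))) (t, z) := by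
    apply HasFDerivAt.fun_const_smul
    exact hd.hasFDerivAt.comp (t, z) ((hasFDerivAt_id (𝕜 := ℝ) (t, z)).fun_const_smul t⁻¹)
  rw [e, h1.fderiv, norm_smul, norm_pow, norm_inv, Real.norm_eq_abs, abs_of_pos ht]
  have h2 : ‖fderiv ℝ (kfun n) (t⁻¹ • (t, z))‖ ≤ |C| := by
    refine (hC _ ?_).trans (le_abs_self _)
    simp only [Prod.smul_mk, smul_eq_mul, Set.mem_prod, Set.mem_singleton_iff, mem_closedBall, dist_zero_right]
    refine ⟨inv_mul_cancel₀ ht.ne', ?_⟩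
    rw [norm_smul, norm_inv, Real.norm_eq_abs, abs_of_pos ht, inv_mul_le_iff₀ ht]
    linarith
  have h3 : ‖(fderiv ℝ (kfun n) (t⁻¹ • (t, z))).comp (t⁻¹ • ContinuousLinearMap.id ℝ (ℝ × Euc n))‖ ≤ |C| * t⁻¹ := by
    refine (ContinuousLinearMap.opNorm_comp_le _ _).trans ?_
    gcongr
    rw [norm_smul, norm_inv, Real.norm_eq_abs, abs_of_pos ht]
    exact mul_le_of_le_one_right (by positivity) ContinuousLinearMap.norm_id_le
  calc _ ≤ t⁻¹ ^ n * (|C| * t⁻¹) := by gcongr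
    _ = _ := by rw [pow_succ]; ring

lemma ext_eq_conv (w : Euc n → F) {t : ℝ} (ht : 0 < t) (x : Euc n) :
    ext w (x, t) = ∫ y, kfun n (t, x - y) • w y := by
  have h1 : ∫ y, kfun n (t, x - y) • w y = ∫ y, kfun n (t, y) • w (x - y) := by
    rw [← integral_sub_left_eq_self _ volume x]
    simp
  rw [h1]
  have h2 := Measure.integral_comp_smul (volume : Measure (Euc n)) (fun y => kfun n (t, y) • w (x - y)) t
  have h3 : ∀ z, kfun n (t, t • z) = (t⁻¹)^n * rho n z := by
    intro z; simp only [kfun, smul_smul]; rw [inv_mul_cancel₀ ht.ne', one_smul]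
  simp only [h3, finrank_euclideanSpace, Fintype.card_fin] at h2
  simp_rw [mul_smul] at h2
  rw [integral_smul, abs_of_pos (by positivity), ← inv_pow] at h2
  exact smul_right_injective F (r := t⁻¹ ^ n) (by positivity) h2

lemma ext_fderiv_le_aux : ∃ C : ℝ, 0 ≤ C ∧ ∀ (f : Euc n → F), Continuous f → ∀ x : Euc n, ∀ t ∈ Set.Ioo (0:ℝ) 1,
    ‖fderiv ℝ (ext f) (x, t)‖ₑ ≤ ENNReal.ofReal (C * (t⁻¹)^(n+1)) * ∫⁻ y in closedBall x t, ‖f y‖ₑ ∧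
    ‖ext f (x, t)‖ₑ ≤ ENNReal.ofReal (C * (t⁻¹)^(n)) * ∫⁻ y in closedBall x t, ‖f y‖ₑ := by
  obtain ⟨C1, hC1, hb⟩ := kfun_fderiv_bound (n := n)
  obtain ⟨C2, hb2⟩ := rho_cs.exists_bound_of_continuous (rho_cont (n := n))
  refine ⟨max C1 C2, le_max_of_le_left hC1, ?_⟩
  intro f hf x t ht
  have aux : ∀ (G : Euc n → ENNReal) (c : ENNReal), (∀ y, ‖x - y‖ ≤ t → G y ≤ c * ‖f y‖ₑ) → (∀ y, t < ‖x - y‖ → G y = 0) →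
      ∫⁻ y, G y ≤ c * ∫⁻ y in closedBall x t, ‖f y‖ₑ := by
    intro G c h1 h2
    rw [← lintegral_const_mul _ hf.enorm.measurable, ← lintegral_indicator measurableSet_closedBall]
    apply lintegral_mono
    intro y
    by_cases hy : y ∈ closedBall x t
    · rw [Set.indicator_of_mem hy]
      apply h1
      rwa [mem_closedBall, dist_eq_norm, norm_sub_rev] at hy
    · rw [Set.indicator_of_notMem hy]
      rw [mem_closedBall, dist_eq_norm, norm_sub_rev, not_le] at hy
      rw [h2 y hy]
  constructor
  · set L : F →L[ℝ] ℝ →L[ℝ] F := (ContinuousLinearMap.lsmul ℝ ℝ).flip with hL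
    have h := hasFDerivAt_convolution_right_with_param (μ := (volume : Measure (Euc n))) L (f := f)
      (g := fun (t : ℝ) (z : Euc n) => kfun n (t, z)) (s := Set.Ioo 0 1) (k := closedBall 0 1)
      isOpen_Ioo (isCompact_closedBall _ _) (by
        intro s z hs hz
        apply kfun_zero hs.1
        simp at hz; linarith [hs.2]) hf.locallyIntegrable
      (by
        change ContDiffOn ℝ 1 (fun p : ℝ × Euc n => kfun n (p.1, p.2)) _
        exact kfun_contDiffOn.mono (Set.prod_mono (fun s hs => hs.1) subset_rfl)) (t, x) ht
    have hsw : HasFDerivAt (fun q : Euc n × ℝ => (q.2, q.1))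
        ((ContinuousLinearMap.snd ℝ (Euc n) ℝ).prod (ContinuousLinearMap.fst ℝ (Euc n) ℝ)) (x, t) :=
      hasFDerivAt_snd.prodMk hasFDerivAt_fst
    have h2 := HasFDerivAt.comp (x, t) h hsw
    have heq : ext f =ᶠ[𝓝 (x, t)] ((fun q : ℝ × Euc n => convolution f (fun z => kfun n (q.1, z)) L volume q.2) ∘
        fun q : Euc n × ℝ => (q.2, q.1)) := by
      have h1 : ∀ᶠ q : Euc n × ℝ in 𝓝 (x, t), 0 < q.2 := continuous_snd.continuousAt.eventually (lt_mem_nhds ht.1)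
      filter_upwards [h1] with q hq
      rw [show q = (q.1, q.2) from rfl, ext_eq_conv f hq]
      simp [convolution, hL]
    rw [heq.fderiv_eq, h2.fderiv]
    have h3 : ‖(ContinuousLinearMap.snd ℝ (Euc n) ℝ).prod (ContinuousLinearMap.fst ℝ (Euc n) ℝ)‖ ≤ 1 := by
      rw [ContinuousLinearMap.opNorm_prod]
      exact max_le (ContinuousLinearMap.norm_snd_le _ _ _) (ContinuousLinearMap.norm_fst_le _ _ _)
    set D := convolution f (fun z => fderiv ℝ (↿fun (t : ℝ) (z : Euc n) => kfun n (t, z)) ((t, x).1, z))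
      (ContinuousLinearMap.precompR (ℝ × Euc n) L) volume (t, x).2 with hD
    have h4 : ‖D.comp ((ContinuousLinearMap.snd ℝ (Euc n) ℝ).prod (ContinuousLinearMap.fst ℝ (Euc n) ℝ))‖ ≤ ‖D‖ := by
      refine (ContinuousLinearMap.opNorm_comp_le _ _).trans ?_
      exact mul_le_of_le_one_right (norm_nonneg _) h3
    refine (enorm_le_iff_norm_le.2 h4).trans ?_
    rw [hD, convolution]
    refine (enorm_integral_le_lintegral_enorm _).trans ?_
    have hk : (↿fun (t : ℝ) (z : Euc n) => kfun n (t, z)) = kfun n := rfl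
    simp only [hk]
    have hno : ∀ y, ‖(((ContinuousLinearMap.precompR (ℝ × Euc n)) L) (f y)) (fderiv ℝ (kfun n) (t, x - y))‖ ≤
        ‖fderiv ℝ (kfun n) (t, x - y)‖ * ‖f y‖ := by
      intro y
      apply ContinuousLinearMap.opNorm_le_bound _ (by positivity)
      intro h
      simp only [ContinuousLinearMap.precompR_apply, ContinuousLinearMap.compL_apply, ContinuousLinearMap.comp_apply, hL,
        ContinuousLinearMap.flip_apply, ContinuousLinearMap.lsmul_apply, norm_smul]
      calc _ ≤ (‖fderiv ℝ (kfun n) (t, x - y)‖ * ‖h‖) * ‖f y‖ := by gcongr; exact ContinuousLinearMap.le_opNorm _ _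
        _ = _ := by ring
    apply aux
    · intro y hy
      rw [← ofReal_norm, ← ofReal_norm, ← ENNReal.ofReal_mul (by have := ht.1; positivity)]
      apply ENNReal.ofReal_le_ofReal
      refine (hno y).trans ?_
      gcongr
      refine (hb t ht.1 _).trans ?_
      have := ht.1
      gcongr
      exact le_max_left _ _
    · intro y hy
      rw [kfun_fderiv_zero ht.1 hy]; simp
  · rw [ext_eq_conv f ht.1]
    refine (enorm_integral_le_lintegral_enorm _).trans ?_
    apply aux
    · intro y hy
      rw [enorm_smul]
      gcongr
      rw [← ofReal_norm]
      apply ENNReal.ofReal_le_ofReal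
      have := ht.1
      rw [kfun, norm_mul, norm_pow, norm_inv, Real.norm_eq_abs, abs_of_pos ht.1, mul_comm]
      gcongr
      exact (hb2 _).trans (le_max_right _ _)
    · intro y hy
      rw [kfun_zero ht.1 hy.le]; simp

lemma ext_fderiv_le : ∃ C : ℝ, 0 ≤ C ∧ ∀ (w : Euc n → F), ContDiff ℝ 1 w → ∀ x : Euc n, ∀ t ∈ Set.Ioo (0:ℝ) 1,
    ‖fderiv ℝ (ext w) (x, t)‖ₑ ≤ ENNReal.ofReal (C * (t⁻¹)^(n+1)) * ∫⁻ y in closedBall x t, ‖w y - w x‖ₑ ∧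
    ‖ext w (x, t)‖ₑ ≤ ‖w x‖ₑ + ENNReal.ofReal (C * (t⁻¹)^(n+1)) * ∫⁻ y in closedBall x t, ‖w y - w x‖ₑ := by
  obtain ⟨C, hC, h⟩ := ext_fderiv_le_aux (n := n) (F := F)
  refine ⟨C, hC, ?_⟩
  intro w hw x t ht
  have hcont := hw.continuous
  have h1 := h (fun y => w y - w x) (by fun_prop) x t ht
  have e : ext (fun y => w y - w x) = fun q => ext w q - w x := by
    ext1 q
    have := ext_sub w (fun _ => w x) hcont (by fun_prop) q
    rw [this, ext_const]
  rw [e] at h1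
  refine ⟨?_, ?_⟩
  · have := h1.1
    rwa [fderiv_sub_const] at this
  · calc ‖ext w (x, t)‖ₑ = ‖w x + (ext w (x,t) - w x)‖ₑ := by congr 1; abel
      _ ≤ ‖w x‖ₑ + ‖ext w (x,t) - w x‖ₑ := enorm_add_le _ _
      _ ≤ _ := by
        gcongr
        refine h1.2.trans ?_
        gcongr
        · have := ht.1; exact (one_le_inv₀ ht.1).2 ht.2.le
        · omega
end Ext

section Kest
variable {n : ℕ}

lemma lint_tail (m : ℕ) (hm : 1 ≤ m) (r : ℝ) (hr : 0 < r) :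
    ∫⁻ t in Set.Ioi r, ENNReal.ofReal ((t⁻¹)^(m+1)) ≤ (ENNReal.ofReal r ^ m)⁻¹ := by
  have hm' : (1:ℝ) ≤ m := by exact_mod_cast hm
  have ha : (-((m:ℝ)+1)) < -1 := by linarith
  have e : ∀ t ∈ Set.Ioi r, (t⁻¹)^(m+1) = t ^ (-((m:ℝ)+1)) := by
    intro t ht
    have : 0 < t := hr.trans ht
    rw [Real.rpow_neg this.le, inv_pow, ← Real.rpow_natCast]; push_cast; rfl
  have h1 : ∫⁻ t in Set.Ioi r, ENNReal.ofReal ((t⁻¹)^(m+1)) = ∫⁻ t in Set.Ioi r, ENNReal.ofReal (t ^ (-((m:ℝ)+1))) := by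
    apply setLIntegral_congr_fun measurableSet_Ioi
    intro t ht
    simp only [e t ht]
  rw [h1, ← ofReal_integral_eq_lintegral_ofReal (integrableOn_Ioi_rpow_of_lt ha hr), integral_Ioi_rpow_of_lt ha hr]
  · rw [← ENNReal.ofReal_pow hr.le, ← ENNReal.ofReal_inv_of_pos (by positivity)]
    apply ENNReal.ofReal_le_ofReal
    have : -((m:ℝ)+1) + 1 = -m := by ring
    rw [this, Real.rpow_neg hr.le, Real.rpow_natCast, neg_div_neg_eq]
    exact div_le_self (by positivity) hm'
  · filter_upwards [ae_restrict_mem measurableSet_Ioi] with t ht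
    have : 0 < t := hr.trans ht
    exact Real.rpow_nonneg this.le _

variable {F : Type*} [NormedAddCommGroup F]

/-- energy density -/
def eg (k : ℕ) (w : Euc n → F) (q : Euc n × Euc n) : ENNReal :=
  ‖w q.1 - w q.2‖ₑ ^ (k+1) / edist q.1 q.2 ^ (n+k)

/-- global near-diagonal energy -/
def globE (k : ℕ) (w : Euc n → F) : ENNReal :=
  ∫⁻ x, ∫⁻ y, if dist y x < 1 then eg k w (x, y) else 0

lemma inner_t (k : ℕ) (hn : 1 ≤ n) (w : Euc n → F) (x y : Euc n) :
    ∫⁻ t in Set.Ioo (0:ℝ) 1, (if dist y x ≤ t then ENNReal.ofReal ((t⁻¹)^(n+k+1)) * ‖w y - w x‖ₑ ^ (k+1) else 0)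
      ≤ if dist y x < 1 then eg k w (x, y) else 0 := by
  by_cases h0 : y = x
  · subst h0; simp
  have hr : 0 < dist y x := dist_pos.2 h0
  split_ifs with h
  · calc _ = ∫⁻ t in Set.Ioo (0:ℝ) 1, (if dist y x ≤ t then ENNReal.ofReal ((t⁻¹)^(n+k+1)) else 0) * ‖w y - w x‖ₑ ^ (k+1) := by
          congr 1; ext t; split_ifs <;> simp
      _ = (∫⁻ t in Set.Ioo (0:ℝ) 1, (if dist y x ≤ t then ENNReal.ofReal ((t⁻¹)^(n+k+1)) else 0)) * ‖w y - w x‖ₑ ^ (k+1) := by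
          rw [lintegral_mul_const]
          exact Measurable.ite (measurableSet_le measurable_const measurable_id) (by fun_prop) measurable_const
      _ ≤ (∫⁻ t in Set.Ioi (dist y x), ENNReal.ofReal ((t⁻¹)^(n+k+1))) * ‖w y - w x‖ₑ ^ (k+1) := by
          refine mul_le_mul_left ?_ _
          rw [setLIntegral_congr (Ioi_ae_eq_Ici (a := dist y x)), ← lintegral_indicator measurableSet_Ici]
          refine (setLIntegral_le_lintegral _ _).trans (lintegral_mono fun t => ?_)
          by_cases ht : dist y x ≤ t
          · simp [ht]
          · simp [ht]
      _ ≤ (ENNReal.ofReal (dist y x) ^ (n+k))⁻¹ * ‖w y - w x‖ₑ ^ (k+1) := by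
          gcongr
          exact lint_tail _ (by omega) _ hr
      _ = eg k w (x, y) := by
          simp only [eg]
          rw [ENNReal.div_eq_inv_mul, ← edist_dist, edist_comm x y, ← enorm_neg (w y - w x), neg_sub]
  · apply le_of_eq
    rw [setLIntegral_congr_fun (g := fun _ => 0) measurableSet_Ioo]
    · simp
    · intro t ht
      rw [not_lt] at h
      have : ¬ dist y x ≤ t := by have := ht.2; linarith
      simp [this]

lemma K_est (k : ℕ) (hn : 1 ≤ n) (c : ℝ) (hc : 0 ≤ c) : ∃ C : ENNReal, C ≠ ⊤ ∧ ∀ (w : Euc n → F), Continuous w →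
    ∫⁻ q in {q : Euc n × ℝ | q.2 ∈ Set.Ioo (0:ℝ) 1}, (ENNReal.ofReal (c * (q.2⁻¹)^(n+1)) *
      ∫⁻ y in closedBall q.1 q.2, ‖w y - w q.1‖ₑ)^(k+1) ≤ C * globE k w := by
  set V := volume (ball (0 : Euc n) 1) with hV
  refine ⟨ENNReal.ofReal (c^(k+1)) * V ^ k, ENNReal.mul_ne_top ENNReal.ofReal_ne_top (ENNReal.pow_ne_top measure_ball_lt_top.ne), ?_⟩
  intro w hw
  set C := ENNReal.ofReal (c^(k+1)) * V ^ k with hC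
  set f : Euc n → Euc n → ENNReal := fun x y => ‖w y - w x‖ₑ ^ (k+1) with hf
  have hpt : ∀ x : Euc n, ∀ t ∈ Set.Ioo (0:ℝ) 1, (ENNReal.ofReal (c * (t⁻¹)^(n+1)) *
      ∫⁻ y in closedBall x t, ‖w y - w x‖ₑ)^(k+1) ≤ C * ∫⁻ y, (if dist y x ≤ t then ENNReal.ofReal ((t⁻¹)^(n+k+1)) * f x y else 0) := by
    intro x t ht
    have ht0 := ht.1
    have h1 := jensen_pow (volume.restrict (closedBall x t)) (fun y => ‖w y - w x‖ₑ)
      (by exact (hw.sub continuous_const).enorm.measurable.aemeasurable) k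
    rw [Measure.restrict_apply_univ, Measure.addHaar_closedBall _ _ ht0.le, finrank_euclideanSpace, Fintype.card_fin] at h1
    have h2 : ∫⁻ y, (if dist y x ≤ t then ENNReal.ofReal ((t⁻¹)^(n+k+1)) * f x y else 0) =
        ENNReal.ofReal ((t⁻¹)^(n+k+1)) * ∫⁻ y in closedBall x t, f x y := by
      have hm : Measurable (f x) := ((hw.sub continuous_const).enorm.measurable.pow_const _)
      rw [← lintegral_const_mul _ hm, ← lintegral_indicator measurableSet_closedBall]
      rfl
    rw [h2, mul_pow]
    calc _ ≤ ENNReal.ofReal (c * t⁻¹ ^ (n + 1)) ^ (k+1) * ((ENNReal.ofReal (t ^ n) * V) ^ k * ∫⁻ y in closedBall x t, f x y) := by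
          gcongr
      _ = (ENNReal.ofReal (c * t⁻¹ ^ (n + 1)) ^ (k+1) * ENNReal.ofReal (t ^ n) ^ k) * V ^ k * ∫⁻ y in closedBall x t, f x y := by
          rw [mul_pow]; ring
      _ = (ENNReal.ofReal (c^(k+1)) * ENNReal.ofReal ((t⁻¹)^(n+k+1))) * V ^ k * ∫⁻ y in closedBall x t, f x y := by
          congr 2
          rw [← ENNReal.ofReal_pow (by positivity), ← ENNReal.ofReal_pow (by positivity),
            ← ENNReal.ofReal_mul (by positivity), ← ENNReal.ofReal_mul (by positivity)]
          congr 1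
          rw [mul_pow, mul_assoc]
          congr 1
          rw [← pow_mul, ← pow_mul, show (n+1)*(k+1) = (n+k+1) + n*k by ring, pow_add, mul_assoc, ← mul_pow,
            inv_mul_cancel₀ ht0.ne', one_pow, mul_one]
      _ = _ := by rw [hC]; ring
  have hmeas : Measurable (fun p : (Euc n × ℝ) × Euc n => if dist p.2 p.1.1 ≤ p.1.2 then
      ENNReal.ofReal ((p.1.2⁻¹)^(n+k+1)) * f p.1.1 p.2 else 0) := by
    apply Measurable.ite (measurableSet_le (by fun_prop) (by fun_prop)) _ measurable_const
    apply Measurable.fun_mul (by fun_prop)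
    exact (((hw.comp continuous_snd).sub (hw.comp (continuous_fst.comp continuous_fst))).enorm.measurable.pow_const _)
  have hset : {q : Euc n × ℝ | q.2 ∈ Set.Ioo (0:ℝ) 1} = Set.univ ×ˢ Set.Ioo (0:ℝ) 1 := by ext; simp
  have hms : MeasurableSet {q : Euc n × ℝ | q.2 ∈ Set.Ioo (0:ℝ) 1} := by
    rw [hset]; exact MeasurableSet.univ.prod measurableSet_Ioo
  calc _ ≤ ∫⁻ q in {q : Euc n × ℝ | q.2 ∈ Set.Ioo (0:ℝ) 1}, C * ∫⁻ y, (if dist y q.1 ≤ q.2 then ENNReal.ofReal ((q.2⁻¹)^(n+k+1)) * f q.1 y else 0) :=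
        setLIntegral_mono' hms fun q hq => hpt q.1 q.2 hq
    _ = C * ∫⁻ q in {q : Euc n × ℝ | q.2 ∈ Set.Ioo (0:ℝ) 1}, ∫⁻ y, (if dist y q.1 ≤ q.2 then ENNReal.ofReal ((q.2⁻¹)^(n+k+1)) * f q.1 y else 0) := by
        rw [lintegral_const_mul]
        exact hmeas.lintegral_prod_right'
    _ = C * ∫⁻ x, ∫⁻ t in Set.Ioo (0:ℝ) 1, ∫⁻ y, (if dist y x ≤ t then ENNReal.ofReal ((t⁻¹)^(n+k+1)) * f x y else 0) := by
        rw [hset, Measure.volume_eq_prod, ← Measure.prod_restrict, lintegral_prod, Measure.restrict_univ]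
        exact hmeas.lintegral_prod_right'.aemeasurable
    _ = C * ∫⁻ x, ∫⁻ y, ∫⁻ t in Set.Ioo (0:ℝ) 1, (if dist y x ≤ t then ENNReal.ofReal ((t⁻¹)^(n+k+1)) * f x y else 0) := by
        congr 2
        ext x
        apply lintegral_lintegral_swap
        exact (hmeas.comp (f := fun p : ℝ × Euc n => ((x, p.1), p.2)) (by fun_prop)).aemeasurable
    _ ≤ _ := by
        gcongr
        exact lintegral_mono fun x => lintegral_mono fun y => inner_t k hn w x y
end Kest

lemma pow_add3 (a b c : ENNReal) (p : ℕ) : (a + b + c) ^ p ≤ 3 ^ p * (a ^ p + b ^ p + c ^ p) := by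
  have h : ∃ m, (m = a ∨ m = b ∨ m = c) ∧ a ≤ m ∧ b ≤ m ∧ c ≤ m := by
    refine ⟨max a (max b c), ?_, le_max_left _ _, (le_max_left _ _).trans (le_max_right _ _), (le_max_right _ _).trans (le_max_right _ _)⟩
    rcases max_choice a (max b c) with h | h
    · exact Or.inl h
    · rcases max_choice b c with h' | h'
      · exact Or.inr (Or.inl (h.trans h'))
      · exact Or.inr (Or.inr (h.trans h'))
  obtain ⟨m, hm, ha, hb, hc⟩ := h
  calc (a + b + c) ^ p ≤ (m + m + m) ^ p := by gcongr
    _ = 3 ^ p * m ^ p := by rw [← mul_pow]; ring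
    _ ≤ _ := by
      gcongr
      rcases hm with rfl | rfl | rfl
      · rw [add_assoc]; exact le_self_add
      · rw [add_assoc, add_left_comm]; exact le_self_add
      · exact le_add_self

lemma pow_add2 (a b : ENNReal) (p : ℕ) : (a + b) ^ (p+1) ≤ 3 ^ (p+1) * (a ^ (p+1) + b ^ (p+1)) := by
  have := pow_add3 a b 0 (p+1)
  simpa using this

section Cut
variable {n : ℕ}

/-- singular kernel -/
def sker (n : ℕ) (R : ℝ) : Euc n → ENNReal := (ball (0 : Euc n) R).indicator (fun z => (‖z‖ₑ^(n-1))⁻¹)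

lemma sker_meas (R : ℝ) : Measurable (sker n R) :=
  Measurable.indicator (by fun_prop) measurableSet_ball

lemma sker_fin (hn : 2 ≤ n) (R : ℝ) : ∫⁻ z, sker n R z ≠ ⊤ := by
  have : Nontrivial (Euc n) := by
    have : Nonempty (Fin n) := ⟨⟨0, by omega⟩⟩
    infer_instance
  have h := (integrableOn_fun_norm_addHaar (volume : Measure (Euc n)) (f := fun r : ℝ => (r^(n-1))⁻¹) (r := R)).2 (by
    simp only [finrank_euclideanSpace, Fintype.card_fin, smul_eq_mul]
    have : IntegrableOn (fun _ : ℝ => (1:ℝ)) (Set.Ioo 0 R) := integrableOn_const (by simp)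
    refine this.congr_fun ?_ measurableSet_Ioo
    intro y hy
    have := hy.1
    simp only
    rw [mul_inv_cancel₀ (by positivity)])
  have h2 := h.2
  rw [HasFiniteIntegral] at h2
  rw [sker, lintegral_indicator measurableSet_ball]
  refine ne_of_lt (lt_of_eq_of_lt ?_ h2)
  apply lintegral_congr_ae
  have h0 : ∀ᵐ z : Euc n ∂(volume.restrict (ball (0 : Euc n) R)), z ≠ 0 := by
    apply ae_restrict_of_ae
    exact (measure_eq_zero_iff_ae_notMem.1 (measure_singleton (0 : Euc n)))
  filter_upwards [h0] with z hz
  have hz' : 0 < ‖z‖ := norm_pos_iff.2 hz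
  rw [Real.enorm_of_nonneg (by positivity), ENNReal.ofReal_inv_of_pos (by positivity), ENNReal.ofReal_pow hz'.le, ofReal_norm]

variable {F : Type*} [NormedAddCommGroup F]

def NL (k : ℕ) (Ω : Set (Euc n)) (w : Euc n → F) : ENNReal := ∫⁻ x in Ω, ‖w x‖ₑ ^ (k+1)
def NE (k : ℕ) (Ω : Set (Euc n)) (w : Euc n → F) : ENNReal :=
  ∫⁻ q, eg k w q ∂((volume.restrict Ω).prod (volume.restrict Ω))
def NN (k : ℕ) (Ω : Set (Euc n)) (w : Euc n → F) : ENNReal := NL k Ω w + NE k Ω w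

lemma eg_aemeas (k : ℕ) {μ : Measure (Euc n)} {w : Euc n → F} (hw : AEStronglyMeasurable w μ) :
    AEMeasurable (eg k w) (μ.prod μ) := by
  unfold eg
  apply AEMeasurable.div
  · exact ((hw.comp_fst (ν := μ)).sub (hw.comp_snd (μ := μ))).enorm.pow_const _
  · exact (by fun_prop : Measurable fun q : Euc n × Euc n => edist q.1 q.2 ^ (n+k)).aemeasurable

lemma eg_self (k : ℕ) (w : Euc n → F) (x : Euc n) : eg k w (x, x) = 0 := by simp [eg]

/-- `r^{k+1} / r^{n+k} = r^{-(n-1)}` -/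
lemma edist_pow_div (hn : 1 ≤ n) (k : ℕ) {x y : Euc n} (h : x ≠ y) :
    edist x y ^ (k+1) / edist x y ^ (n+k) = (edist x y ^ (n-1))⁻¹ := by
  have h0 : edist x y ≠ 0 := by simpa using h
  have h1 : edist x y ≠ ⊤ := edist_ne_top _ _
  have e : n + k = (k+1) + (n-1) := by omega
  rw [e, pow_add _ (k+1) (n-1), ENNReal.div_eq_inv_mul, ENNReal.mul_inv (Or.inl (pow_ne_zero _ h0)) (Or.inl (ENNReal.pow_ne_top h1)), mul_comm, ← mul_assoc,
    ENNReal.mul_inv_cancel (pow_ne_zero _ h0) (ENNReal.pow_ne_top h1), one_mul]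

lemma lintegral_prod_conv1 (f d : Euc n → ENNReal) (hf : AEMeasurable f) (hd : Measurable d) :
    ∫⁻ q : Euc n × Euc n, f q.1 * d (q.1 - q.2) ∂(volume.prod volume) = (∫⁻ x, f x) * ∫⁻ z, d z := by
  rw [lintegral_prod]
  · have : ∀ x, ∫⁻ y, f x * d (x - y) = f x * ∫⁻ z, d z := by
      intro x
      rw [lintegral_const_mul _ (by fun_prop), lintegral_sub_left_eq_self]
    simp only [this]
    rw [lintegral_mul_const'' _ hf]
  · exact (hf.comp_fst).mul (by fun_prop)

lemma lintegral_prod_conv2 (f d : Euc n → ENNReal) (hf : AEMeasurable f) (hd : Measurable d) :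
    ∫⁻ q : Euc n × Euc n, f q.2 * d (q.1 - q.2) ∂(volume.prod volume) = (∫⁻ x, f x) * ∫⁻ z, d z := by
  rw [lintegral_prod_symm]
  · have : ∀ y, ∫⁻ x, f y * d (x - y) = f y * ∫⁻ z, d z := by
      intro x
      rw [lintegral_const_mul _ (by fun_prop), lintegral_sub_right_eq_self]
    simp only [this]
    rw [lintegral_mul_const'' _ hf]
  · exact (hf.comp_snd).mul (by fun_prop)

variable [NormedSpace ℝ F]

lemma cutoff_est (hn : 2 ≤ n) (k : ℕ) {Ω : Set (Euc n)} (hΩ : MeasurableSet Ω) (χ : Euc n → ℝ) (hχ : ContDiff ℝ 1 χ)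
    (hχc : HasCompactSupport χ) (hχΩ : tsupport χ ⊆ Ω) (hχ1 : ∀ x, χ x ∈ Set.Icc (0:ℝ) 1) :
    ∃ C : ENNReal, C ≠ ⊤ ∧ ∀ w : Euc n → F, AEStronglyMeasurable w (volume.restrict Ω) →
      globE k (fun x => χ x • w x) ≤ C * NN k Ω w := by
  classical
  obtain ⟨L, hL⟩ := hχ.lipschitzWith_of_hasCompactSupport hχc (by norm_num)
  have hz : ∀ x, x ∉ Ω → χ x = 0 := fun x hx => image_eq_zero_of_notMem_tsupport fun h => hx (hχΩ h)
  set d := sker n 1 with hd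
  have hdf : ∫⁻ z, d z ≠ ⊤ := sker_fin hn 1
  refine ⟨3^(k+1) * (1 + L^(k+1) * (2 * ∫⁻ z, d z)), by finiteness, ?_⟩
  intro w hw
  set f : Euc n → ENNReal := Ω.indicator (fun x => ‖w x‖ₑ ^ (k+1)) with hf
  have hfm : AEMeasurable f := (aemeasurable_indicator_iff hΩ).2 (hw.enorm.pow_const _)
  set g : Euc n × Euc n → ENNReal := (Ω ×ˢ Ω).indicator (eg k w) with hg
  have hgm : AEMeasurable g (volume.prod volume) := by
    rw [hg, aemeasurable_indicator_iff (hΩ.prod hΩ), ← Measure.prod_restrict]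
    exact eg_aemeas k hw
  have hfm1 : AEMeasurable (fun q : Euc n × Euc n => f q.1 * d (q.1 - q.2)) (volume.prod volume) :=
    (hfm.comp_fst).mul (by have := sker_meas (n := n) 1; fun_prop)
  have hfm2 : AEMeasurable (fun q : Euc n × Euc n => f q.2 * d (q.1 - q.2)) (volume.prod volume) :=
    (hfm.comp_snd).mul (by have := sker_meas (n := n) 1; fun_prop)
  set G : Euc n × Euc n → ENNReal := fun q => 3^(k+1) * (g q + L^(k+1) * (f q.1 * d (q.1 - q.2) + f q.2 * d (q.1 - q.2))) with hG
  have hGm : AEMeasurable G (volume.prod volume) := (hgm.add ((hfm1.add hfm2).const_mul _)).const_mul _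
  have hpt : ∀ x y, (if dist y x < 1 then eg k (fun x => χ x • w x) (x, y) else 0) ≤ G (x, y) := by
    intro x y
    split_ifs with h
    swap; · exact zero_le
    by_cases hxy : x = y
    · subst hxy; rw [eg_self]; exact zero_le
    have hdd : d (x - y) = (edist x y ^ (n-1))⁻¹ := by
      rw [hd, sker, Set.indicator_of_mem]
      · rw [edist_eq_enorm_sub]
      · rw [mem_ball, dist_zero_right, ← dist_eq_norm, dist_comm]; exact h
    have hLL : ‖χ x - χ y‖ₑ ≤ L * edist x y := by rw [← edist_eq_enorm_sub]; exact hL x y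
    have hle1 : ‖χ x‖ₑ ≤ 1 := by
      rw [Real.enorm_of_nonneg (hχ1 x).1]; exact ENNReal.ofReal_le_one.2 (hχ1 x).2
    set A : ENNReal := if x ∈ Ω ∧ y ∈ Ω then ‖w x - w y‖ₑ else 0 with hA
    set Bx : ENNReal := Ω.indicator (fun x => ‖w x‖ₑ) x with hBx
    set By : ENNReal := Ω.indicator (fun x => ‖w x‖ₑ) y with hBy
    have hmain : ‖χ x • w x - χ y • w y‖ₑ ≤ A + L * edist x y * Bx + L * edist x y * By := by
      by_cases hx : x ∈ Ω
      · by_cases hy : y ∈ Ω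
        · have e : χ x • w x - χ y • w y = χ x • (w x - w y) + (χ x - χ y) • w y := by
            rw [smul_sub, sub_smul]; abel
          rw [e, hA, if_pos ⟨hx, hy⟩, hBy, Set.indicator_of_mem hy]
          refine (enorm_add_le _ _).trans ?_
          rw [enorm_smul, enorm_smul, add_right_comm]
          refine le_trans ?_ le_self_add
          gcongr
          exact mul_le_of_le_one_left' hle1
        · have e : χ x • w x - χ y • w y = (χ x - χ y) • w x := by rw [hz y hy]; simp
          rw [e, enorm_smul, hBx, Set.indicator_of_mem hx, add_assoc, add_left_comm]
          refine le_trans ?_ le_self_add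
          gcongr
      · by_cases hy : y ∈ Ω
        · have e : χ x • w x - χ y • w y = (χ x - χ y) • w y := by rw [hz x hx]; simp
          rw [e, enorm_smul, hBy, Set.indicator_of_mem hy]
          refine le_trans ?_ le_add_self
          gcongr
        · rw [hz x hx, hz y hy]; simp
    have hp := (pow_le_pow_left₀ zero_le hmain (k+1)).trans (pow_add3 _ _ _ (k+1))
    have hAg : A ^ (k+1) / edist x y ^ (n+k) = g (x, y) := by
      by_cases hm : x ∈ Ω ∧ y ∈ Ω
      · rw [hA, if_pos hm, hg, Set.indicator_of_mem (by exact hm)]; rfl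
      · rw [hA, if_neg hm, hg, Set.indicator_of_notMem (by exact hm)]; simp
    have hBf : ∀ z, (L * edist x y * (Ω.indicator (fun x => ‖w x‖ₑ) z))^(k+1) / edist x y ^ (n+k) = L^(k+1) * (f z * d (x - y)) := by
      intro z
      rw [hdd, ← edist_pow_div (by omega) k hxy, mul_pow, mul_pow]
      have : f z = (Ω.indicator (fun x => ‖w x‖ₑ) z)^(k+1) := by
        by_cases hz : z ∈ Ω
        · rw [hf, Set.indicator_of_mem hz, Set.indicator_of_mem hz]
        · rw [hf, Set.indicator_of_notMem hz, Set.indicator_of_notMem hz]; simp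
      rw [this, div_eq_mul_inv, div_eq_mul_inv]; ring
    calc eg k (fun x => χ x • w x) (x, y) ≤ (3 ^ (k+1) * (A ^ (k+1) + (L * edist x y * Bx) ^ (k+1) + (L * edist x y * By) ^ (k+1))) / edist x y ^ (n+k) := by
          simp only [eg]; gcongr
      _ = 3 ^ (k+1) * (A ^ (k+1) / edist x y ^ (n+k) + (L * edist x y * Bx) ^ (k+1) / edist x y ^ (n+k) + (L * edist x y * By) ^ (k+1) / edist x y ^ (n+k)) := by
          simp only [div_eq_mul_inv]; ring
      _ = G (x, y) := by rw [hAg, hBx, hBy, hBf, hBf, hG]; simp only; ring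
  calc globE k (fun x => χ x • w x) ≤ ∫⁻ x, ∫⁻ y, G (x, y) := lintegral_mono fun x => lintegral_mono fun y => hpt x y
    _ = ∫⁻ q, G q ∂(volume.prod volume) := (lintegral_prod _ hGm).symm
    _ = 3^(k+1) * ((∫⁻ q, g q ∂(volume.prod volume)) + L^(k+1) * ((∫⁻ x, f x) * (∫⁻ z, d z) + (∫⁻ x, f x) * ∫⁻ z, d z)) := by
      have hs1 : AEMeasurable (fun q : Euc n × Euc n => f q.1 * d (q.1 - q.2) + f q.2 * d (q.1 - q.2)) (volume.prod volume) := hfm1.add hfm2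
      have hs2 : AEMeasurable (fun q : Euc n × Euc n => g q + L^(k+1) * (f q.1 * d (q.1 - q.2) + f q.2 * d (q.1 - q.2))) (volume.prod volume) := hgm.add (hs1.const_mul _)
      simp only [hG]
      rw [lintegral_const_mul'' _ hs2, lintegral_add_left' hgm,
        lintegral_const_mul'' _ hs1, lintegral_add_left' hfm1,
        lintegral_prod_conv1 f d hfm (sker_meas 1), lintegral_prod_conv2 f d hfm (sker_meas 1)]
    _ = 3^(k+1) * (NE k Ω w + L^(k+1) * (2 * ∫⁻ z, d z) * NL k Ω w) := by
      have e1 : ∫⁻ q, g q ∂(volume.prod volume) = NE k Ω w := by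
        rw [hg, lintegral_indicator (hΩ.prod hΩ), ← Measure.prod_restrict]; rfl
      have e2 : ∫⁻ x, f x = NL k Ω w := by rw [hf, lintegral_indicator hΩ]; rfl
      rw [e1, e2]; ring
    _ ≤ 3^(k+1) * (1 * NE k Ω w + 1 * NL k Ω w + L^(k+1) * (2 * ∫⁻ z, d z) * NL k Ω w + L^(k+1) * (2 * ∫⁻ z, d z) * NE k Ω w) := by
      refine mul_le_mul' le_rfl ?_
      calc NE k Ω w + L^(k+1) * (2 * ∫⁻ z, d z) * NL k Ω w
          ≤ NE k Ω w + L^(k+1) * (2 * ∫⁻ z, d z) * NL k Ω w + (NL k Ω w + L^(k+1) * (2 * ∫⁻ z, d z) * NE k Ω w) := le_self_add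
        _ = _ := by ring
    _ = _ := by rw [NN]; ring
end Cut

section Core
variable {n : ℕ}

lemma cut_contDiff {F : Type*} [NormedAddCommGroup F] [NormedSpace ℝ F] {Ω : Set (Euc n)} (hΩ : IsOpen Ω) {χ : Euc n → ℝ} (hχ : ContDiff ℝ 1 χ)
    (hχΩ : tsupport χ ⊆ Ω) {v : Euc n → F} (hv : ContDiffOn ℝ 1 v Ω) : ContDiff ℝ 1 (fun x => χ x • v x) := by
  rw [contDiff_iff_contDiffAt]
  intro x
  by_cases hx : x ∈ tsupport χ
  · exact hχ.contDiffAt.smul (hv.contDiffAt (hΩ.mem_nhds (hχΩ hx)))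
  · have h := notMem_tsupport_iff_eventuallyEq.1 hx
    have : (fun x => χ x • v x) =ᶠ[𝓝 x] fun _ => (0 : F) := by
      filter_upwards [h] with y hy
      simp [hy]
    exact contDiffAt_const.congr_of_eventuallyEq this

variable {F : Type*} [NormedAddCommGroup F] [NormedSpace ℝ F] [FiniteDimensional ℝ F]

def slab (n : ℕ) : Set (Euc n × ℝ) := {q | q.2 ∈ Set.Ioo (0:ℝ) 1}

lemma slab_meas : MeasurableSet (slab n) := measurableSet_Ioo.preimage measurable_snd

lemma slab_energy (hn : 2 ≤ n) (k : ℕ) {Ω : Set (Euc n)} (hΩ : IsOpen Ω) (χ : Euc n → ℝ) (hχ : ContDiff ℝ 1 χ)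
    (hχc : HasCompactSupport χ) (hχΩ : tsupport χ ⊆ Ω) (hχ1 : ∀ x, χ x ∈ Set.Icc (0:ℝ) 1) :
    ∃ C : ENNReal, C ≠ ⊤ ∧ ∀ v : Euc n → F, ContDiffOn ℝ 1 v Ω →
      ∫⁻ q in slab n, ‖fderiv ℝ (ext (fun x => χ x • v x)) q‖ₑ ^ (k+1) ≤ C * NN k Ω v ∧
      ∫⁻ q in slab n, ‖ext (fun x => χ x • v x) q‖ₑ ^ (k+1) ≤ C * NN k Ω v := by
  obtain ⟨c, hc, hext⟩ := ext_fderiv_le (n := n) (F := F)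
  obtain ⟨C1, hC1, hK⟩ := K_est (n := n) (F := F) k (by omega) c hc
  obtain ⟨C2, hC2, hcut⟩ := cutoff_est (F := F) hn k hΩ.measurableSet χ hχ hχc hχΩ hχ1
  refine ⟨3^(k+1) * (1 + C1 * C2), by finiteness, ?_⟩
  intro v hv
  have hw := cut_contDiff hΩ hχ hχΩ hv
  set w := fun x => χ x • v x with hwdef
  set G : Euc n × ℝ → ENNReal := fun q => ENNReal.ofReal (c * (q.2⁻¹)^(n+1)) * ∫⁻ y in closedBall q.1 q.2, ‖w y - w q.1‖ₑ with hG
  have hGi : ∫⁻ q in slab n, G q ^ (k+1) ≤ C1 * C2 * NN k Ω v := by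
    refine (hK w hw.continuous).trans ?_
    rw [mul_assoc]
    refine mul_le_mul' le_rfl (hcut v (hv.continuousOn.aestronglyMeasurable hΩ.measurableSet))
  have h3 : (1:ENNReal) ≤ 3^(k+1) := one_le_pow₀ (by norm_num)
  constructor
  · calc _ ≤ ∫⁻ q in slab n, G q ^ (k+1) := by
          apply setLIntegral_mono' slab_meas
          intro q hq
          exact pow_le_pow_left₀ zero_le (hext w hw q.1 q.2 hq).1 _
      _ ≤ 1 * ((1 + C1 * C2) * NN k Ω v) := by
          refine hGi.trans ?_
          rw [one_mul, add_mul]; exact le_add_self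
      _ ≤ _ := by
          rw [mul_assoc]
          exact mul_le_mul' h3 le_rfl
  · have hwm : Measurable (fun q : Euc n × ℝ => ‖w q.1‖ₑ ^ (k+1)) :=
      ((hw.continuous.comp continuous_fst).enorm.measurable.pow_const _)
    have hwL : ∫⁻ q in slab n, ‖w q.1‖ₑ ^ (k+1) ≤ NL k Ω v := by
      have e : slab n = Set.univ ×ˢ Set.Ioo (0:ℝ) 1 := by ext q; simp [slab]
      rw [e, Measure.volume_eq_prod, ← Measure.prod_restrict, lintegral_prod _ (by exact hwm.aemeasurable)]
      simp only [lintegral_const, Measure.restrict_apply MeasurableSet.univ, Set.univ_inter, Real.volume_Ioo, sub_zero, ENNReal.ofReal_one, mul_one, Measure.restrict_univ]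
      rw [NL, ← lintegral_indicator hΩ.measurableSet]
      apply lintegral_mono
      intro x
      by_cases hx : x ∈ Ω
      · rw [Set.indicator_of_mem hx]
        simp only [hwdef, enorm_smul]
        refine pow_le_pow_left₀ zero_le ?_ _
        refine mul_le_of_le_one_left' ?_
        rw [Real.enorm_of_nonneg (hχ1 x).1]; exact ENNReal.ofReal_le_one.2 (hχ1 x).2
      · have : χ x = 0 := image_eq_zero_of_notMem_tsupport fun h => hx (hχΩ h)
        simp [hwdef, this]
    calc _ ≤ ∫⁻ q in slab n, 3^(k+1) * (‖w q.1‖ₑ ^ (k+1) + G q ^ (k+1)) := by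
          apply setLIntegral_mono' slab_meas
          intro q hq
          exact (pow_le_pow_left₀ zero_le (hext w hw q.1 q.2 hq).2 _).trans (pow_add2 _ _ _)
      _ = 3^(k+1) * ((∫⁻ q in slab n, ‖w q.1‖ₑ ^ (k+1)) + ∫⁻ q in slab n, G q ^ (k+1)) := by
          rw [lintegral_const_mul' _ _ (by finiteness), lintegral_add_left hwm]
      _ ≤ 3^(k+1) * (NN k Ω v + C1 * C2 * NN k Ω v) := by
          refine mul_le_mul' le_rfl (add_le_add (hwL.trans le_self_add) hGi)
      _ = _ := by ring

/-- cutoff in t -/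
lemma exists_theta : ∃ θ : ℝ → ℝ, ContDiff ℝ 1 θ ∧ HasCompactSupport θ ∧ tsupport θ ⊆ Set.Ioo (-1) 1 ∧ θ 0 = 1 := by
  obtain ⟨θ, h1, h2, h3, h4, h5⟩ := exists_cutoff (isCompact_singleton (x := (0:ℝ))) (isOpen_Ioo (a := (-1:ℝ)) (b := 1)) (by simp)
  exact ⟨θ, h1, h2, h3, (h5 0 rfl).self_of_nhds⟩

lemma int_cut {Ω : Set (Euc n)} (hΩ : IsOpen Ω) {χ : Euc n → ℝ} {φ : Euc n → ℝ} (hφΩ : tsupport φ ⊆ Ω)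
    (h1 : ∀ x ∈ tsupport φ, ∀ᶠ y in 𝓝 x, χ y = 1) (v : Euc n → Euc n) :
    ∫ x in Ω, (jacMat n v x).det * φ x = ∫ x, (fderiv ℝ (fun x => χ x • v x) x).det * φ x := by
  rw [setIntegral_eq_integral_of_forall_compl_eq_zero]
  · congr 1
    ext x
    by_cases hx : x ∈ tsupport φ
    · have : (fun x => χ x • v x) =ᶠ[𝓝 x] v := by
        filter_upwards [h1 x hx] with y hy
        simp [hy]
      rw [this.fderiv_eq, det_jac]
    · rw [image_eq_zero_of_notMem_tsupport hx]; simp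
  · intro x hx
    rw [image_eq_zero_of_notMem_tsupport fun h => hx (hφΩ h)]; simp

lemma volume_half_restrict_slab (f : Euc n × ℝ → ENNReal) (h0 : ∀ q : Euc n × ℝ, 1 ≤ q.2 → f q = 0) :
    ∫⁻ q in {q : Euc n × ℝ | 0 < q.2}, f q = ∫⁻ q in slab n, f q := by
  have hm : MeasurableSet {q : Euc n × ℝ | 0 < q.2} := measurableSet_Ioi.preimage measurable_snd
  rw [← lintegral_indicator hm, ← lintegral_indicator slab_meas]
  congr 1; ext q
  by_cases hq : 0 < q.2
  · by_cases hq1 : q.2 < 1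
    · rw [Set.indicator_of_mem (by exact hq), Set.indicator_of_mem (by exact ⟨hq, hq1⟩)]
    · rw [Set.indicator_of_mem (by exact hq), Set.indicator_of_notMem (by exact fun h => hq1 h.2), h0 q (not_lt.1 hq1)]
  · rw [Set.indicator_of_notMem (by exact hq), Set.indicator_of_notMem (by exact fun h => hq h.1)]

lemma fderiv_zero_of_theta {θ : ℝ → ℝ} (hθ : tsupport θ ⊆ Set.Ioo (-1) 1) (Φ : Euc n × ℝ → ℝ) (q : Euc n × ℝ) (hq : 1 ≤ q.2) :
    fderiv ℝ (fun q : Euc n × ℝ => θ q.2 * Φ q) q = 0 := by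
  have h : q.2 ∉ tsupport θ := fun h => absurd (hθ h).2 (not_lt.2 hq)
  have h' := (continuous_snd.continuousAt (x := q)).eventually (notMem_tsupport_iff_eventuallyEq.1 h)
  have : (fun q : Euc n × ℝ => θ q.2 * Φ q) =ᶠ[𝓝 q] fun _ => 0 := by
    filter_upwards [h'] with y hy
    simp at hy; simp [hy]
  rw [this.fderiv_eq]; simp

lemma int_det_prod (W : Euc n × ℝ → Euc n) (hW : ContDiff ℝ 1 W) (Ψ : Euc n × ℝ → ℝ) (hΨ : ContDiff ℝ 1 Ψ)
    (hc : HasCompactSupport Ψ) : Integrable (fun q => ((fderiv ℝ W q).prod (fderiv ℝ Ψ q)).det) := by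
  have hWc : Continuous (fderiv ℝ W) := hW.continuous_fderiv (by norm_num)
  have hΨc : Continuous (fderiv ℝ Ψ) := hΨ.continuous_fderiv (by norm_num)
  apply Continuous.integrable_of_hasCompactSupport
  · exact continuous_det_prod.comp (hWc.prodMk hΨc)
  · refine (hc.fderiv (𝕜 := ℝ)).mono ?_
    intro q hq
    rw [Function.mem_support] at hq ⊢
    contrapose! hq
    rw [hq, det_prod_zero]

theorem core1 (hn : 2 ≤ n) {Ω : Set (Euc n)} (hΩ : IsOpen Ω) (φ : Euc n → ℝ) (hφ : Cc1 n Ω φ) (ε : ENNReal) (hε : ε ≠ 0) :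
    ∃ C : ENNReal, C ≠ ⊤ ∧ ∀ v v' : Euc n → Euc n, ContDiffOn ℝ 1 v Ω → ContDiffOn ℝ 1 v' Ω →
      ‖(∫ x in Ω, (jacMat n v x).det * φ x) - ∫ x in Ω, (jacMat n v' x).det * φ x‖ₑ ≤
        ε * NN (n-1) Ω v' + C * NN (n-1) Ω (v - v') := by
  obtain ⟨hφ1, hφc, hφΩ⟩ := hφ
  obtain ⟨χ, hχ, hχc, hχΩ, hχ1, hχφ⟩ := exists_cutoff hφc.isCompact hΩ hφΩ
  obtain ⟨θ, hθ, hθc, hθs, hθ0⟩ := exists_theta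
  obtain ⟨C, hC, hsl⟩ := slab_energy (F := Euc n) hn (n-1) hΩ χ hχ hχc hχΩ hχ1
  set Ψ : Euc n × ℝ → ℝ := fun q => θ q.2 * φ q.1 with hΨd
  have hΨ : ContDiff ℝ 1 Ψ := (hθ.comp contDiff_snd).mul (hφ1.comp contDiff_fst)
  have hΨc : HasCompactSupport Ψ := by
    apply HasCompactSupport.of_support_subset_isCompact (hφc.isCompact.prod hθc.isCompact)
    intro q hq
    rw [Function.mem_support] at hq
    exact ⟨subset_tsupport _ (right_ne_zero_of_mul hq), subset_tsupport _ (left_ne_zero_of_mul hq)⟩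
  obtain ⟨M, hM⟩ := (hΨc.fderiv (𝕜 := ℝ)).exists_bound_of_continuous (hΨ.continuous_fderiv (by norm_num))
  -- choose eps
  obtain ⟨δ, hδ, hδε⟩ : ∃ δ : ℝ, 0 < δ ∧ ENNReal.ofReal δ * C ≤ ε := by
    rcases eq_or_ne C 0 with h0 | h0
    · exact ⟨1, one_pos, by simp [h0]⟩
    have hp : 0 < min (ε / C) 1 := by
      rw [lt_min_iff]; exact ⟨ENNReal.div_pos hε hC, one_pos⟩
    have hf : min (ε / C) 1 ≠ ⊤ := ne_top_of_le_ne_top ENNReal.one_ne_top (min_le_right _ _)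
    refine ⟨(min (ε / C) 1).toReal, ENNReal.toReal_pos hp.ne' hf, ?_⟩
    rw [ENNReal.ofReal_toReal hf]
    calc _ ≤ ε / C * C := mul_le_mul' (min_le_left _ _) le_rfl
      _ ≤ ε := (ENNReal.div_mul_cancel h0 hC).le
  obtain ⟨D, hD, hpert⟩ := homog_perturb (X := (Euc n × ℝ) →L[ℝ] Euc n) (Y := (Euc n × ℝ) →L[ℝ] ℝ)
    (fun q => (q.1.prod q.2).det) continuous_det_prod n (by omega) (fun r a y => by
      have := det_prod_smul a y r 1
      simpa using this) (closedBall 0 M) (isCompact_closedBall _ _) δ hδ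
  refine ⟨ENNReal.ofReal D * C, by finiteness, ?_⟩
  intro v v' hv hv'
  have hw := cut_contDiff hΩ hχ hχΩ hv
  have hw' := cut_contDiff hΩ hχ hχΩ hv'
  have hn1 : n - 1 + 1 = n := by omega
  rw [int_cut hΩ hφΩ hχφ v, int_cut hΩ hφΩ hχφ v']
  set w := fun x => χ x • v x with hwd
  set w' := fun x => χ x • v' x with hwd'
  have hV := ext_contDiff w hw
  have hV' := ext_contDiff w' hw'
  have key := half_space (ext w) hV Ψ hΨ hΨc
  have key' := half_space (ext w') hV' Ψ hΨ hΨc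
  simp only [ext_zero, hΨd, hθ0, one_mul] at key key'
  rw [key, key', neg_sub_neg, ← integral_sub (int_det_prod _ hV' _ hΨ hΨc).integrableOn (int_det_prod _ hV _ hΨ hΨc).integrableOn]
  refine (enorm_integral_le_lintegral_enorm _).trans ?_
  rw [volume_half_restrict_slab]
  swap
  · intro q hq
    rw [fderiv_zero_of_theta hθs (fun q => φ q.1) q hq, det_prod_zero, det_prod_zero]; simp
  have hdiff : ∀ q, fderiv ℝ (ext w) q - fderiv ℝ (ext w') q = fderiv ℝ (ext (fun x => χ x • (v - v') x)) q := by
    intro q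
    have e : ext (fun x => χ x • (v - v') x) = fun q => ext w q - ext w' q := by
      ext1 q
      rw [← ext_sub w w' hw.continuous hw'.continuous]
      congr 1; ext1 x
      simp only [hwd, hwd', Pi.sub_apply, smul_sub]
    rw [e, fderiv_fun_sub (hV.differentiable (by norm_num) q) (hV'.differentiable (by norm_num) q)]
  have hA := (hsl v' hv').1
  have hB := (hsl (v - v') (hv.sub hv')).1
  rw [hn1] at hA hB
  calc _ ≤ ∫⁻ q in slab n, (ENNReal.ofReal δ * ‖fderiv ℝ (ext w') q‖ₑ^n + ENNReal.ofReal D * ‖fderiv ℝ (ext (fun x => χ x • (v - v') x)) q‖ₑ ^ n) := by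
        apply lintegral_mono
        intro q
        have := hpert (fderiv ℝ (ext w) q) (fderiv ℝ (ext w') q) (fderiv ℝ Ψ q) (by simpa using hM q)
        rw [hdiff] at this
        simp only
        rw [← enorm_neg, neg_sub, Real.enorm_eq_ofReal_abs]
        refine (ENNReal.ofReal_le_ofReal this).trans ?_
        rw [ENNReal.ofReal_add (by positivity) (by positivity), ENNReal.ofReal_mul hδ.le, ENNReal.ofReal_mul hD, ENNReal.ofReal_pow (norm_nonneg _),
          ENNReal.ofReal_pow (norm_nonneg _), ofReal_norm, ofReal_norm]
    _ = ENNReal.ofReal δ * (∫⁻ q in slab n, ‖fderiv ℝ (ext w') q‖ₑ^n) + ENNReal.ofReal D * ∫⁻ q in slab n, ‖fderiv ℝ (ext (fun x => χ x • (v - v') x)) q‖ₑ ^ n := by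
        rw [lintegral_add_left, lintegral_const_mul' _ _ (by finiteness), lintegral_const_mul' _ _ (by finiteness)]
        exact ((hV'.continuous_fderiv (by norm_num)).enorm.measurable.pow_const _).const_mul _
    _ ≤ ENNReal.ofReal δ * (C * NN (n-1) Ω v') + ENNReal.ofReal D * (C * NN (n-1) Ω (v - v')) := by
        exact add_le_add (mul_le_mul' le_rfl hA) (mul_le_mul' le_rfl hB)
    _ ≤ _ := by
        rw [← mul_assoc, ← mul_assoc]
        exact add_le_add (mul_le_mul' hδε le_rfl) le_rfl

end Core

section Core
variable {n : ℕ}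

lemma exists_small (ε C : ENNReal) (hε : ε ≠ 0) (hC : C ≠ ⊤) : ∃ δ : ℝ, 0 < δ ∧ ENNReal.ofReal δ * C ≤ ε := by
  rcases eq_or_ne C 0 with h0 | h0
  · exact ⟨1, one_pos, by simp [h0]⟩
  have hp : 0 < min (ε / C) 1 := by
    rw [lt_min_iff]; exact ⟨ENNReal.div_pos hε hC, one_pos⟩
  have hf : min (ε / C) 1 ≠ ⊤ := ne_top_of_le_ne_top ENNReal.one_ne_top (min_le_right _ _)
  refine ⟨(min (ε / C) 1).toReal, ENNReal.toReal_pos hp.ne' hf, ?_⟩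
  rw [ENNReal.ofReal_toReal hf]
  calc _ ≤ ε / C * C := mul_le_mul' (min_le_left _ _) le_rfl
    _ ≤ ε := (ENNReal.div_mul_cancel h0 hC).le

theorem core2 (hn : 2 ≤ n) {Ω : Set (Euc n)} (hΩ : IsOpen Ω) (S : Set (Euc n)) (hS : IsCompact S) (hSΩ : S ⊆ Ω) (ε : ENNReal) (hε : ε ≠ 0) :
    ∃ C : ENNReal, C ≠ ⊤ ∧ ∀ (v : Euc n → Euc n) (φ : Euc n → ℝ), ContDiffOn ℝ 1 v Ω → ContDiff ℝ 1 φ → tsupport φ ⊆ S →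
      ‖∫ x in Ω, (jacMat n v x).det * φ x‖ₑ ≤ ε * NN n Ω v + C * NN n Ω φ := by
  obtain ⟨χ, hχ, hχc, hχΩ, hχ1, hχS⟩ := exists_cutoff hS hΩ hSΩ
  obtain ⟨θ, hθ, hθc, hθs, hθ0⟩ := exists_theta
  obtain ⟨C, hC, hsl⟩ := slab_energy (F := Euc n) hn n hΩ χ hχ hχc hχΩ hχ1
  obtain ⟨C', hC', hsl'⟩ := slab_energy (F := ℝ) hn n hΩ χ hχ hχc hχΩ hχ1
  obtain ⟨M1, hM1⟩ := hθc.exists_bound_of_continuous hθ.continuous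
  obtain ⟨M2, hM2⟩ := (hθc.fderiv (𝕜 := ℝ)).exists_bound_of_continuous (hθ.continuous_fderiv (by norm_num))
  set M := max M1 M2 with hMd
  have hM0 : 0 ≤ M := (norm_nonneg (θ 0)).trans ((hM1 0).trans (le_max_left _ _))
  obtain ⟨δ, hδ, hδε⟩ := exists_small ε C hε hC
  obtain ⟨D, hD, hpert⟩ := homog_perturb (X := ((Euc n × ℝ) →L[ℝ] Euc n) × ((Euc n × ℝ) →L[ℝ] ℝ)) (Y := Unit)
    (fun q => (q.1.1.prod q.1.2).det) (continuous_det_prod.comp continuous_fst) (n+1) (by omega) (fun r a y => by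
      have := det_prod_smul a.1 a.2 r r
      simpa [pow_succ] using this) Set.univ isCompact_univ δ hδ
  refine ⟨ENNReal.ofReal D * (ENNReal.ofReal M ^ (n+1) * (3 ^ (n+1) * (2 * C'))), by finiteness, ?_⟩
  intro v φ hv hφ hφS
  have hφc : HasCompactSupport φ := HasCompactSupport.of_support_subset_isCompact hS ((subset_tsupport _).trans hφS)
  have hχφ : (fun x => χ x • φ x) = φ := by
    ext1 x
    by_cases hx : x ∈ S
    · rw [(hχS x hx).self_of_nhds, one_smul]
    · rw [image_eq_zero_of_notMem_tsupport fun h => hx (hφS h), smul_zero]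
  set Φ := ext φ with hΦd
  have hΦ : ContDiff ℝ 1 Φ := ext_contDiff φ hφ
  set Ψ : Euc n × ℝ → ℝ := fun q => θ q.2 * Φ q with hΨd
  have hΨ : ContDiff ℝ 1 Ψ := (hθ.comp contDiff_snd).mul hΦ
  have hΨc : HasCompactSupport Ψ := by
    apply HasCompactSupport.of_support_subset_isCompact ((hS.cthickening (r := 1)).prod hθc.isCompact)
    intro q hq
    rw [Function.mem_support] at hq
    have h1 := left_ne_zero_of_mul hq
    have h2 := right_ne_zero_of_mul hq
    refine ⟨?_, subset_tsupport _ h1⟩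
    have h3 : ∃ z, rho n z • φ (q.1 - q.2 • z) ≠ 0 := by
      by_contra hcon
      push Not at hcon
      apply h2
      simp only [hΦd, ext, hcon, integral_zero]
    obtain ⟨z, hz⟩ := h3
    have hz1 : ‖z‖ < 1 := by
      by_contra hcon
      rw [rho_zero (not_lt.1 hcon)] at hz
      simp at hz
    have hz2 : q.1 - q.2 • z ∈ S := hφS (subset_tsupport _ (right_ne_zero_of_smul hz))
    have hq2 := hθs (subset_tsupport _ h1)
    refine mem_cthickening_of_dist_le _ _ _ _ hz2 ?_
    rw [dist_eq_norm, sub_sub_cancel, norm_smul, Real.norm_eq_abs]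
    have : |q.2| ≤ 1 := abs_le.2 ⟨hq2.1.le, hq2.2.le⟩
    nlinarith [abs_nonneg q.2, norm_nonneg z]
  have hw := cut_contDiff hΩ hχ hχΩ hv
  rw [int_cut hΩ (hφS.trans hSΩ) (fun x hx => hχS x (hφS hx)) v]
  set w := fun x => χ x • v x with hwd
  have hV := ext_contDiff w hw
  have key := half_space (ext w) hV Ψ hΨ hΨc
  simp only [ext_zero, hΨd, hθ0, one_mul, hΦd] at key
  rw [key, enorm_neg]
  refine (enorm_integral_le_lintegral_enorm _).trans ?_
  rw [volume_half_restrict_slab]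
  swap
  · intro q hq
    rw [fderiv_zero_of_theta hθs (ext φ) q hq, det_prod_zero]; simp
  have hA := (hsl v hv).1
  have hB := hsl' φ hφ.contDiffOn
  rw [hχφ] at hB
  have hDΨ : ∀ q, ‖fderiv ℝ Ψ q‖ₑ ≤ ENNReal.ofReal M * (‖fderiv ℝ Φ q‖ₑ + ‖Φ q‖ₑ) := by
    intro q
    have h1 : HasFDerivAt (fun q : Euc n × ℝ => θ q.2) ((fderiv ℝ θ q.2).comp (ContinuousLinearMap.snd ℝ (Euc n) ℝ)) q :=
      (hθ.differentiable (by norm_num) q.2).hasFDerivAt.comp q hasFDerivAt_snd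
    have h2 := h1.fun_mul (hΦ.differentiable (by norm_num) q).hasFDerivAt
    rw [h2.fderiv, mul_add]
    have hen : ∀ a b : (Euc n × ℝ) →L[ℝ] ℝ, ‖a + b‖ₑ ≤ ‖a‖ₑ + ‖b‖ₑ := by
      intro a b
      rw [← ofReal_norm, ← ofReal_norm, ← ofReal_norm, ← ENNReal.ofReal_add (norm_nonneg _) (norm_nonneg _)]
      exact ENNReal.ofReal_le_ofReal (norm_add_le _ _)
    refine (hen _ _).trans (add_le_add ?_ ?_)
    · rw [enorm_smul]
      refine mul_le_mul' ?_ le_rfl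
      rw [← ofReal_norm]
      exact ENNReal.ofReal_le_ofReal ((hM1 _).trans (le_max_left _ _))
    · rw [enorm_smul, mul_comm]
      refine mul_le_mul' ?_ le_rfl
      rw [← ofReal_norm]
      refine ENNReal.ofReal_le_ofReal ?_
      calc _ ≤ ‖fderiv ℝ θ q.2‖ * ‖ContinuousLinearMap.snd ℝ (Euc n) ℝ‖ := ContinuousLinearMap.opNorm_comp_le _ _
        _ ≤ M2 * 1 := mul_le_mul (hM2 _) (ContinuousLinearMap.norm_snd_le _ _ _) (norm_nonneg _) ((norm_nonneg _).trans (hM2 0))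
        _ ≤ M := by rw [mul_one]; exact le_max_right _ _
  have hΦm : Measurable (fun q => ‖fderiv ℝ Φ q‖ₑ ^ (n+1)) := (hΦ.continuous_fderiv (by norm_num)).enorm.measurable.pow_const _
  have hBB : ∫⁻ q in slab n, ‖fderiv ℝ Ψ q‖ₑ ^ (n+1) ≤ ENNReal.ofReal M ^ (n+1) * (3 ^ (n+1) * (2 * C')) * NN n Ω φ := by
    calc _ ≤ ∫⁻ q in slab n, ENNReal.ofReal M ^ (n+1) * (3^(n+1) * (‖fderiv ℝ Φ q‖ₑ ^ (n+1) + ‖Φ q‖ₑ ^ (n+1))) := by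
          apply lintegral_mono
          intro q
          refine (pow_le_pow_left₀ zero_le (hDΨ q) _).trans ?_
          rw [mul_pow]
          exact mul_le_mul' le_rfl (pow_add2 _ _ _)
      _ = ENNReal.ofReal M ^ (n+1) * (3^(n+1) * ((∫⁻ q in slab n, ‖fderiv ℝ Φ q‖ₑ ^ (n+1)) + ∫⁻ q in slab n, ‖Φ q‖ₑ ^ (n+1))) := by
          rw [lintegral_const_mul' _ _ (by finiteness), lintegral_const_mul' _ _ (by finiteness), lintegral_add_left hΦm]
      _ ≤ ENNReal.ofReal M ^ (n+1) * (3^(n+1) * (C' * NN n Ω φ + C' * NN n Ω φ)) :=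
          mul_le_mul' le_rfl (mul_le_mul' le_rfl (add_le_add hB.1 hB.2))
      _ = _ := by ring
  calc _ ≤ ∫⁻ q in slab n, (ENNReal.ofReal δ * ‖fderiv ℝ (ext w) q‖ₑ^(n+1) + ENNReal.ofReal D * ‖fderiv ℝ Ψ q‖ₑ ^ (n+1)) := by
        apply lintegral_mono
        intro q
        have := hpert (fderiv ℝ (ext w) q, fderiv ℝ Ψ q) (fderiv ℝ (ext w) q, 0) () trivial
        simp only [det_prod_zero, sub_zero, Prod.mk_sub_mk, sub_self, Prod.norm_mk, norm_zero] at this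
        rw [max_eq_left (norm_nonneg _), max_eq_right (norm_nonneg _)] at this
        simp only
        rw [Real.enorm_eq_ofReal_abs]
        refine (ENNReal.ofReal_le_ofReal this).trans ?_
        rw [ENNReal.ofReal_add (by positivity) (by positivity), ENNReal.ofReal_mul hδ.le, ENNReal.ofReal_mul hD, ENNReal.ofReal_pow (norm_nonneg _),
          ENNReal.ofReal_pow (norm_nonneg _), ofReal_norm, ofReal_norm]
    _ = ENNReal.ofReal δ * (∫⁻ q in slab n, ‖fderiv ℝ (ext w) q‖ₑ^(n+1)) + ENNReal.ofReal D * ∫⁻ q in slab n, ‖fderiv ℝ Ψ q‖ₑ ^ (n+1) := by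
        rw [lintegral_add_left, lintegral_const_mul' _ _ (by finiteness), lintegral_const_mul' _ _ (by finiteness)]
        exact ((hV.continuous_fderiv (by norm_num)).enorm.measurable.pow_const _).const_mul _
    _ ≤ ENNReal.ofReal δ * (C * NN n Ω v) + ENNReal.ofReal D * (ENNReal.ofReal M ^ (n+1) * (3 ^ (n+1) * (2 * C')) * NN n Ω φ) := by
        exact add_le_add (mul_le_mul' le_rfl hA) (mul_le_mul' le_rfl hBB)
    _ ≤ _ := by
        rw [← mul_assoc, ← mul_assoc]
        exact add_le_add (mul_le_mul' hδε le_rfl) le_rfl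

end Core

section Bridge
variable {n : ℕ} {F : Type*} [NormedAddCommGroup F]

lemma bridge_L (k : ℕ) (p : ℝ) (hp : p = (k:ℝ) + 1) (a : F) : ‖(‖a‖ ^ p : ℝ)‖ₑ = ‖a‖ₑ ^ (k+1) := by
  rw [Real.enorm_of_nonneg (by positivity), hp, show ((k:ℝ)+1) = ((k+1 : ℕ) : ℝ) by push_cast; ring, Real.rpow_natCast, ENNReal.ofReal_pow (norm_nonneg _), ofReal_norm]

lemma bridge_E (hn : 1 ≤ n) (k : ℕ) (s p : ℝ) (hp : p = (k:ℝ) + 1) (hs : (n:ℝ) + s * p = (n:ℝ) + k) (w : Euc n → F) (q : Euc n × Euc n) :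
    ‖(‖w q.1 - w q.2‖ ^ p / dist q.1 q.2 ^ ((n : ℝ) + s * p) : ℝ)‖ₑ = eg k w q := by
  by_cases h : q.1 = q.2
  · rw [eg, h]
    have : p ≠ 0 := by rw [hp]; positivity
    simp [Real.zero_rpow this]
  have hd : 0 < dist q.1 q.2 := dist_pos.2 h
  rw [hs, show ((n:ℝ)+k) = ((n+k : ℕ) : ℝ) by push_cast; ring, Real.rpow_natCast, Real.enorm_of_nonneg (by positivity), ENNReal.ofReal_div_of_pos (by positivity),
    ENNReal.ofReal_pow hd.le, ← edist_dist, eg]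
  congr 1
  rw [← bridge_L k p hp, Real.enorm_of_nonneg (by positivity)]

lemma memWsp_NN (hn : 1 ≤ n) (k : ℕ) (s p : ℝ) (hp : p = (k:ℝ) + 1) (hs : (n:ℝ) + s * p = (n:ℝ) + k) {Ω : Set (Euc n)} {w : Euc n → F}
    (h : MemWsp n s p Ω w) : NN k Ω w < ⊤ := by
  obtain ⟨h1, h2, h3⟩ := h
  have h2' := h2.2
  have h3' := h3.2
  rw [HasFiniteIntegral] at h2' h3'
  simp only [bridge_L k p hp] at h2'
  simp only [bridge_E hn k s p hp hs] at h3'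
  exact ENNReal.add_lt_top.2 ⟨h2', h3'⟩

lemma sobNorm_eq (hn : 1 ≤ n) (k : ℕ) (s p : ℝ) (hp : p = (k:ℝ) + 1) (hs : (n:ℝ) + s * p = (n:ℝ) + k) {Ω : Set (Euc n)} {w : Euc n → F}
    (hw : AEStronglyMeasurable w (volume.restrict Ω)) (h : NN k Ω w < ⊤) :
    sobNorm n s p Ω w = (NL k Ω w).toReal ^ (1/p) + (NE k Ω w).toReal ^ (1/p) := by
  have hp0 : 0 ≤ p := by rw [hp]; positivity
  have hm1 : AEStronglyMeasurable (fun x => ‖w x‖ ^ p) (volume.restrict Ω) :=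
    (Real.continuous_rpow_const hp0).comp_aestronglyMeasurable hw.norm
  have hm2 : AEStronglyMeasurable (fun q : Euc n × Euc n => ‖w q.1 - w q.2‖ ^ p / dist q.1 q.2 ^ ((n : ℝ) + s * p))
    ((volume.restrict Ω).prod (volume.restrict Ω)) := by
    have h1 : AEStronglyMeasurable (fun q : Euc n × Euc n => ‖w q.1 - w q.2‖ ^ p) ((volume.restrict Ω).prod (volume.restrict Ω)) :=
      (Real.continuous_rpow_const hp0).comp_aestronglyMeasurable
      (((hw.comp_fst (ν := volume.restrict Ω)).sub (hw.comp_snd (μ := volume.restrict Ω))).norm)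
    have h2 : Measurable (fun q : Euc n × Euc n => dist q.1 q.2 ^ ((n : ℝ) + s * p)) := by fun_prop
    exact (h1.aemeasurable.div h2.aemeasurable).aestronglyMeasurable
  have hI : Integrable (fun q : Euc n × Euc n => ‖w q.1 - w q.2‖ ^ p / dist q.1 q.2 ^ ((n : ℝ) + s * p))
    ((volume.restrict Ω).prod (volume.restrict Ω)) := by
    refine ⟨hm2, ?_⟩
    rw [HasFiniteIntegral]
    simp only [bridge_E hn k s p hp hs]
    exact lt_of_le_of_lt le_add_self h
  rw [sobNorm, sobSemi]
  congr 2
  · rw [integral_eq_lintegral_of_nonneg_ae (Eventually.of_forall fun x => by positivity) hm1, NL]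
    congr 2; ext x
    rw [← bridge_L k p hp, Real.enorm_of_nonneg (by positivity)]
  · rw [← integral_prod _ hI, integral_eq_lintegral_of_nonneg_ae (Eventually.of_forall fun x => by positivity) hm2, NE]
    congr 2; ext q
    rw [← bridge_E hn k s p hp hs, Real.enorm_of_nonneg (by positivity)]

lemma sob_to_NN (hn : 1 ≤ n) (k : ℕ) (s p : ℝ) (hp : p = (k:ℝ) + 1) (hs : (n:ℝ) + s * p = (n:ℝ) + k) {Ω : Set (Euc n)} {w : ℕ → Euc n → F}
    (hw : ∀ j, AEStronglyMeasurable (w j) (volume.restrict Ω)) (h : ∀ j, NN k Ω (w j) < ⊤) :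
    Tendsto (fun j => sobNorm n s p Ω (w j)) atTop (𝓝 0) ↔ Tendsto (fun j => NN k Ω (w j)) atTop (𝓝 0) := by
  have hp0 : 0 < p := by rw [hp]; positivity
  have hL : ∀ j, NL k Ω (w j) ≠ ⊤ := fun j => (lt_of_le_of_lt le_self_add (h j)).ne
  have hE : ∀ j, NE k Ω (w j) ≠ ⊤ := fun j => (lt_of_le_of_lt le_add_self (h j)).ne
  simp only [fun j => sobNorm_eq hn k s p hp hs (hw j) (h j)]
  have aux : ∀ f : ℕ → ENNReal, (∀ j, f j ≠ ⊤) → Tendsto (fun j => (f j).toReal ^ (1/p)) atTop (𝓝 0) → Tendsto f atTop (𝓝 0) := by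
    intro f hf h1
    have h2 := h1.rpow_const (p := p) (Or.inr hp0.le)
    rw [Real.zero_rpow hp0.ne'] at h2
    have h3 : (fun j => ((f j).toReal ^ (1/p)) ^ p) = fun j => (f j).toReal := by
      ext j
      rw [← Real.rpow_mul ENNReal.toReal_nonneg, one_div, inv_mul_cancel₀ hp0.ne', Real.rpow_one]
    rw [h3] at h2
    exact (ENNReal.tendsto_toReal_zero_iff hf).1 h2
  have aux2 : ∀ f : ℕ → ENNReal, (∀ j, f j ≠ ⊤) → Tendsto f atTop (𝓝 0) → Tendsto (fun j => (f j).toReal ^ (1/p)) atTop (𝓝 0) := by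
    intro f hf h1
    have h2 := ((ENNReal.tendsto_toReal_zero_iff hf).2 h1).rpow_const (p := 1/p) (Or.inr (by positivity))
    rwa [Real.zero_rpow (by positivity)] at h2
  constructor
  · intro hh
    have h1 : Tendsto (fun j => (NL k Ω (w j)).toReal ^ (1/p)) atTop (𝓝 0) :=
      squeeze_zero (fun j => by positivity) (fun j => le_add_of_nonneg_right (by positivity)) hh
    have h2 : Tendsto (fun j => (NE k Ω (w j)).toReal ^ (1/p)) atTop (𝓝 0) :=
      squeeze_zero (fun j => by positivity) (fun j => le_add_of_nonneg_left (by positivity)) hh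
    simpa [NN] using (aux _ hL h1).add (aux _ hE h2)
  · intro hh
    have h1 : Tendsto (fun j => NL k Ω (w j)) atTop (𝓝 0) :=
      tendsto_of_tendsto_of_tendsto_of_le_of_le tendsto_const_nhds hh (fun j => zero_le) (fun j => le_self_add)
    have h2 : Tendsto (fun j => NE k Ω (w j)) atTop (𝓝 0) :=
      tendsto_of_tendsto_of_tendsto_of_le_of_le tendsto_const_nhds hh (fun j => zero_le) (fun j => le_add_self)
    simpa using (aux2 _ hL h1).add (aux2 _ hE h2)

lemma eg_add_le (k : ℕ) (v w : Euc n → F) (q) : eg k (v + w) q ≤ 3^(k+1) * (eg k v q + eg k w q) := by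
  rw [eg, eg, eg, ← ENNReal.add_div, ← mul_div_assoc]
  refine ENNReal.div_le_div_right ?_ _
  refine le_trans (pow_le_pow_left₀ zero_le ?_ _) (pow_add2 _ _ _)
  have : (v + w) q.1 - (v + w) q.2 = (v q.1 - v q.2) + (w q.1 - w q.2) := by simp only [Pi.add_apply]; abel
  rw [this]; exact enorm_add_le _ _

lemma NN_add (k : ℕ) {Ω : Set (Euc n)} {v : Euc n → F} (w : Euc n → F) (hv : AEStronglyMeasurable v (volume.restrict Ω)) :
    NN k Ω (v + w) ≤ 3^(k+1) * (NN k Ω v + NN k Ω w) := by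
  have h1 : NL k Ω (v + w) ≤ 3^(k+1) * (NL k Ω v + NL k Ω w) := by
    rw [NL, NL, NL, ← lintegral_add_left' (hv.enorm.pow_const _), ← lintegral_const_mul' _ _ (by finiteness)]
    apply lintegral_mono
    intro x
    exact le_trans (pow_le_pow_left₀ zero_le (enorm_add_le _ _) _) (pow_add2 _ _ _)
  have h2 : NE k Ω (v + w) ≤ 3^(k+1) * (NE k Ω v + NE k Ω w) := by
    rw [NE, NE, NE, ← lintegral_add_left' (eg_aemeas k hv), ← lintegral_const_mul' _ _ (by finiteness)]
    exact lintegral_mono fun q => eg_add_le k v w q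
  calc _ ≤ _ := add_le_add h1 h2
    _ = _ := by rw [NN, NN]; ring

lemma NN_neg (k : ℕ) {Ω : Set (Euc n)} (w : Euc n → F) : NN k Ω (-w) = NN k Ω w := by
  have : eg k (-w) = eg k w := by
    ext q
    rw [eg, eg]; simp only [Pi.neg_apply]
    rw [← neg_sub', enorm_neg]
  simp [NN, NL, NE, this]

lemma NN_sub (k : ℕ) {Ω : Set (Euc n)} {v : Euc n → F} (w : Euc n → F) (hv : AEStronglyMeasurable v (volume.restrict Ω)) :
    NN k Ω (v - w) ≤ 3^(k+1) * (NN k Ω v + NN k Ω w) := by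
  rw [sub_eq_add_neg, ← NN_neg k w]; exact NN_add k _ hv

lemma sker_int (hn : 2 ≤ n) {Ω : Set (Euc n)} (hΩ : MeasurableSet Ω) (hΩb : Bornology.IsBounded Ω) (R : ℝ) :
    ∫⁻ q, sker n R (q.1 - q.2) ∂((volume.restrict Ω).prod (volume.restrict Ω)) < ⊤ := by
  have h := lintegral_prod_conv1 (Ω.indicator fun _ => (1:ENNReal)) (sker n R) ((measurable_const.indicator hΩ).aemeasurable) (sker_meas R)
  rw [lintegral_indicator hΩ, setLIntegral_one] at h
  refine lt_of_le_of_lt (le_trans ?_ h.le) (ENNReal.mul_lt_top hΩb.measure_lt_top (sker_fin hn R).lt_top)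
  rw [Measure.prod_restrict, ← lintegral_indicator (hΩ.prod hΩ)]
  apply lintegral_mono
  intro q
  by_cases hq : q ∈ Ω ×ˢ Ω
  · simp only [Set.indicator_of_mem hq, Set.indicator_of_mem hq.1, one_mul]; exact le_rfl
  · simp only [Set.indicator_of_notMem hq]; exact zero_le

lemma sker_eq {R : ℝ} {x y : Euc n} (h : dist x y < R) : sker n R (x - y) = (edist x y ^ (n-1))⁻¹ := by
  rw [sker, Set.indicator_of_mem]
  · rw [edist_eq_enorm_sub]
  · rw [mem_ball, dist_zero_right, ← dist_eq_norm]; exact h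

lemma exists_R {Ω : Set (Euc n)} (hΩb : Bornology.IsBounded Ω) : ∃ R : ℝ, ∀ x ∈ Ω, ∀ y ∈ Ω, dist x y < R :=
  ⟨diam Ω + 1, fun x hx y hy => lt_of_le_of_lt (dist_le_diam_of_mem hΩb hx hy) (by linarith)⟩

lemma NN_lip (hn : 2 ≤ n) (k : ℕ) {Ω : Set (Euc n)} (hΩ : MeasurableSet Ω) (hΩb : Bornology.IsBounded Ω) {w : Euc n → F}
    (L M : NNReal) (hL : ∀ x ∈ Ω, ∀ y ∈ Ω, ‖w x - w y‖ₑ ≤ L * edist x y) (hM : ∀ x ∈ Ω, ‖w x‖ₑ ≤ M) : NN k Ω w < ⊤ := by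
  obtain ⟨R, hR⟩ := exists_R hΩb
  apply ENNReal.add_lt_top.2
  constructor
  · calc NL k Ω w ≤ ∫⁻ x in Ω, (M:ENNReal)^(k+1) := setLIntegral_mono' hΩ fun x hx => pow_le_pow_left₀ zero_le (hM x hx) _
      _ = M^(k+1) * volume Ω := by simp
      _ < ⊤ := ENNReal.mul_lt_top (by finiteness) hΩb.measure_lt_top
  · calc NE k Ω w ≤ ∫⁻ q, (L:ENNReal)^(k+1) * sker n R (q.1 - q.2) ∂((volume.restrict Ω).prod (volume.restrict Ω)) := by
          rw [NE, Measure.prod_restrict]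
          refine setLIntegral_mono' (hΩ.prod hΩ) ?_
          intro q hq
          by_cases h : q.1 = q.2
          · rw [eg, h]; simp
          rw [sker_eq (hR _ hq.1 _ hq.2), ← edist_pow_div (by omega) k h, eg, ← mul_div_assoc, ← mul_pow]
          exact ENNReal.div_le_div_right (pow_le_pow_left₀ zero_le (hL _ hq.1 _ hq.2) _) _
      _ = _ := lintegral_const_mul' _ _ (by finiteness)
      _ < ⊤ := ENNReal.mul_lt_top (by finiteness) (sker_int hn hΩ hΩb R)

lemma young_aux (m : ℕ) (a r τ : ENNReal) (hτ : τ ≠ 0) (hτ' : τ ≠ ⊤) (hr : r ≠ 0) (hr' : r ≠ ⊤) :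
    a ^ m ≤ τ ^ m * r ^ m + τ⁻¹ * (a ^ (m+1) / r) := by
  by_cases h : a ≤ τ * r
  · rw [← mul_pow]; exact (pow_le_pow_left₀ zero_le h _).trans le_self_add
  · refine le_trans ?_ le_add_self
    push Not at h
    calc a ^ m = a ^ m * (τ * r) * (τ⁻¹ / r) := by
          rw [div_eq_mul_inv]
          calc a ^ m = a ^ m * (τ * τ⁻¹) * (r * r⁻¹) := by
                rw [ENNReal.mul_inv_cancel hτ hτ', ENNReal.mul_inv_cancel hr hr']; simp
            _ = _ := by ring
      _ ≤ a ^ m * a * (τ⁻¹ / r) := by gcongr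
      _ = _ := by rw [pow_succ, div_eq_mul_inv, div_eq_mul_inv]; ring

lemma embed (hn : 2 ≤ n) {Ω : Set (Euc n)} (hΩ : MeasurableSet Ω) (hΩb : Bornology.IsBounded Ω) :
    ∃ A : ENNReal, A ≠ ⊤ ∧ ∀ w : Euc n → F, ∀ τ : ENNReal, τ ≠ 0 → τ ≠ ⊤ →
      NN (n-1) Ω w ≤ τ ^ n * A + τ⁻¹ * NN n Ω w := by
  obtain ⟨R, hR⟩ := exists_R hΩb
  set I := ∫⁻ q, sker n R (q.1 - q.2) ∂((volume.restrict Ω).prod (volume.restrict Ω)) with hI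
  have hIf : I < ⊤ := sker_int hn hΩ hΩb R
  have hn1 : n - 1 + 1 = n := by omega
  refine ⟨volume Ω + I, (ENNReal.add_lt_top.2 ⟨hΩb.measure_lt_top, hIf⟩).ne, ?_⟩
  intro w τ hτ hτ'
  have h1 : NL (n-1) Ω w ≤ τ ^ n * volume Ω + τ⁻¹ * NL n Ω w := by
    calc NL (n-1) Ω w ≤ ∫⁻ x in Ω, (τ^n + τ⁻¹ * ‖w x‖ₑ^(n+1)) := by
          rw [NL, hn1]
          apply lintegral_mono
          intro x
          simpa using young_aux n ‖w x‖ₑ 1 τ hτ hτ' one_ne_zero ENNReal.one_ne_top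
      _ = _ := by
          rw [lintegral_add_left measurable_const, lintegral_const_mul' _ _ (by finiteness), NL]; simp
  have h2 : NE (n-1) Ω w ≤ τ ^ n * I + τ⁻¹ * NE n Ω w := by
    calc NE (n-1) Ω w ≤ ∫⁻ q, (τ^n * sker n R (q.1 - q.2) + τ⁻¹ * eg n w q) ∂((volume.restrict Ω).prod (volume.restrict Ω)) := by
          rw [NE, Measure.prod_restrict]
          refine setLIntegral_mono' (hΩ.prod hΩ) ?_
          intro q hq
          by_cases h : q.1 = q.2
          · rw [eg, hn1, h]; simp [show n ≠ 0 by omega]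
          have h0 : edist q.1 q.2 ≠ 0 := by simpa using h
          have h1 : edist q.1 q.2 ≠ ⊤ := edist_ne_top _ _
          rw [sker_eq (hR _ hq.1 _ hq.2), ← edist_pow_div (by omega) (n-1) h, eg, eg, hn1]
          have := young_aux n ‖w q.1 - w q.2‖ₑ (edist q.1 q.2) τ hτ hτ' h0 h1
          refine (ENNReal.div_le_div_right this _).trans ?_
          rw [ENNReal.add_div]
          refine add_le_add (by rw [mul_div_assoc]) ?_
          rw [mul_div_assoc]
          refine mul_le_mul' le_rfl ?_
          rw [show n + n = 1 + (n + (n-1)) by omega, pow_add _ 1, pow_one, div_eq_mul_inv, div_eq_mul_inv, div_eq_mul_inv, ENNReal.mul_inv (Or.inl h0) (Or.inl h1), mul_assoc]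
      _ = _ := by
          rw [lintegral_add_left, lintegral_const_mul' _ _ (by finiteness), lintegral_const_mul' _ _ (by finiteness), NE]
          have := sker_meas (n := n) R
          fun_prop
  calc _ ≤ _ := add_le_add h1 h2
    _ = _ := by rw [NN]; ring

lemma embed_fin (hn : 2 ≤ n) {Ω : Set (Euc n)} (hΩ : MeasurableSet Ω) (hΩb : Bornology.IsBounded Ω) {w : Euc n → F} (h : NN n Ω w < ⊤) :
    NN (n-1) Ω w < ⊤ := by
  obtain ⟨A, hA, hh⟩ := embed (F := F) hn hΩ hΩb
  refine lt_of_le_of_lt (hh w 1 one_ne_zero ENNReal.one_ne_top) ?_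
  simp only [one_pow, one_mul, inv_one]
  exact ENNReal.add_lt_top.2 ⟨hA.lt_top, h⟩

lemma embed_tendsto (hn : 2 ≤ n) {Ω : Set (Euc n)} (hΩ : MeasurableSet Ω) (hΩb : Bornology.IsBounded Ω) {ι : Type*} {l : Filter ι} {w : ι → Euc n → F}
    (h : Tendsto (fun j => NN n Ω (w j)) l (𝓝 0)) : Tendsto (fun j => NN (n-1) Ω (w j)) l (𝓝 0) := by
  obtain ⟨A, hA, hh⟩ := embed (F := F) hn hΩ hΩb
  rw [ENNReal.tendsto_nhds_zero] at h ⊢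
  intro ε hε
  obtain ⟨δ, hδ, hδA⟩ := exists_small (ε/2) A (ENNReal.half_pos hε.ne').ne' hA
  set τ := ENNReal.ofReal (min δ 1) with hτd
  have hτ : τ ≠ 0 := by simp [hτd, hδ]
  have hτ' : τ ≠ ⊤ := ENNReal.ofReal_ne_top
  have hτ1 : τ ≤ 1 := ENNReal.ofReal_le_one.2 (min_le_right _ _)
  filter_upwards [h (τ * (ε/2)) (pos_iff_ne_zero.2 (mul_ne_zero hτ (ENNReal.half_pos hε.ne').ne'))] with j hj
  calc _ ≤ _ := hh (w j) τ hτ hτ'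
    _ ≤ ε/2 + τ⁻¹ * (τ * (ε/2)) := by
      refine add_le_add ?_ (mul_le_mul' le_rfl hj)
      refine le_trans (mul_le_mul' ?_ le_rfl) hδA
      calc τ ^ n ≤ τ ^ 1 := pow_le_pow_right_of_le_one' hτ1 (by omega)
        _ = τ := pow_one _
        _ ≤ _ := ENNReal.ofReal_le_ofReal (min_le_left _ _)
    _ = ε := by rw [← mul_assoc, ENNReal.inv_mul_cancel hτ hτ', one_mul, ENNReal.add_halves]

end Bridge

section SP
variable {n : ℕ}

lemma sp_lemma {α : Type*} [MeasurableSpace α] {μ : Measure α} (a b' : ℕ → α → ENNReal) (b : α → ENNReal) (C : ENNReal) (hC : C ≠ ⊤)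
    (ha : ∀ j, AEMeasurable (a j) μ) (hb : AEMeasurable b μ) (hab : ∀ j, ∀ᵐ x ∂μ, a j x ≤ C * (b x + b' j x))
    (hbf : ∫⁻ x, b x ∂μ ≠ ⊤) (hb0 : Tendsto (fun j => ∫⁻ x, b' j x ∂μ) atTop (𝓝 0)) (ha0 : ∀ᵐ x ∂μ, Tendsto (fun j => a j x) atTop (𝓝 0)) :
    Tendsto (fun j => ∫⁻ x, a j x ∂μ) atTop (𝓝 0) := by
  have h1 : Tendsto (fun j => ∫⁻ x, min (a j x) (C * b x) ∂μ) atTop (𝓝 (∫⁻ x, 0 ∂μ)) := by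
    refine tendsto_lintegral_of_dominated_convergence' (fun x => C * b x) (fun j => (ha j).min (hb.const_mul _))
      (fun j => Eventually.of_forall fun x => min_le_right _ _) ?_ ?_
    · rw [lintegral_const_mul' _ _ hC]; exact ENNReal.mul_ne_top hC hbf
    · filter_upwards [ha0] with x hx
      exact tendsto_of_tendsto_of_tendsto_of_le_of_le tendsto_const_nhds hx (fun j => zero_le) (fun j => min_le_left _ _)
  have h2 : Tendsto (fun j => C * ∫⁻ x, b' j x ∂μ) atTop (𝓝 0) := by
    simpa using ENNReal.Tendsto.const_mul hb0 (Or.inr hC)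
  have h3 := h1.add h2
  simp only [lintegral_zero, add_zero] at h3
  refine tendsto_of_tendsto_of_tendsto_of_le_of_le tendsto_const_nhds h3 (fun j => zero_le) (fun j => ?_)
  rw [← lintegral_const_mul' _ _ hC, ← lintegral_add_left' ((ha j).min (hb.const_mul _))]
  apply lintegral_mono_ae
  filter_upwards [hab j] with x hx
  rw [mul_add] at hx
  rcases le_total (a j x) (C * b x) with h | h
  · rw [min_eq_left h]; exact le_self_add
  · rw [min_eq_right h]; exact hx

variable {F G : Type*} [NormedAddCommGroup F] [NormedAddCommGroup G]

lemma eg_tendsto (k : ℕ) (w : ℕ → Euc n → G) (q : Euc n × Euc n) (h1 : Tendsto (fun j => w j q.1) atTop (𝓝 0))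
    (h2 : Tendsto (fun j => w j q.2) atTop (𝓝 0)) : Tendsto (fun j => eg k (w j) q) atTop (𝓝 0) := by
  by_cases h : q.1 = q.2
  · have : ∀ j, eg k (w j) q = 0 := fun j => by rw [eg, h]; simp
    simp [this]
  have h0 : edist q.1 q.2 ≠ 0 := by simpa using h
  have h3 := (h1.sub h2).enorm
  simp only [sub_zero, enorm_zero] at h3
  have h4 := ENNReal.Tendsto.pow (n := k+1) h3
  have h5 := ENNReal.Tendsto.div_const h4 (b := edist q.1 q.2 ^ (n+k)) (Or.inr (pow_ne_zero _ h0))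
  simpa [eg] using h5

lemma NN_dom (hn : 2 ≤ n) (k : ℕ) {Ω : Set (Euc n)} (hΩ : MeasurableSet Ω) (hΩb : Bornology.IsBounded Ω) (u : Euc n → F)
    (hu : AEStronglyMeasurable u (volume.restrict Ω)) (huf : NN k Ω u < ⊤) (e : ℕ → Euc n → F)
    (he : ∀ j, AEStronglyMeasurable (e j) (volume.restrict Ω)) (he0 : Tendsto (fun j => NN k Ω (e j)) atTop (𝓝 0))
    (w : ℕ → Euc n → G) (hw : ∀ j, AEStronglyMeasurable (w j) (volume.restrict Ω)) (C : NNReal)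
    (h1 : ∀ j, ∀ x ∈ Ω, ∀ y ∈ Ω, ‖w j x - w j y‖ₑ ≤ C * (‖u x - u y‖ₑ + ‖e j x - e j y‖ₑ + edist x y))
    (h2 : ∀ j, ∀ x ∈ Ω, ‖w j x‖ₑ ≤ C * (‖u x‖ₑ + ‖e j x‖ₑ + 1))
    (h3 : ∀ᵐ x ∂(volume.restrict Ω), Tendsto (fun j => w j x) atTop (𝓝 0)) :
    Tendsto (fun j => NN k Ω (w j)) atTop (𝓝 0) := by
  have heL : Tendsto (fun j => NL k Ω (e j)) atTop (𝓝 0) :=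
    tendsto_of_tendsto_of_tendsto_of_le_of_le tendsto_const_nhds he0 (fun j => zero_le) (fun j => le_self_add)
  have heE : Tendsto (fun j => NE k Ω (e j)) atTop (𝓝 0) :=
    tendsto_of_tendsto_of_tendsto_of_le_of_le tendsto_const_nhds he0 (fun j => zero_le) (fun j => le_add_self)
  have hCf : (C:ENNReal)^(k+1) * 3^(k+1) ≠ ⊤ := by finiteness
  have hL : Tendsto (fun j => NL k Ω (w j)) atTop (𝓝 0) := by
    refine sp_lemma (fun j x => ‖w j x‖ₑ^(k+1)) (fun j x => ‖e j x‖ₑ^(k+1)) (fun x => ‖u x‖ₑ^(k+1) + 1) _ hCf (fun j => (hw j).enorm.pow_const _)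
      ((hu.enorm.pow_const _).add_const _) ?_ ?_ heL ?_
    · intro j
      filter_upwards [ae_restrict_mem hΩ] with x hx
      refine (pow_le_pow_left₀ zero_le (h2 j x hx) _).trans ?_
      rw [mul_pow, mul_assoc]
      refine mul_le_mul' le_rfl ((pow_add3 _ _ _ _).trans ?_)
      rw [one_pow, add_right_comm]
    · rw [lintegral_add_right _ measurable_const]
      refine (ENNReal.add_lt_top.2 ⟨lt_of_le_of_lt le_self_add huf, ?_⟩).ne
      simp only [lintegral_const, one_mul, Measure.restrict_apply MeasurableSet.univ, Set.univ_inter]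
      exact hΩb.measure_lt_top
    · filter_upwards [h3] with x hx
      have := ENNReal.Tendsto.pow (n := k+1) hx.enorm
      simpa using this
  have hE : Tendsto (fun j => NE k Ω (w j)) atTop (𝓝 0) := by
    obtain ⟨R, hR⟩ := exists_R hΩb
    have hsm : Measurable (fun q : Euc n × Euc n => sker n R (q.1 - q.2)) := by have := sker_meas (n := n) R; fun_prop
    refine sp_lemma (fun j => eg k (w j)) (fun j => eg k (e j)) (fun q => eg k u q + sker n R (q.1 - q.2)) _ hCf (fun j => eg_aemeas k (hw j))
      ((eg_aemeas k hu).add hsm.aemeasurable) ?_ ?_ heE ?_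
    · intro j
      rw [Measure.prod_restrict]
      filter_upwards [ae_restrict_mem (hΩ.prod hΩ)] with q hq
      by_cases h : q.1 = q.2
      · rw [eg, h]; simp
      rw [sker_eq (hR _ hq.1 _ hq.2), ← edist_pow_div (by omega) k h, eg, eg, eg, ← ENNReal.add_div, ← ENNReal.add_div, ← mul_div_assoc]
      refine ENNReal.div_le_div_right ?_ _
      refine (pow_le_pow_left₀ zero_le (h1 j _ hq.1 _ hq.2) _).trans ?_
      rw [mul_pow, mul_assoc]
      refine mul_le_mul' le_rfl ((pow_add3 _ _ _ _).trans ?_)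
      rw [add_right_comm]
    · rw [lintegral_add_right _ hsm]
      exact (ENNReal.add_lt_top.2 ⟨lt_of_le_of_lt le_add_self huf, sker_int hn hΩ hΩb R⟩).ne
    · have h4 := Measure.quasiMeasurePreserving_fst (μ := volume.restrict Ω) (ν := volume.restrict Ω) |>.ae h3
      have h5 := Measure.quasiMeasurePreserving_snd (μ := volume.restrict Ω) (ν := volume.restrict Ω) |>.ae h3
      filter_upwards [h4, h5] with q hq1 hq2
      exact eg_tendsto k w q hq1 hq2
  simpa [NN] using hL.add hE

lemma NL_subseq (k : ℕ) {Ω : Set (Euc n)} (e : ℕ → Euc n → F) (he : ∀ j, AEStronglyMeasurable (e j) (volume.restrict Ω))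
    (h : Tendsto (fun j => NL k Ω (e j)) atTop (𝓝 0)) : ∃ ms : ℕ → ℕ, StrictMono ms ∧
      ∀ᵐ x ∂(volume.restrict Ω), Tendsto (fun j => e (ms j) x) atTop (𝓝 0) := by
  have h1 : Tendsto (fun j => eLpNorm (e j - 0) ((k+1 : ℕ) : ENNReal) (volume.restrict Ω)) atTop (𝓝 0) := by
    have e1 : ∀ j, eLpNorm (e j - 0) ((k+1 : ℕ) : ENNReal) (volume.restrict Ω) = (NL k Ω (e j)) ^ (1 / ((k+1 : ℕ) : ℝ)) := by
      intro j
      rw [eLpNorm_eq_lintegral_rpow_enorm_toReal (by norm_cast) (by finiteness)]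
      simp only [sub_zero, ENNReal.toReal_natCast, NL, ENNReal.rpow_natCast]
    simp only [e1]
    have := h.ennrpow_const (1 / ((k+1 : ℕ) : ℝ))
    rwa [ENNReal.zero_rpow_of_pos (by positivity)] at this
  have h2 := tendstoInMeasure_of_tendsto_eLpNorm (by norm_cast) he aestronglyMeasurable_zero h1
  obtain ⟨ms, hm, hh⟩ := h2.exists_seq_tendsto_ae
  exact ⟨ms, hm, hh⟩

lemma superpos (hn : 2 ≤ n) (k : ℕ) {Ω : Set (Euc n)} (hΩ : MeasurableSet Ω) (hΩb : Bornology.IsBounded Ω) (u : Euc n → F)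
    (hu : AEStronglyMeasurable u (volume.restrict Ω)) (huf : NN k Ω u < ⊤) (v : ℕ → Euc n → F)
    (hv : ∀ j, AEStronglyMeasurable (v j) (volume.restrict Ω)) (hv0 : Tendsto (fun j => NN k Ω (v j - u)) atTop (𝓝 0))
    (f : F → G) (K : NNReal) (hf : LipschitzWith K f) :
    Tendsto (fun j => NN k Ω (f ∘ v j - f ∘ u)) atTop (𝓝 0) := by
  have he : ∀ j, AEStronglyMeasurable (v j - u) (volume.restrict Ω) := fun j => (hv j).sub hu
  apply tendsto_of_subseq_tendsto
  intro ns hns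
  have h0 := hv0.comp hns
  have heL : Tendsto (fun j => NL k Ω (v (ns j) - u)) atTop (𝓝 0) :=
    tendsto_of_tendsto_of_tendsto_of_le_of_le tendsto_const_nhds h0 (fun j => zero_le) (fun j => le_self_add)
  obtain ⟨ms, hm, hms⟩ := NL_subseq k _ (fun j => he (ns j)) heL
  refine ⟨ms, ?_⟩
  have hK : ∀ a b, ‖f a - f b‖ₑ ≤ K * ‖a - b‖ₑ := fun a b => by
    rw [← edist_eq_enorm_sub, ← edist_eq_enorm_sub]; exact hf a b
  refine NN_dom hn k hΩ hΩb u hu huf (fun j => v (ns (ms j)) - u) (fun j => he _) (h0.comp hm.tendsto_atTop)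
    (fun j => f ∘ v (ns (ms j)) - f ∘ u) (fun j => (hf.continuous.comp_aestronglyMeasurable (hv _)).sub (hf.continuous.comp_aestronglyMeasurable hu)) (2 * K) ?_ ?_ ?_
  · intro j x _ y _
    set a := v (ns (ms j))
    have e1 : (f ∘ a - f ∘ u) x - (f ∘ a - f ∘ u) y = (f (a x) - f (a y)) - (f (u x) - f (u y)) := by
      simp only [Pi.sub_apply, Function.comp]; abel
    have e2 : a x - a y = (u x - u y) + ((a - u) x - (a - u) y) := by simp only [Pi.sub_apply]; abel
    rw [e1]
    calc _ ≤ ‖f (a x) - f (a y)‖ₑ + ‖f (u x) - f (u y)‖ₑ := enorm_sub_le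
      _ ≤ K * (‖u x - u y‖ₑ + ‖(a - u) x - (a - u) y‖ₑ) + K * ‖u x - u y‖ₑ := by
        refine add_le_add ((hK _ _).trans (mul_le_mul' le_rfl ?_)) (hK _ _)
        rw [e2]; exact enorm_add_le _ _
      _ ≤ K * (‖u x - u y‖ₑ + ‖(a - u) x - (a - u) y‖ₑ) + K * ‖u x - u y‖ₑ + (K * ‖(a - u) x - (a - u) y‖ₑ + 2 * K * edist x y) := le_self_add
      _ = _ := by push_cast; ring
  · intro j x _
    refine (hK _ _).trans ?_
    push_cast
    refine mul_le_mul' ?_ ?_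
    · nth_rewrite 1 [← one_mul (K:ENNReal)]; exact mul_le_mul' (by norm_num) le_rfl
    · exact le_add_self.trans le_self_add
  · filter_upwards [hms] with x hx
    have h1 : Tendsto (fun j => v (ns (ms j)) x) atTop (𝓝 (u x)) := by
      simpa using hx.add_const (u x)
    have h2 := ((hf.continuous.tendsto (u x)).comp h1).sub_const (f (u x))
    simpa using h2

end SP

section Lip
variable {n : ℕ} {F : Type*} [NormedAddCommGroup F] [NormedSpace ℝ F]

lemma local_fderiv_bound {Ω : Set (Euc n)} (hΩ : IsOpen Ω) {w : Euc n → F} (hw : ContDiffOn ℝ 1 w (closure Ω)) {p : Euc n} (hp : p ∈ closure Ω) :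
    ∃ r > 0, ∃ M : ℝ, 0 ≤ M ∧ ∀ x ∈ Ω, x ∈ ball p r → DifferentiableAt ℝ w x ∧ ‖fderiv ℝ w x‖ ≤ M := by
  have h1 := hw p hp
  rw [show (1 : WithTop ℕ∞) = 0 + 1 by simp, contDiffWithinAt_succ_iff_hasFDerivWithinAt (by simp), Set.insert_eq_of_mem hp] at h1
  obtain ⟨U, hU, -, f', hf', hc⟩ := h1
  have hpU : p ∈ U := mem_of_mem_nhdsWithin hp hU
  have hb : ∀ᶠ x in 𝓝[U] p, ‖f' x‖ < ‖f' p‖ + 1 := by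
    have := hc.continuousWithinAt.norm
    exact this.eventually (gt_mem_nhds (by linarith))
  have hb' : ∀ᶠ x in 𝓝[closure Ω] p, x ∈ U ∧ ‖f' x‖ < ‖f' p‖ + 1 := by
    have h2 : {x | ‖f' x‖ < ‖f' p‖ + 1} ∈ 𝓝[U] p := hb
    rw [mem_nhdsWithin] at h2
    obtain ⟨o, ho, hpo, hoU⟩ := h2
    filter_upwards [hU, mem_nhdsWithin_of_mem_nhds (ho.mem_nhds hpo)] with x hx hxo
    exact ⟨hx, hoU ⟨hxo, hx⟩⟩
  rw [eventually_nhdsWithin_iff, Metric.eventually_nhds_iff_ball] at hb'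
  obtain ⟨r, hr, hball⟩ := hb'
  refine ⟨r, hr, ‖f' p‖ + 1, by positivity, ?_⟩
  intro x hxΩ hxr
  have hx := hball x hxr (subset_closure hxΩ)
  have hUx : U ∈ 𝓝 x := by
    filter_upwards [hΩ.mem_nhds hxΩ, isOpen_ball.mem_nhds hxr] with y hy hyr
    exact (hball y hyr (subset_closure hy)).1
  have hd := (hf' x hx.1).hasFDerivAt hUx
  exact ⟨hd.differentiableAt, by rw [hd.fderiv]; exact hx.2.le⟩

lemma seg_bound {Ω : Set (Euc n)} {w : Euc n → F} {p : Euc n} {r M : ℝ}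
    (hM : ∀ x ∈ Ω, x ∈ ball p r → DifferentiableAt ℝ w x ∧ ‖fderiv ℝ w x‖ ≤ M) {a b : Euc n}
    (h : ∀ x ∈ segment ℝ a b, x ∈ Ω ∧ x ∈ ball p r) : ‖w b - w a‖ ≤ M * ‖b - a‖ :=
  (convex_segment a b).norm_image_sub_le_of_norm_fderiv_le (fun x hx => (hM x (h x hx).1 (h x hx).2).1)
    (fun x hx => (hM x (h x hx).1 (h x hx).2).2) (left_mem_segment _ _ _) (right_mem_segment _ _ _)

lemma local_lip {Ω : Set (Euc n)} (hΩ : IsOpen Ω) (hs : SmoothBoundary n Ω) {w : Euc n → F} (hw : ContDiffOn ℝ 1 w (closure Ω)) {p : Euc n} (hp : p ∈ closure Ω) :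
    ∃ r > 0, ∃ L : ℝ, 0 ≤ L ∧ ∀ a ∈ Ω, a ∈ ball p r → ∀ b ∈ Ω, b ∈ ball p r → ‖w b - w a‖ ≤ L * ‖b - a‖ := by
  obtain ⟨r0, hr0, M, hM0, hM⟩ := local_fderiv_bound hΩ hw hp
  by_cases hpΩ : p ∈ Ω
  · obtain ⟨r1, hr1, hball⟩ := Metric.isOpen_iff.1 hΩ p hpΩ
    refine ⟨min r0 r1, lt_min hr0 hr1, M, hM0, ?_⟩
    intro a _ ha b _ hb
    apply seg_bound hM
    intro x hx
    have := (convex_ball p (min r0 r1)).segment_subset ha hb hx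
    exact ⟨hball (ball_subset_ball (min_le_right _ _) this), ball_subset_ball (min_le_left _ _) this⟩
  · obtain ⟨f, hf, hfΩ, hfd⟩ := hs
    have hpf : p ∈ frontier Ω := by rw [hΩ.frontier_eq]; exact ⟨hp, hpΩ⟩
    have hne := hfd p hpf
    obtain ⟨e, he⟩ : ∃ e, fderiv ℝ f p e < 0 := by
      by_contra hcon
      push Not at hcon
      apply hne
      ext x
      have h1 := hcon x
      have h2 := hcon (-x)
      rw [map_neg] at h2
      simp only [ContinuousLinearMap.zero_apply]
      linarith
    set c := -(fderiv ℝ f p e) / 2 with hc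
    have hc0 : 0 < c := by rw [hc]; linarith
    have hfc : Continuous (fderiv ℝ f) := hf.continuous_fderiv (by simp)
    have hfdiff : Differentiable ℝ f := hf.differentiable (by simp)
    set M1 := ‖fderiv ℝ f p‖ + 1 with hM1
    have hM1p : 0 < M1 := by positivity
    have ev : ∀ᶠ x in 𝓝 p, fderiv ℝ f x e < -c ∧ ‖fderiv ℝ f x‖ < M1 := by
      have h1 : ContinuousAt (fun x => fderiv ℝ f x e) p := by fun_prop
      have h2 : ContinuousAt (fun x => ‖fderiv ℝ f x‖) p := by fun_prop
      exact (h1.eventually (gt_mem_nhds (by linarith))).and (h2.eventually (gt_mem_nhds (by linarith)))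
    obtain ⟨r1, hr1, hball⟩ := Metric.eventually_nhds_iff_ball.1 ev
    set r := min r0 r1 with hr
    have hrp : 0 < r := lt_min hr0 hr1
    set κ := M1 / c with hκ
    have hκ0 : 0 < κ := by positivity
    -- along e
    have mem_iff : ∀ x, x ∈ Ω ↔ f x < 0 := fun x => by rw [hfΩ]; rfl
    have along : ∀ a ∈ ball p r, ∀ t, 0 ≤ t → a + t • e ∈ ball p r → f (a + t • e) ≤ f a - c * t := by
      intro a ha t ht hat
      rcases eq_or_lt_of_le ht with rfl | ht
      · simp
      have hder : ∀ s : ℝ, HasDerivAt (fun s : ℝ => f (a + s • e)) (fderiv ℝ f (a + s • e) e) s := by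
        intro s
        have h1 : HasDerivAt (fun s : ℝ => a + s • e) e s := by
          simpa using ((hasDerivAt_id s).smul_const e).const_add a
        exact (hfdiff _).hasFDerivAt.comp_hasDerivAt s h1
      obtain ⟨s, hs, hse⟩ := exists_hasDerivAt_eq_slope (fun s : ℝ => f (a + s • e)) _ ht
        (fun s _ => (hder s).continuousAt.continuousWithinAt) (fun s _ => hder s)
      have hmem : a + s • e ∈ ball p r := by
        have hconv := convex_ball p r
        have := hconv.segment_subset ha hat
        apply this
        rw [segment_eq_image']
        refine ⟨s / t, ⟨div_nonneg hs.1.le ht.le, (div_le_one ht).2 hs.2.le⟩, ?_⟩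
        simp only [add_sub_cancel_left, smul_smul]
        rw [div_mul_cancel₀ _ ht.ne']
      have h3 := (hball _ (ball_subset_ball (min_le_right _ _) hmem)).1
      rw [hse] at h3
      simp only [zero_smul, add_zero, sub_zero] at h3
      rw [div_lt_iff₀ ht] at h3
      linarith
    refine ⟨r / (1 + 2 * κ * ‖e‖), by positivity, M * (1 + 2 * κ * ‖e‖), by positivity, ?_⟩
    intro a haΩ ha b hbΩ hb
    set r' := r / (1 + 2 * κ * ‖e‖) with hr'
    have hr'p : 0 < r' := by positivity
    have hrr' : r' + 2 * r' * κ * ‖e‖ = r := by rw [hr']; field_simp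
    set d := ‖b - a‖ with hd
    have hd2 : d ≤ 2 * r' := by
      rw [hd, ← dist_eq_norm]
      have := dist_triangle b p a
      rw [mem_ball] at ha hb
      rw [dist_comm p a] at this
      linarith
    have hd0 : 0 ≤ d := norm_nonneg _
    set l := κ * d with hl
    have hl0 : 0 ≤ l := by positivity
    have hshift : ∀ x ∈ ball p r', ∀ t ∈ Set.Icc 0 l, x + t • e ∈ ball p r := by
      intro x hx t ht
      rw [mem_ball] at hx ⊢
      calc dist (x + t • e) p ≤ dist (x + t • e) x + dist x p := dist_triangle _ _ _
        _ = t * ‖e‖ + dist x p := by rw [dist_eq_norm, add_sub_cancel_left, norm_smul, Real.norm_of_nonneg ht.1]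
        _ ≤ l * ‖e‖ + dist x p := by gcongr; exact ht.2
        _ < 2 * r' * κ * ‖e‖ + r' := by
          refine add_lt_add_of_le_of_lt ?_ hx
          rw [hl]
          have : κ * d ≤ κ * (2 * r') := by gcongr
          nlinarith [norm_nonneg e]
        _ = r := by linarith
    have hsubr : ∀ x ∈ ball p r', x ∈ ball p r := fun x hx => by
      have := hshift x hx 0 ⟨le_rfl, hl0⟩
      simpa using this
    have hM' : ∀ x ∈ Ω, x ∈ ball p r → DifferentiableAt ℝ w x ∧ ‖fderiv ℝ w x‖ ≤ M := fun x hx hxr => hM x hx (ball_subset_ball (min_le_left _ _) hxr)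
    have hvert : ∀ x ∈ Ω, x ∈ ball p r' → ‖w (x + l • e) - w x‖ ≤ M * (l * ‖e‖) := by
      intro x hxΩ hx
      have := seg_bound hM' (a := x) (b := x + l • e) ?_
      · simpa [norm_smul, abs_of_nonneg hl0] using this
      · intro y hy
        rw [segment_eq_image'] at hy
        obtain ⟨θ, hθ, rfl⟩ := hy
        simp only [add_sub_cancel_left, smul_smul]
        have hmem := hshift x hx (θ * l) ⟨mul_nonneg hθ.1 hl0, mul_le_of_le_one_left hl0 hθ.2⟩
        refine ⟨?_, hmem⟩
        rw [mem_iff] at hxΩ ⊢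
        have := along x (hsubr x hx) (θ * l) (mul_nonneg hθ.1 hl0) hmem
        have : 0 ≤ c * (θ * l) := mul_nonneg hc0.le (mul_nonneg hθ.1 hl0)
        linarith
    have hhor : ‖w (b + l • e) - w (a + l • e)‖ ≤ M * d := by
      have := seg_bound hM' (a := a + l • e) (b := b + l • e) ?_
      · simpa [add_sub_add_right_eq_sub] using this
      · intro y hy
        have hya := hshift a ha l ⟨hl0, le_rfl⟩
        have hyr := (convex_ball p r).segment_subset hya (hshift b hb l ⟨hl0, le_rfl⟩) hy
        refine ⟨?_, hyr⟩
        have h1 := along a (hsubr a ha) l hl0 hya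
        have h2 : ‖f y - f (a + l • e)‖ ≤ M1 * ‖y - (a + l • e)‖ :=
          (convex_ball p r).norm_image_sub_le_of_norm_fderiv_le (fun x _ => hfdiff x)
            (fun x hx => (hball x (ball_subset_ball (min_le_right _ _) hx)).2.le) hya hyr
        have h3 : ‖y - (a + l • e)‖ ≤ d := by
          rw [segment_eq_image'] at hy
          obtain ⟨θ, hθ, rfl⟩ := hy
          simp only [add_sub_cancel_left, add_sub_add_right_eq_sub, norm_smul, Real.norm_of_nonneg hθ.1]
          exact mul_le_of_le_one_left (norm_nonneg _) hθ.2
        have h4 : c * l = M1 * d := by rw [hl, hκ]; field_simp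
        rw [mem_iff] at haΩ ⊢
        have h5 := (le_abs_self _).trans (h2.trans (mul_le_mul_of_nonneg_left h3 hM1p.le))
        linarith
    have hva := hvert a haΩ ha
    have hvb := hvert b hbΩ hb
    have e1 : w b - w a = (w (b + l • e) - w (a + l • e)) + (w (a + l • e) - w a) - (w (b + l • e) - w b) := by abel
    calc ‖w b - w a‖ ≤ M * d + M * (l * ‖e‖) + M * (l * ‖e‖) := by
          rw [e1]
          exact (norm_sub_le _ _).trans (add_le_add ((norm_add_le _ _).trans (add_le_add hhor hva)) hvb)
      _ = _ := by rw [hl]; ring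

lemma glob_lip {Ω : Set (Euc n)} (hΩ : IsOpen Ω) (hΩb : Bornology.IsBounded Ω) (hs : SmoothBoundary n Ω) {w : Euc n → F} (hw : ContDiffOn ℝ 1 w (closure Ω)) :
    ∃ K : NNReal, LipschitzOnWith K w (closure Ω) := by
  have hcp : IsCompact (closure Ω) := hΩb.isCompact_closure
  apply LocallyLipschitzOn.exists_lipschitzOnWith_of_compact hcp
  intro p hp
  obtain ⟨r, hr, L, hL, h⟩ := local_lip hΩ hs hw hp
  refine ⟨⟨L, hL⟩, closure Ω ∩ ball p r, inter_mem_nhdsWithin _ (ball_mem_nhds p hr), ?_⟩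
  have h1 : LipschitzOnWith ⟨L, hL⟩ w (Ω ∩ ball p r) := by
    apply LipschitzOnWith.of_dist_le_mul
    intro x hx y hy
    rw [dist_eq_norm, dist_eq_norm]
    exact h y hy.1 hy.2 x hx.1 hx.2
  have h2 : LipschitzOnWith ⟨L, hL⟩ w (closure (Ω ∩ ball p r)) :=
    h1.closure (hw.continuousOn.mono (closure_mono Set.inter_subset_left))
  exact h2.mono (isOpen_ball.closure_inter)

lemma NN_C1 (hn : 2 ≤ n) (k : ℕ) {Ω : Set (Euc n)} (hΩ : IsOpen Ω) (hΩb : Bornology.IsBounded Ω) (hs : SmoothBoundary n Ω) {w : Euc n → F} (hw : ContDiffOn ℝ 1 w (closure Ω)) :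
    NN k Ω w < ⊤ := by
  obtain ⟨K, hK⟩ := glob_lip hΩ hΩb hs hw
  obtain ⟨M, hM⟩ := hΩb.isCompact_closure.exists_bound_of_continuousOn hw.continuousOn
  refine NN_lip hn k hΩ.measurableSet hΩb K M.toNNReal ?_ ?_
  · intro x hx y hy
    rw [← edist_eq_enorm_sub]
    exact hK (subset_closure hx) (subset_closure hy)
  · intro x hx
    rw [← ofReal_norm]
    exact ENNReal.ofReal_le_ofReal (hM x (subset_closure hx))

end Lip

section JP
variable {n : ℕ}

lemma compare (hn : 2 ≤ n) {Ω : Set (Euc n)} (hΩ : IsOpen Ω) (ψ : Euc n → ℝ) (hψ : Cc1 n Ω ψ) {ι : Type*} {l : Filter ι} (v v' : ι → Euc n → Euc n)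
    (hv : ∀ i, ContDiffOn ℝ 1 (v i) Ω) (hv' : ∀ i, ContDiffOn ℝ 1 (v' i) Ω) (v0 : Euc n → Euc n) (h0m : AEStronglyMeasurable v0 (volume.restrict Ω)) (h0 : NN (n-1) Ω v0 < ⊤)
    (h1 : Tendsto (fun i => NN (n-1) Ω (v i - v0)) l (𝓝 0)) (h2 : Tendsto (fun i => NN (n-1) Ω (v' i - v0)) l (𝓝 0)) :
    Tendsto (fun i => ‖(∫ x in Ω, (jacMat n (v i) x).det * ψ x) - ∫ x in Ω, (jacMat n (v' i) x).det * ψ x‖ₑ) l (𝓝 0) := by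
  have hm : ∀ i, AEStronglyMeasurable (v i - v0) (volume.restrict Ω) := fun i => ((hv i).continuousOn.aestronglyMeasurable hΩ.measurableSet).sub h0m
  have hm' : ∀ i, AEStronglyMeasurable (v' i - v0) (volume.restrict Ω) := fun i => ((hv' i).continuousOn.aestronglyMeasurable hΩ.measurableSet).sub h0m
  rw [ENNReal.tendsto_nhds_zero]
  intro ε hε
  set B : ENNReal := 3^(n-1+1) * (1 + NN (n-1) Ω v0) with hB
  have hBf : B ≠ ⊤ := by
    have := h0.ne
    finiteness
  obtain ⟨δ, hδ, hδB⟩ := exists_small (ε/2) B (ENNReal.half_pos hε.ne').ne' hBf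
  obtain ⟨C, hC, hcore⟩ := core1 hn hΩ ψ hψ (ENNReal.ofReal δ) (by simpa using hδ)
  have h3 : Tendsto (fun i => C * (3^(n-1+1) * (NN (n-1) Ω (v i - v0) + NN (n-1) Ω (v' i - v0)))) l (𝓝 0) := by
    have := ENNReal.Tendsto.const_mul (ENNReal.Tendsto.const_mul (a := 3^(n-1+1)) (h1.add h2) (Or.inr (by finiteness))) (Or.inr hC)
    simpa using this
  rw [ENNReal.tendsto_nhds_zero] at h3 h2
  filter_upwards [h3 (ε/2) (ENNReal.half_pos hε.ne'), h2 1 one_pos] with i hi hi1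
  refine (hcore (v i) (v' i) (hv i) (hv' i)).trans ?_
  rw [← ENNReal.add_halves ε]
  refine add_le_add ?_ ?_
  · refine le_trans (mul_le_mul' le_rfl ?_) hδB
    have e : v' i = (v' i - v0) + v0 := by simp
    rw [e]
    exact (NN_add (n-1) v0 (hm' i)).trans (mul_le_mul' le_rfl (add_le_add hi1 le_rfl))
  · refine le_trans (mul_le_mul' le_rfl ?_) hi
    have e : v i - v' i = (v i - v0) - (v' i - v0) := by abel
    rw [e]
    exact NN_sub (n-1) _ (hm i)

lemma hp1 (hn : 2 ≤ n) : (n:ℝ) = ((n-1 : ℕ) : ℝ) + 1 := by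
  rw [Nat.cast_sub (by omega)]; simp

lemma hs1 (hn : 2 ≤ n) : (n:ℝ) + ((n:ℝ)-1)/n * n = (n:ℝ) + ((n-1 : ℕ) : ℝ) := by
  have : (n:ℝ) ≠ 0 := by positivity
  rw [Nat.cast_sub (by omega), div_mul_cancel₀ _ this]; simp

lemma hs2 : (n:ℝ) + ((n:ℝ))/((n:ℝ)+1) * ((n:ℝ)+1) = (n:ℝ) + n := by
  have : (n:ℝ) + 1 ≠ 0 := by positivity
  rw [div_mul_cancel₀ _ this]

theorem jpair_exists (hn : 2 ≤ n) {Ω : Set (Euc n)} (hΩ : IsOpen Ω) (hΩb : Bornology.IsBounded Ω) (hs : SmoothBoundary n Ω) (ψ : Euc n → ℝ) (hψ : Cc1 n Ω ψ) (v : Euc n → Euc n)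
    (hv : AEStronglyMeasurable v (volume.restrict Ω)) (hvf : NN (n-1) Ω v < ⊤) (vk : ℕ → Euc n → Euc n) (hvk : ∀ k, ContDiffOn ℝ 1 (vk k) (closure Ω))
    (h : Tendsto (fun k => NN (n-1) Ω (vk k - v)) atTop (𝓝 0)) :
    ∃ J, JPairing n Ω v ψ J ∧ Tendsto (fun k => ∫ x in Ω, (jacMat n (vk k) x).det * ψ x) atTop (𝓝 J) := by
  have hm : ∀ w : Euc n → Euc n, ContDiffOn ℝ 1 w (closure Ω) → AEStronglyMeasurable w (volume.restrict Ω) :=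
    fun w hw => (hw.continuousOn.mono subset_closure).aestronglyMeasurable hΩ.measurableSet
  have hbr : ∀ wk : ℕ → Euc n → Euc n, (∀ k, ContDiffOn ℝ 1 (wk k) (closure Ω)) →
      (Tendsto (fun k => sobNorm n (((n : ℝ) - 1) / n) n Ω (wk k - v)) atTop (𝓝 0) ↔ Tendsto (fun k => NN (n-1) Ω (wk k - v)) atTop (𝓝 0)) := by
    intro wk hwk
    refine sob_to_NN (by omega) (n-1) _ _ (hp1 hn) (hs1 hn) (fun j => (hm _ (hwk j)).sub hv) (fun j => ?_)
    refine lt_of_le_of_lt (NN_sub (n-1) v (hm _ (hwk j))) ?_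
    exact ENNReal.mul_lt_top (by finiteness) (ENNReal.add_lt_top.2 ⟨NN_C1 hn _ hΩ hΩb hs (hwk j), hvf⟩)
  have hvk' : ∀ k, ContDiffOn ℝ 1 (vk k) Ω := fun k => (hvk k).mono subset_closure
  set a : ℕ → ℝ := fun k => ∫ x in Ω, (jacMat n (vk k) x).det * ψ x with ha
  have hcauchy : CauchySeq a := by
    rw [cauchySeq_iff_tendsto_dist_atTop_0]
    have h1 := compare hn hΩ ψ hψ (l := (atTop : Filter (ℕ × ℕ))) (fun i => vk i.1) (fun i => vk i.2) (fun i => hvk' _) (fun i => hvk' _) v hv hvf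
      (h.comp (by rw [← prod_atTop_atTop_eq]; exact tendsto_fst)) (h.comp (by rw [← prod_atTop_atTop_eq]; exact tendsto_snd))
    have h2 := (ENNReal.tendsto_toReal ENNReal.zero_ne_top).comp h1
    simpa [Function.comp_def, dist_eq_norm] using h2
  obtain ⟨J, hJ⟩ := cauchySeq_tendsto_of_complete hcauchy
  refine ⟨J, ⟨⟨vk, hvk, (hbr vk hvk).2 h, hJ⟩, ?_⟩, hJ⟩
  intro wk hwk hw
  have h1 := compare hn hΩ ψ hψ (l := (atTop : Filter ℕ)) wk vk (fun k => (hwk k).mono subset_closure) hvk' v hv hvf ((hbr wk hwk).1 hw) h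
  have h2 := (ENNReal.tendsto_toReal ENNReal.zero_ne_top).comp h1
  simp only [Function.comp_def, toReal_enorm, ENNReal.toReal_zero] at h2
  have h3 := (tendsto_zero_iff_norm_tendsto_zero.2 h2).add hJ
  simpa [ha] using h3

lemma contDiff_detF (F : Euc n → Euc n) (hF : ContDiff ℝ (⊤ : ℕ∞) F) : ContDiff ℝ 1 (fun y => (jacMat n F y).det) := by
  have hd : ContDiff ℝ 1 (fderiv ℝ F) := (hF.of_le (m := 2) (WithTop.coe_le_coe.2 le_top)).fderiv_right (by rw [one_add_one_eq_two])
  simp only [Matrix.det_apply]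
  refine ContDiff.sum fun σ _ => ContDiff.const_smul _ ?_
  refine contDiff_prod fun i _ => ?_
  simp only [jacMat, Matrix.of_apply]
  exact contDiff_euclidean.1 (hd.clm_apply contDiff_const) _

lemma det_chain {Ω : Set (Euc n)} (hΩ : IsOpen Ω) (F : Euc n → Euc n) (hF : Differentiable ℝ F) (w : Euc n → Euc n) (hw : ContDiffOn ℝ 1 w Ω) {x : Euc n} (hx : x ∈ Ω) :
    (jacMat n (F ∘ w) x).det = (jacMat n w x).det * (jacMat n F (w x)).det := by
  have hd : DifferentiableAt ℝ w x := ((hw x hx).contDiffAt (hΩ.mem_nhds hx)).differentiableAt (by norm_num)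
  rw [← det_jac, ← det_jac, ← det_jac, fderiv_comp x (hF _) hd]
  change LinearMap.det ((fderiv ℝ F (w x) : Euc n →ₗ[ℝ] Euc n) ∘ₗ (fderiv ℝ w x : Euc n →ₗ[ℝ] Euc n)) = _
  rw [LinearMap.det_comp, mul_comm]

theorem part2_formula (hn : 2 ≤ n) {Ω : Set (Euc n)} (hΩ : IsOpen Ω) (ψ : Euc n → ℝ) (hψ : Cc1 n Ω ψ) (F : Euc n → Euc n) (hF : ContDiff ℝ (⊤ : ℕ∞) F)
    (w : Euc n → Euc n) (hw : ContDiffOn ℝ 1 w Ω) :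
    -∫ x in Ω, ∑ i, jvec n w x i * fderiv ℝ (fun y => ψ y * (jacMat n F (w y)).det) x (EuclideanSpace.single i 1) =
      ∫ x in Ω, (jacMat n (F ∘ w) x).det * ψ x := by
  obtain ⟨hψ1, hψc, hψΩ⟩ := hψ
  obtain ⟨χ, hχ, hχc, hχΩ, hχ1, hχψ⟩ := exists_cutoff hψc.isCompact hΩ hψΩ
  set φ : Euc n → ℝ := fun y => ψ y * (jacMat n F (w y)).det with hφd
  have hφ : ContDiff ℝ 1 φ := cut_contDiff hΩ hψ1 hψΩ ((contDiff_detF F hF).comp_contDiffOn hw)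
  have hφs : tsupport φ ⊆ tsupport ψ := tsupport_mul_subset_left
  have hcw := cut_contDiff hΩ hχ hχΩ hw
  have key := ibp hn (fun x => χ x • w x) hcw (hχc.smul_right) φ hφ
  have hloc : ∀ x ∈ tsupport ψ, (fun x => χ x • w x) =ᶠ[𝓝 x] w := by
    intro x hx
    filter_upwards [hχψ x hx] with y hy
    simp [hy]
  have e1 : ∫ x in Ω, ∑ i, jvec n w x i * fderiv ℝ φ x (EuclideanSpace.single i 1) = ∫ x, ∑ i, jvec n (fun x => χ x • w x) x i * fderiv ℝ φ x (EuclideanSpace.single i 1) := by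
    have hz : ∀ x, x ∉ tsupport ψ → fderiv ℝ φ x = 0 := by
      intro x hx
      have : x ∉ tsupport φ := fun h => hx (hφs h)
      rw [(notMem_tsupport_iff_eventuallyEq.1 this).fderiv_eq]
      exact fderiv_const_apply (0:ℝ)
    rw [setIntegral_eq_integral_of_forall_compl_eq_zero]
    · congr 1; ext x
      by_cases hx : x ∈ tsupport ψ
      · have h1 := hloc x hx
        have h2 : jvec n (fun x => χ x • w x) x = jvec n w x := by
          have h3 : jacMat n (fun x => χ x • w x) x = jacMat n w x := by
            unfold jacMat; rw [h1.fderiv_eq]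
          unfold jvec
          rw [h3, h1.self_of_nhds]
        rw [h2]
      · rw [hz x hx]; simp
    · intro x hx
      rw [hz x (fun h => hx (hψΩ h))]; simp
  have e2 : ∫ x in Ω, (jacMat n (F ∘ w) x).det * ψ x = ∫ x, (jacMat n (fun x => χ x • w x) x).det * φ x := by
    rw [setIntegral_eq_integral_of_forall_compl_eq_zero]
    · congr 1; ext x
      by_cases hx : x ∈ tsupport ψ
      · have h1 := hloc x hx
        rw [det_chain hΩ F (hF.differentiable (by simp)) w hw (hψΩ hx)]
        have h2 : jacMat n (fun x => χ x • w x) x = jacMat n w x := by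
          unfold jacMat; rw [h1.fderiv_eq]
        rw [h2, hφd]; ring
      · simp [hφd, image_eq_zero_of_notMem_tsupport hx]
    · intro x hx
      rw [image_eq_zero_of_notMem_tsupport fun h => hx (hψΩ h), mul_zero]
  rw [e1, e2, key]

theorem part2 (hn : 2 ≤ n) {Ω : Set (Euc n)} (hΩ : IsOpen Ω) (hΩb : Bornology.IsBounded Ω) (hs : SmoothBoundary n Ω)
    (u : Euc n → Euc n) (hu : AEStronglyMeasurable u (volume.restrict Ω)) (huf : NN n Ω u < ⊤)
    (F : Euc n → Euc n) (hF : ContDiff ℝ (⊤ : ℕ∞) F) (K : NNReal) (hFK : LipschitzWith K F) (ψ : Euc n → ℝ) (hψ : Cc1 n Ω ψ)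
    (uk : ℕ → Euc n → Euc n) (huk : ∀ k, ContDiffOn ℝ 1 (uk k) (closure Ω)) (h : Tendsto (fun k => NN n Ω (uk k - u)) atTop (𝓝 0)) :
    ∃ J, JPairing n Ω (F ∘ u) ψ J ∧ Tendsto (fun k => ∫ x in Ω, (jacMat n (F ∘ uk k) x).det * ψ x) atTop (𝓝 J) := by
  have hm : ∀ k, AEStronglyMeasurable (uk k) (volume.restrict Ω) :=
    fun k => ((huk k).continuousOn.mono subset_closure).aestronglyMeasurable hΩ.measurableSet
  have huf' := embed_fin hn hΩ.measurableSet hΩb huf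
  have h1 := superpos hn (n-1) hΩ.measurableSet hΩb u hu huf' uk hm (embed_tendsto hn hΩ.measurableSet hΩb h) F K hFK
  have hFuk : ∀ k, ContDiffOn ℝ 1 (F ∘ uk k) (closure Ω) := fun k => (hF.of_le (by exact_mod_cast le_top)).comp_contDiffOn (huk k)
  have hFu : AEStronglyMeasurable (F ∘ u) (volume.restrict Ω) := hFK.continuous.comp_aestronglyMeasurable hu
  refine jpair_exists hn hΩ hΩb hs ψ hψ (F ∘ u) hFu ?_ (fun k => F ∘ uk k) hFuk h1
  -- finiteness
  rw [ENNReal.tendsto_nhds_zero] at h1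
  obtain ⟨k, hk⟩ := (h1 1 one_pos).exists
  have e : F ∘ u = (F ∘ uk k) - (F ∘ uk k - F ∘ u) := by abel
  rw [e]
  refine lt_of_le_of_lt (NN_sub (n-1) _ (hFK.continuous.comp_aestronglyMeasurable (hm k))) ?_
  exact ENNReal.mul_lt_top (by finiteness) (ENNReal.add_lt_top.2 ⟨NN_C1 hn _ hΩ hΩb hs (hFuk k), lt_of_le_of_lt hk ENNReal.one_lt_top⟩)

end JP

section DN
variable {n : ℕ}

lemma anti_measure {K : NNReal} {Φ : Euc n → Euc n} (h : AntilipschitzWith K Φ) (s : Set (Euc n)) :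
    volume (Φ ⁻¹' s) ≤ (K:ENNReal)^n * volume s := by
  haveI : Measure.IsAddHaarMeasure (μH[(n:ℝ)] : Measure (Euc n)) := by
    simpa using MeasureTheory.isAddHaarMeasure_hausdorffMeasure (E := EuclideanSpace ℝ (Fin n))
  have e := Measure.isAddLeftInvariant_eq_smul (volume : Measure (Euc n)) (μH[(n:ℝ)])
  rw [e]
  have h1 := h.hausdorffMeasure_preimage_le (d := n) (by positivity) s
  rw [ENNReal.rpow_natCast] at h1
  simp only [Measure.smul_apply, ENNReal.smul_def, smul_eq_mul]
  calc _ ≤ _ * ((K:ENNReal)^n * μH[(n:ℝ)] s) := mul_le_mul' le_rfl h1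
    _ = _ := by ring

lemma map_le {K : NNReal} {Φ : Euc n → Euc n} (h : AntilipschitzWith K Φ) (hc : Continuous Φ) {Ω : Set (Euc n)} (hΩ : MeasurableSet Ω) (hm : Set.MapsTo Φ Ω Ω) :
    (volume.restrict Ω).map Φ ≤ ((K:ENNReal)^n) • volume.restrict Ω := by
  refine Measure.le_iff.2 fun s hs => ?_
  rw [Measure.map_apply hc.measurable hs, Measure.smul_apply, Measure.restrict_apply hs, Measure.restrict_apply (hc.measurable hs), smul_eq_mul]
  refine le_trans (measure_mono ?_) (anti_measure h (s ∩ Ω))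
  rintro x ⟨hx, hxΩ⟩
  exact ⟨hx, hm hxΩ⟩

variable {F : Type*} [NormedAddCommGroup F]

lemma NL_comp (k : ℕ) {K : NNReal} {Φ : Euc n → Euc n} (h : AntilipschitzWith K Φ) (hc : Continuous Φ) {Ω : Set (Euc n)} (hΩ : MeasurableSet Ω) (hm : Set.MapsTo Φ Ω Ω)
    (w : Euc n → F) (hw : StronglyMeasurable w) : NL k Ω (w ∘ Φ) ≤ (K:ENNReal)^n * NL k Ω w := by
  unfold NL
  have h1 : ∫⁻ x in Ω, ‖(w ∘ Φ) x‖ₑ ^ (k+1) = ∫⁻ y, ‖w y‖ₑ^(k+1) ∂((volume.restrict Ω).map Φ) := by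
    rw [lintegral_map (hw.enorm.pow_const _) hc.measurable]; rfl
  rw [h1]
  refine (lintegral_mono' (map_le h hc hΩ hm) le_rfl).trans ?_
  rw [lintegral_smul_measure, smul_eq_mul]

lemma eg_meas (k : ℕ) {w : Euc n → F} (hw : StronglyMeasurable w) : Measurable (eg k w) := by
  unfold eg
  apply Measurable.div
  · exact ((hw.comp_measurable measurable_fst).sub (hw.comp_measurable measurable_snd)).enorm.pow_const _
  · fun_prop

lemma eg_comp_le (k : ℕ) {L : NNReal} (hL : L ≠ 0) {Φ : Euc n → Euc n} (hLip : LipschitzWith L Φ) (w : Euc n → F) (q : Euc n × Euc n) :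
    eg k (w ∘ Φ) q ≤ (L:ENNReal)^(n+k) * eg k w (Φ q.1, Φ q.2) := by
  have h := hLip q.1 q.2
  simp only [eg, Function.comp]
  rw [ENNReal.div_eq_inv_mul, ENNReal.div_eq_inv_mul, ← mul_assoc]
  refine mul_le_mul' ?_ le_rfl
  have h2 : edist (Φ q.1) (Φ q.2) ^ (n+k) ≤ (L:ENNReal)^(n+k) * edist q.1 q.2 ^ (n+k) := by
    rw [← mul_pow]; exact pow_le_pow_left' h _
  have h3 := ENNReal.inv_le_inv.2 h2
  have hL0 : (L:ENNReal)^(n+k) ≠ 0 := pow_ne_zero _ (by simpa using hL)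
  have hLt : (L:ENNReal)^(n+k) ≠ ⊤ := by finiteness
  calc _ = (L:ENNReal)^(n+k) * ((L:ENNReal)^(n+k) * edist q.1 q.2 ^ (n+k))⁻¹ := by
        rw [ENNReal.mul_inv (Or.inl hL0) (Or.inl hLt), ← mul_assoc, ENNReal.mul_inv_cancel hL0 hLt, one_mul]
    _ ≤ _ := mul_le_mul' le_rfl h3

lemma NE_comp (k : ℕ) {K L : NNReal} (hL : L ≠ 0) {Φ : Euc n → Euc n} (hLip : LipschitzWith L Φ) (h : AntilipschitzWith K Φ) {Ω : Set (Euc n)} (hΩ : MeasurableSet Ω) (hm : Set.MapsTo Φ Ω Ω)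
    (w : Euc n → F) (hw : StronglyMeasurable w) : NE k Ω (w ∘ Φ) ≤ (L:ENNReal)^(n+k) * ((K:ENNReal)^n * (K:ENNReal)^n * NE k Ω w) := by
  unfold NE
  have hc := hLip.continuous
  refine (lintegral_mono (eg_comp_le k hL hLip w)).trans ?_
  rw [lintegral_const_mul' _ _ (by finiteness)]
  refine mul_le_mul' le_rfl ?_
  have h1 : ∫⁻ q, eg k w (Φ q.1, Φ q.2) ∂((volume.restrict Ω).prod (volume.restrict Ω)) =
      ∫⁻ q, eg k w q ∂(((volume.restrict Ω).map Φ).prod ((volume.restrict Ω).map Φ)) := by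
    rw [Measure.map_prod_map _ _ hc.measurable hc.measurable, lintegral_map (eg_meas k hw) (by fun_prop)]; rfl
  rw [h1]
  haveI : SFinite (((K:ENNReal)^n) • (volume : Measure (Euc n)).restrict Ω) := inferInstance
  refine (lintegral_mono' (Measure.prod_mono (map_le h hc hΩ hm) (map_le h hc hΩ hm)) le_rfl).trans ?_
  rw [Measure.prod_smul_left, Measure.prod_smul_right, lintegral_smul_measure, lintegral_smul_measure, smul_eq_mul, smul_eq_mul, mul_assoc]

end DN

section DM
variable {n : ℕ}

lemma scheffe {α : Type*} [MeasurableSpace α] {μ : Measure α} (d b : ℕ → α → ENNReal) (b0 : α → ENNReal) (C : ENNReal) (hC : C ≠ ⊤)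
    (hd : ∀ j, AEMeasurable (d j) μ) (hb : ∀ j, AEMeasurable (b j) μ) (hb0 : AEMeasurable b0 μ) (hdb : ∀ j, ∀ᵐ x ∂μ, d j x ≤ C * (b0 x + b j x))
    (hbf : ∫⁻ x, b0 x ∂μ ≠ ⊤) (c : ℕ → ENNReal) (hc : Tendsto c atTop (𝓝 1)) (hbc : ∀ j, ∫⁻ x, b j x ∂μ ≤ c j * ∫⁻ x, b0 x ∂μ)
    (hblim : ∀ᵐ x ∂μ, Tendsto (fun j => b j x) atTop (𝓝 (b0 x)))
    (hd0 : ∀ᵐ x ∂μ, Tendsto (fun j => d j x) atTop (𝓝 0)) :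
    Tendsto (fun j => ∫⁻ x, d j x ∂μ) atTop (𝓝 0) := by
  have hmin : Tendsto (fun j => ∫⁻ x, min (b j x) (b0 x) ∂μ) atTop (𝓝 (∫⁻ x, b0 x ∂μ)) := by
    refine tendsto_lintegral_of_dominated_convergence' b0 (fun j => (hb j).min hb0) (fun j => Eventually.of_forall fun x => min_le_right _ _) hbf ?_
    filter_upwards [hblim] with x hx
    have := hx.min (tendsto_const_nhds (x := b0 x))
    simpa using this
  have hpos : Tendsto (fun j => ∫⁻ x, (b j x - min (b j x) (b0 x)) ∂μ) atTop (𝓝 0) := by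
    have h1 : Tendsto (fun j => c j * ∫⁻ x, b0 x ∂μ) atTop (𝓝 (1 * ∫⁻ x, b0 x ∂μ)) := ENNReal.Tendsto.mul_const hc (Or.inr hbf)
    have h2 := ENNReal.Tendsto.sub h1 hmin (Or.inr hbf)
    rw [one_mul, tsub_self] at h2
    refine tendsto_of_tendsto_of_tendsto_of_le_of_le tendsto_const_nhds h2 (fun j => zero_le) (fun j => ?_)
    dsimp only
    rw [lintegral_sub' ((hb j).min hb0) ?_ (Eventually.of_forall fun x => min_le_left _ _)]
    · exact tsub_le_tsub_right (hbc j) _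
    · exact (lt_of_le_of_lt (lintegral_mono fun x => min_le_right _ _) hbf.lt_top).ne
  refine sp_lemma d (fun j x => b j x - min (b j x) (b0 x)) (fun x => b0 x + b0 x) C hC hd (hb0.add hb0) ?_ ?_ hpos hd0
  · intro j
    filter_upwards [hdb j] with x hx
    refine hx.trans (mul_le_mul' le_rfl ?_)
    rw [add_assoc]
    refine add_le_add le_rfl ?_
    rw [← tsub_le_iff_left]
    exact tsub_le_tsub_left (min_le_right _ _) _
  · rw [lintegral_add_left' hb0]; exact ENNReal.add_ne_top.2 ⟨hbf, hbf⟩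

variable {F : Type*} [NormedAddCommGroup F] [NormedSpace ℝ F]

lemma enorm_avg_pow (k : ℕ) (r : Euc n → ℝ) (hr : Continuous r) (hr0 : ∀ z, 0 ≤ r z) (hr1 : ∫ z, r z = 1) (g : Euc n → F) (hg : AEStronglyMeasurable g volume) :
    ‖∫ z, r z • g z‖ₑ^(k+1) ≤ ∫⁻ z, ENNReal.ofReal (r z) * ‖g z‖ₑ^(k+1) := by
  have hi : Integrable r := integrable_of_integral_eq_one hr1
  have hm : Measurable fun z => ENNReal.ofReal (r z) := hr.measurable.ennreal_ofReal
  set ν : Measure (Euc n) := volume.withDensity (fun z => ENNReal.ofReal (r z)) with hν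
  have hν1 : ν Set.univ = 1 := by
    rw [hν, withDensity_apply _ MeasurableSet.univ, setLIntegral_univ, ← ofReal_integral_eq_lintegral_ofReal hi (Eventually.of_forall hr0), hr1, ENNReal.ofReal_one]
  have hab : ν ≪ volume := withDensity_absolutelyContinuous _ _
  have h1 : ‖∫ z, r z • g z‖ₑ ≤ ∫⁻ z, ‖g z‖ₑ ∂ν := by
    refine (enorm_integral_le_lintegral_enorm _).trans_eq ?_
    rw [hν, lintegral_withDensity_eq_lintegral_mul₀ hm.aemeasurable hg.enorm]
    congr 1; ext z
    rw [enorm_smul, Real.enorm_of_nonneg (hr0 z)]; rfl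
  refine (pow_le_pow_left' h1 _).trans ?_
  refine (jensen_pow ν (fun z => ‖g z‖ₑ) (hg.mono_ac hab).enorm k).trans_eq ?_
  rw [hν1, one_pow, one_mul, hν, lintegral_withDensity_eq_lintegral_mul₀ hm.aemeasurable (hg.enorm.pow_const _)]
  rfl

lemma avg_const (r : Euc n → ℝ) (hr : Continuous r) (hr0 : ∀ z, 0 ≤ r z) (hr1 : ∫ z, r z = 1) (C : ENNReal) (A : Euc n → ENNReal) (h : ∀ z, r z ≠ 0 → A z ≤ C) :
    ∫⁻ z, ENNReal.ofReal (r z) * A z ≤ C := by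
  have hi : Integrable r := integrable_of_integral_eq_one hr1
  have hm : Measurable fun z => ENNReal.ofReal (r z) := hr.measurable.ennreal_ofReal
  calc _ ≤ ∫⁻ z, ENNReal.ofReal (r z) * C := by
        refine lintegral_mono fun z => ?_
        by_cases hz : r z = 0
        · simp [hz]
        · exact mul_le_mul' le_rfl (h z hz)
    _ = C := by
        rw [lintegral_mul_const _ hm, ← ofReal_integral_eq_lintegral_ofReal hi (Eventually.of_forall hr0), hr1, ENNReal.ofReal_one, one_mul]

/-- energy of averages -/
lemma NN_avg (k : ℕ) {Ω : Set (Euc n)} (r : Euc n → ℝ) (hr : Continuous r) (hr0 : ∀ z, 0 ≤ r z) (hr1 : ∫ z, r z = 1)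
    (T : Euc n → Euc n) (hT : Continuous T) (w : Euc n → F) (hw : StronglyMeasurable w) (hIntg : ∀ x, Integrable (fun z => r z • w (T x - z)))
    (CL CE : ENNReal) (hL : ∀ z, r z ≠ 0 → NL k Ω (fun x => w (T x - z)) ≤ CL) (hE : ∀ z, r z ≠ 0 → NE k Ω (fun x => w (T x - z)) ≤ CE) :
    NL k Ω (fun x => ∫ z, r z • w (T x - z)) ≤ CL ∧ NE k Ω (fun x => ∫ z, r z • w (T x - z)) ≤ CE := by
  have hm : Measurable fun z => ENNReal.ofReal (r z) := hr.measurable.ennreal_ofReal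
  have hwz : ∀ x, AEStronglyMeasurable (fun z => w (T x - z)) volume := fun x => (hw.comp_measurable (by fun_prop)).aestronglyMeasurable
  constructor
  · refine le_trans ?_ (avg_const r hr hr0 hr1 CL _ hL)
    unfold NL
    calc _ ≤ ∫⁻ x in Ω, ∫⁻ z, ENNReal.ofReal (r z) * ‖w (T x - z)‖ₑ^(k+1) := lintegral_mono fun x => enorm_avg_pow k r hr hr0 hr1 _ (hwz x)
      _ = ∫⁻ z, ∫⁻ x in Ω, ENNReal.ofReal (r z) * ‖w (T x - z)‖ₑ^(k+1) := by
          rw [lintegral_lintegral_swap]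
          refine Measurable.aemeasurable ?_
          refine Measurable.mul (hm.comp measurable_snd) ?_
          exact ((hw.comp_measurable (g := fun p : Euc n × Euc n => T p.1 - p.2) (by fun_prop)).enorm.pow_const _)
      _ = _ := by
          congr 1; ext z
          rw [lintegral_const_mul' _ _ ENNReal.ofReal_ne_top]
  · refine le_trans ?_ (avg_const r hr hr0 hr1 CE _ hE)
    unfold NE
    calc _ ≤ ∫⁻ q, (∫⁻ z, ENNReal.ofReal (r z) * eg k (fun x => w (T x - z)) q) ∂((volume.restrict Ω).prod (volume.restrict Ω)) := by
          refine lintegral_mono fun q => ?_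
          simp only [eg]
          rw [← integral_sub (hIntg q.1) (hIntg q.2)]
          simp only [← smul_sub]
          rw [ENNReal.div_eq_inv_mul]
          have h1 := enorm_avg_pow k r hr hr0 hr1 (fun z => w (T q.1 - z) - w (T q.2 - z)) ((hwz _).sub (hwz _))
          refine (mul_le_mul' le_rfl h1).trans ?_
          refine (lintegral_const_mul_le _ _).trans ?_
          refine lintegral_mono fun z => le_of_eq ?_
          rw [ENNReal.div_eq_inv_mul]; ring
      _ = ∫⁻ z, ∫⁻ q, ENNReal.ofReal (r z) * eg k (fun x => w (T x - z)) q ∂((volume.restrict Ω).prod (volume.restrict Ω)) := by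
          rw [lintegral_lintegral_swap]
          refine Measurable.aemeasurable ?_
          refine Measurable.mul (hm.comp measurable_snd) ?_
          simp only [eg, Function.comp_def]
          refine Measurable.div ?_ (by fun_prop)
          refine Measurable.pow_const (StronglyMeasurable.enorm ?_) _
          exact (hw.comp_measurable (g := fun p : (Euc n × Euc n) × Euc n => T p.1.1 - p.2) (by fun_prop)).sub
            (hw.comp_measurable (g := fun p : (Euc n × Euc n) × Euc n => T p.1.2 - p.2) (by fun_prop))
      _ = _ := by
          congr 1; ext z
          rw [lintegral_const_mul' _ _ ENNReal.ofReal_ne_top]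

end DM

section DF
variable {n : ℕ}

lemma deform_local {Ω : Set (Euc n)} (hΩ : IsOpen Ω) (f : Euc n → ℝ) (hf : ContDiff ℝ (⊤ : ℕ∞) f) (hfΩ : Ω = f ⁻¹' Set.Iio 0) (V : Euc n → Euc n) (hV : Continuous V)
    {p : Euc n} (hp : p ∈ closure Ω) (hpV : p ∈ frontier Ω → 0 < fderiv ℝ f p (V p)) :
    ∃ η > 0, ∀ x ∈ closure Ω, dist x p < η → ∀ t ∈ Set.Ioo 0 η, ∀ z : Euc n, ‖z‖ < η → x - t • (V x + z) ∈ Ω := by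
  have hfdiff : Differentiable ℝ f := hf.differentiable (by simp)
  have hfc : Continuous (fderiv ℝ f) := hf.continuous_fderiv (by simp)
  by_cases hpΩ : p ∈ Ω
  · have hc : Continuous (fun q : Euc n × ℝ × Euc n => q.1 - q.2.1 • (V q.1 + q.2.2)) := by fun_prop
    have h1 : ∀ᶠ q in 𝓝 ((p, 0, 0) : Euc n × ℝ × Euc n), q.1 - q.2.1 • (V q.1 + q.2.2) ∈ Ω := by
      apply hc.continuousAt.eventually
      simpa using hΩ.mem_nhds hpΩ
    obtain ⟨η, hη, hb⟩ := Metric.eventually_nhds_iff.1 h1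
    refine ⟨η, hη, fun x _ hx t ht z hz => ?_⟩
    refine hb (y := (x, t, z)) ?_
    simp only [Prod.dist_eq, max_lt_iff, dist_zero_right]
    refine ⟨hx, ?_, hz⟩
    rw [Real.norm_of_nonneg ht.1.le]; exact ht.2
  · have hpf : p ∈ frontier Ω := by rw [hΩ.frontier_eq]; exact ⟨hp, hpΩ⟩
    have hpos := hpV hpf
    have hc : Continuous (fun q : Euc n × ℝ × Euc n => fderiv ℝ f (q.1 - q.2.1 • (V q.1 + q.2.2)) (V q.1 + q.2.2)) := by fun_prop
    have h1 : ∀ᶠ q in 𝓝 ((p, 0, 0) : Euc n × ℝ × Euc n), 0 < fderiv ℝ f (q.1 - q.2.1 • (V q.1 + q.2.2)) (V q.1 + q.2.2) := by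
      apply hc.continuousAt.eventually
      apply lt_mem_nhds
      simpa using hpos
    obtain ⟨η, hη, hb⟩ := Metric.eventually_nhds_iff.1 h1
    refine ⟨η, hη, fun x hxc hx t ht z hz => ?_⟩
    have hb' : ∀ s ∈ Set.Ico 0 η, 0 < fderiv ℝ f (x - s • (V x + z)) (V x + z) := by
      intro s hs
      refine hb (y := (x, s, z)) ?_
      simp only [Prod.dist_eq, max_lt_iff, dist_zero_right]
      refine ⟨hx, ?_, hz⟩
      rw [Real.norm_of_nonneg hs.1]; exact hs.2
    have hder : ∀ s : ℝ, HasDerivAt (fun s : ℝ => f (x - s • (V x + z))) (-(fderiv ℝ f (x - s • (V x + z)) (V x + z))) s := by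
      intro s
      have h2 : HasDerivAt (fun s : ℝ => x - s • (V x + z)) (-(V x + z)) s := by
        simpa using ((hasDerivAt_id s).smul_const (V x + z)).const_sub x
      have h3 := (hfdiff (x - s • (V x + z))).hasFDerivAt.comp_hasDerivAt s h2
      simpa [Function.comp_def] using h3
    have hanti : StrictAntiOn (fun s : ℝ => f (x - s • (V x + z))) (Set.Icc 0 t) := by
      refine strictAntiOn_of_deriv_neg (convex_Icc 0 t) (fun s _ => (hder s).continuousAt.continuousWithinAt) ?_
      intro s hs
      rw [interior_Icc] at hs
      rw [(hder s).deriv, neg_lt_zero]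
      exact hb' s ⟨hs.1.le, hs.2.trans ht.2⟩
    have h4 := hanti (Set.left_mem_Icc.2 ht.1.le) (Set.right_mem_Icc.2 ht.1.le) ht.1
    simp only [zero_smul, sub_zero] at h4
    have h5 : f x ≤ 0 := by
      have : closure Ω ⊆ f ⁻¹' Set.Iic 0 := closure_minimal (by rw [hfΩ]; exact Set.preimage_mono Set.Iio_subset_Iic_self) (isClosed_Iic.preimage hf.continuous)
      exact this hxc
    rw [hfΩ]
    exact lt_of_lt_of_le h4 h5

lemma deform {Ω : Set (Euc n)} (hΩ : IsOpen Ω) (hΩb : Bornology.IsBounded Ω) (hs : SmoothBoundary n Ω) :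
    ∃ V : Euc n → Euc n, ContDiff ℝ 1 V ∧ HasCompactSupport V ∧ ∃ η > 0, ∀ x ∈ closure Ω, ∀ t ∈ Set.Ioo 0 η, ∀ z : Euc n, ‖z‖ < η → x - t • (V x + z) ∈ Ω := by
  obtain ⟨f, hf, hfΩ, hfd⟩ := hs
  have hcomp : IsCompact (closure Ω) := hΩb.isCompact_closure
  obtain ⟨χ, hχ, hχc, -, -, hχ1⟩ := exists_cutoff hcomp isOpen_univ (Set.subset_univ _)
  set V0 : Euc n → Euc n := fun x => WithLp.toLp 2 (fun i => fderiv ℝ f x (EuclideanSpace.single i 1)) with hV0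
  have hd : ContDiff ℝ 1 (fderiv ℝ f) := (hf.of_le (m := 2) (WithTop.coe_le_coe.2 le_top)).fderiv_right (by rw [one_add_one_eq_two])
  have hV0c : ContDiff ℝ 1 V0 := by
    rw [contDiff_euclidean]
    intro i
    exact hd.clm_apply contDiff_const
  have hVc : ContDiff ℝ 1 (fun x => χ x • V0 x) := hχ.smul hV0c
  refine ⟨fun x => χ x • V0 x, hVc, hχc.smul_right, ?_⟩
  have hpos : ∀ p ∈ frontier Ω, 0 < fderiv ℝ f p (χ p • V0 p) := by
    intro p hp
    have h1 : χ p = 1 := (hχ1 p (frontier_subset_closure hp)).self_of_nhds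
    rw [h1, one_smul]
    have e : V0 p = ∑ i, (fderiv ℝ f p (EuclideanSpace.single i 1)) • EuclideanSpace.single i (1:ℝ) := by
      ext j
      simp [hV0, Finset.sum_apply, Pi.single_apply]
    have e2 : fderiv ℝ f p (V0 p) = ∑ i, (fderiv ℝ f p (EuclideanSpace.single i 1))^2 := by
      conv_lhs => rw [e]
      rw [map_sum]
      refine Finset.sum_congr rfl fun i _ => ?_
      rw [map_smul, smul_eq_mul, sq]
    rw [e2]
    refine lt_of_le_of_ne (Finset.sum_nonneg fun i _ => sq_nonneg _) (Ne.symm ?_)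
    intro h0
    rw [Finset.sum_eq_zero_iff_of_nonneg (fun i _ => sq_nonneg _)] at h0
    apply hfd p hp
    apply ContinuousLinearMap.coe_injective
    refine (EuclideanSpace.basisFun (Fin n) ℝ).toBasis.ext fun i => ?_
    have := h0 i (Finset.mem_univ _)
    simpa using this
  have key : ∀ s : Set (Euc n), IsCompact s → s ⊆ closure Ω → ∃ η > 0, ∀ x ∈ s, ∀ t ∈ Set.Ioo 0 η, ∀ z : Euc n, ‖z‖ < η → x - t • (χ x • V0 x + z) ∈ Ω := by
    intro s hs hsc
    have := hs.induction_on (p := fun s' => ∃ η > 0, ∀ x ∈ s' ∩ closure Ω, ∀ t ∈ Set.Ioo 0 η, ∀ z : Euc n, ‖z‖ < η → x - t • (χ x • V0 x + z) ∈ Ω)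
      ⟨1, one_pos, by simp⟩ ?_ ?_ ?_
    · obtain ⟨η, hη, h⟩ := this
      exact ⟨η, hη, fun x hx => h x ⟨hx, hsc hx⟩⟩
    · rintro a b hab ⟨η, hη, h⟩
      exact ⟨η, hη, fun x hx => h x ⟨hab hx.1, hx.2⟩⟩
    · rintro a b ⟨η, hη, h⟩ ⟨η', hη', h'⟩
      refine ⟨min η η', lt_min hη hη', ?_⟩
      rintro x ⟨hx | hx, hxc⟩ t ht z hz
      · exact h x ⟨hx, hxc⟩ t ⟨ht.1, ht.2.trans_le (min_le_left _ _)⟩ z (hz.trans_le (min_le_left _ _))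
      · exact h' x ⟨hx, hxc⟩ t ⟨ht.1, ht.2.trans_le (min_le_right _ _)⟩ z (hz.trans_le (min_le_right _ _))
    · intro p hp
      obtain ⟨η, hη, h⟩ := deform_local hΩ f hf hfΩ (fun x => χ x • V0 x) hVc.continuous (hsc hp) (hpos p)
      exact ⟨ball p η, mem_nhdsWithin_of_mem_nhds (ball_mem_nhds p hη), η, hη, fun x hx => h x hx.2 hx.1⟩
  exact key _ hcomp le_rfl

end DF

section DT
variable {n : ℕ}

lemma NL_congr (k : ℕ) {F : Type*} [NormedAddCommGroup F] {Ω : Set (Euc n)} (hΩ : MeasurableSet Ω) {v w : Euc n → F} (h : ∀ x ∈ Ω, v x = w x) : NL k Ω v = NL k Ω w :=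
  setLIntegral_congr_fun hΩ fun x hx => by simp only [h x hx]

lemma NE_congr (k : ℕ) {F : Type*} [NormedAddCommGroup F] {Ω : Set (Euc n)} (hΩ : MeasurableSet Ω) {v w : Euc n → F} (h : ∀ x ∈ Ω, v x = w x) : NE k Ω v = NE k Ω w := by
  unfold NE
  rw [Measure.prod_restrict]
  exact setLIntegral_congr_fun (hΩ.prod hΩ) fun q hq => by simp only [eg, h q.1 hq.1, h q.2 hq.2]

lemma shift_lip {V : Euc n → Euc n} {Λ : NNReal} (hV : LipschitzWith Λ V) {t : ℝ} (ht : 0 ≤ t) (htΛ : t * Λ < 1) (z : Euc n) :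
    LipschitzWith (Real.toNNReal (1 + t * Λ)) (fun x => x - t • V x - z) ∧ AntilipschitzWith (Real.toNNReal (1 - t * Λ)⁻¹) (fun x => x - t • V x - z) := by
  have h1 : ∀ x y, ‖t • V x - t • V y‖ ≤ t * Λ * ‖x - y‖ := by
    intro x y
    rw [← smul_sub, norm_smul, Real.norm_of_nonneg ht, mul_assoc]
    refine mul_le_mul_of_nonneg_left ?_ ht
    simpa [dist_eq_norm] using hV.dist_le_mul x y
  have hp : 0 ≤ 1 + t * Λ := by positivity
  have hp' : 0 < 1 - t * Λ := by linarith
  constructor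
  · refine LipschitzWith.of_dist_le_mul fun x y => ?_
    rw [Real.coe_toNNReal _ hp, dist_eq_norm, dist_eq_norm]
    have e : x - t • V x - z - (y - t • V y - z) = (x - y) - (t • V x - t • V y) := by abel
    rw [e]
    have := norm_sub_le (x - y) (t • V x - t • V y)
    linarith [h1 x y]
  · refine AntilipschitzWith.of_le_mul_dist fun x y => ?_
    rw [Real.coe_toNNReal _ (by positivity), dist_eq_norm, dist_eq_norm]
    have e : x - t • V x - z - (y - t • V y - z) = (x - y) - (t • V x - t • V y) := by abel
    rw [e, inv_mul_eq_div, le_div_iff₀ hp']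
    have := norm_sub_norm_le (x - y) (t • V x - t • V y)
    linarith [h1 x y]

lemma eg_tendsto' (k : ℕ) {G : Type*} [NormedAddCommGroup G] (w : ℕ → Euc n → G) (w0 : Euc n → G) (q : Euc n × Euc n) (h1 : Tendsto (fun j => w j q.1) atTop (𝓝 (w0 q.1)))
    (h2 : Tendsto (fun j => w j q.2) atTop (𝓝 (w0 q.2))) : Tendsto (fun j => eg k (w j) q) atTop (𝓝 (eg k w0 q)) := by
  by_cases h : q.1 = q.2
  · have : ∀ v : Euc n → G, eg k v q = 0 := fun v => by rw [eg, h]; simp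
    simp [this]
  have h0 : edist q.1 q.2 ≠ 0 := by simpa using h
  have h4 := ENNReal.Tendsto.pow (n := k+1) (h1.sub h2).enorm
  exact ENNReal.Tendsto.div_const h4 (b := edist q.1 q.2 ^ (n+k)) (Or.inr (pow_ne_zero _ h0))

lemma NN_scheffe (k : ℕ) {Ω : Set (Euc n)} (hΩ : MeasurableSet Ω) (u : Euc n → Euc n) (hu : AEStronglyMeasurable u (volume.restrict Ω)) (huf : NN k Ω u < ⊤)
    (w : ℕ → Euc n → Euc n) (hw : ∀ j, AEStronglyMeasurable (w j) (volume.restrict Ω)) (hlim : ∀ x ∈ Ω, Tendsto (fun j => w j x) atTop (𝓝 (u x)))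
    (cL cE : ℕ → ENNReal) (hcL : Tendsto cL atTop (𝓝 1)) (hcE : Tendsto cE atTop (𝓝 1)) (hL : ∀ j, NL k Ω (w j) ≤ cL j * NL k Ω u) (hE : ∀ j, NE k Ω (w j) ≤ cE j * NE k Ω u) :
    Tendsto (fun j => NN k Ω (w j - u)) atTop (𝓝 0) := by
  have hf := ENNReal.add_lt_top.1 huf
  have hCf : (3:ENNReal)^(k+1) ≠ ⊤ := by finiteness
  have h0 : ∀ x ∈ Ω, Tendsto (fun j => (w j - u) x) atTop (𝓝 0) := fun x hx => by
    simpa using (hlim x hx).sub_const (u x)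
  have hL' : Tendsto (fun j => NL k Ω (w j - u)) atTop (𝓝 0) := by
    refine scheffe (fun j x => ‖(w j - u) x‖ₑ^(k+1)) (fun j x => ‖w j x‖ₑ^(k+1)) (fun x => ‖u x‖ₑ^(k+1)) _ hCf (fun j => ((hw j).sub hu).enorm.pow_const _)
      (fun j => (hw j).enorm.pow_const _) (hu.enorm.pow_const _) ?_ hf.1.ne cL hcL hL ?_ ?_
    · intro j
      refine Eventually.of_forall fun x => ?_
      refine le_trans (pow_le_pow_left' (b := ‖u x‖ₑ + ‖w j x‖ₑ) ?_ _) (pow_add2 _ _ _)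
      rw [add_comm]; exact enorm_sub_le
    · rw [ae_restrict_iff' hΩ]
      exact Eventually.of_forall fun x hx => ENNReal.Tendsto.pow (hlim x hx).enorm
    · rw [ae_restrict_iff' hΩ]
      refine Eventually.of_forall fun x hx => ?_
      simpa using ENNReal.Tendsto.pow (n := k+1) (h0 x hx).enorm
  have hE' : Tendsto (fun j => NE k Ω (w j - u)) atTop (𝓝 0) := by
    refine scheffe (fun j q => eg k (w j - u) q) (fun j q => eg k (w j) q) (fun q => eg k u q) _ hCf (fun j => eg_aemeas k ((hw j).sub hu))
      (fun j => eg_aemeas k (hw j)) (eg_aemeas k hu) ?_ hf.2.ne cE hcE hE ?_ ?_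
    · intro j
      refine Eventually.of_forall fun q => ?_
      have h1 := eg_add_le k (w j) (-u) q
      have h2 : eg k (-u) q = eg k u q := by
        simp only [eg, Pi.neg_apply]
        rw [show -u q.1 - -u q.2 = -(u q.1 - u q.2) by abel, enorm_neg]
      rw [h2, ← sub_eq_add_neg, add_comm (eg k (w j) q)] at h1
      exact h1
    · rw [Measure.prod_restrict, ae_restrict_iff' (hΩ.prod hΩ)]
      exact Eventually.of_forall fun q hq => eg_tendsto' k w u q (hlim _ hq.1) (hlim _ hq.2)
    · rw [Measure.prod_restrict, ae_restrict_iff' (hΩ.prod hΩ)]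
      exact Eventually.of_forall fun q hq => eg_tendsto k _ q (h0 _ hq.1) (h0 _ hq.2)
  simpa [NN] using hL'.add hE'

lemma NL_integrable (k : ℕ) {Ω : Set (Euc n)} (hΩ : MeasurableSet Ω) (hΩb : Bornology.IsBounded Ω) (u : Euc n → Euc n) (hu : AEStronglyMeasurable u (volume.restrict Ω)) (huf : NL k Ω u < ⊤) :
    Integrable (Ω.indicator u) := by
  rw [integrable_indicator_iff hΩ]
  refine ⟨hu, ?_⟩
  have h1 : ∀ x, ‖u x‖ₑ ≤ 1 + ‖u x‖ₑ^(k+1) := by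
    intro x
    rcases le_total ‖u x‖ₑ 1 with h | h
    · exact h.trans le_self_add
    · exact (le_self_pow₀ h (by omega)).trans le_add_self
  refine lt_of_le_of_lt (lintegral_mono h1) ?_
  rw [lintegral_add_left measurable_const]
  refine ENNReal.add_lt_top.2 ⟨?_, huf⟩
  simp only [lintegral_const, one_mul, Measure.restrict_apply_univ]
  exact hΩb.measure_lt_top

end DT

section DU
variable {n : ℕ}

theorem density (k : ℕ) {Ω : Set (Euc n)} (hΩ : IsOpen Ω) (hΩb : Bornology.IsBounded Ω) (hs : SmoothBoundary n Ω)
    (u : Euc n → Euc n) (hu : ContinuousOn u Ω) (huf : NN k Ω u < ⊤) (S : Set (Euc n)) (hS : IsCompact S) (hSΩ : S ⊆ Ω) :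
    ∃ w : ℕ → Euc n → Euc n, (∀ j, ContDiff ℝ 1 (w j)) ∧ Tendsto (fun j => NN k Ω (w j - u)) atTop (𝓝 0) ∧
      (∀ x ∈ Ω, Tendsto (fun j => w j x) atTop (𝓝 (u x))) ∧ ∃ M, ∀ j, ∀ x ∈ S, ‖w j x‖ ≤ M := by
  classical
  have hΩm := hΩ.measurableSet
  obtain ⟨V, hV, hVc, η, hη, hmap⟩ := deform hΩ hΩb hs
  obtain ⟨Λ, hΛ⟩ := ContDiff.lipschitzWith_of_hasCompactSupport (n := 1) hVc hV (by norm_num)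
  obtain ⟨B0, hB0⟩ := hVc.exists_bound_of_continuous hV.continuous
  set B : ℝ := max B0 0 with hBd
  have hB : ∀ x, ‖V x‖ ≤ B := fun x => (hB0 x).trans (le_max_left _ _)
  have hB1 : 0 ≤ B := le_max_right _ _
  -- parameters
  set a : ℝ := min η (1 / (Λ + 1)) with ha
  have ha0 : 0 < a := lt_min hη (by positivity)
  set t : ℕ → ℝ := fun j => a / 2 * (1 / ((j:ℝ) + 1)) with ht
  have htpos : ∀ j, 0 < t j := fun j => by positivity
  have htle : ∀ j, t j ≤ a / 2 := fun j => by
    rw [ht]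
    have : 1 / ((j:ℝ)+1) ≤ 1 := by
      rw [div_le_one (by positivity)]; linarith [(Nat.cast_nonneg j : (0:ℝ) ≤ j)]
    nlinarith
  have htη : ∀ j, t j < η := fun j => lt_of_lt_of_le (lt_of_le_of_lt (htle j) (by linarith)) (min_le_left η (1 / ((Λ:ℝ) + 1)))
  have htΛ : ∀ j, t j * Λ < 1 := fun j => by
    have h1 : t j < 1 / ((Λ:ℝ)+1) := lt_of_lt_of_le (lt_of_le_of_lt (htle j) (by linarith)) (min_le_right η (1 / ((Λ:ℝ) + 1)))
    rw [lt_div_iff₀ (by positivity)] at h1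
    have := htpos j
    nlinarith
  have ht0 : Tendsto t atTop (𝓝 0) := by
    have := (tendsto_one_div_add_atTop_nhds_zero_nat (𝕜 := ℝ)).const_mul (a/2)
    rw [mul_zero] at this
    exact this
  -- measurable extension
  set g : Euc n → Euc n := Ω.indicator u with hg
  have hgm : StronglyMeasurable g := by
    have := (hu.measurable_piecewise (g := fun _ => (0 : Euc n)) continuousOn_const hΩm)
    have e : Ω.piecewise u (fun _ => (0 : Euc n)) = g := Set.piecewise_eq_indicator
    rw [e] at this
    exact this.stronglyMeasurable
  have hum : AEStronglyMeasurable u (volume.restrict Ω) := hu.aestronglyMeasurable hΩm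
  have huf2 := ENNReal.add_lt_top.1 huf
  have hgi : Integrable g := NL_integrable k hΩm hΩb u hum huf2.1
  have hgu : ∀ x ∈ Ω, g x = u x := fun x hx => Set.indicator_of_mem hx u
  -- kernels
  let φ : ℕ → ContDiffBump (0 : Euc n) := fun j => ⟨t j * η / 2, t j * η, by have := htpos j; positivity, by have := htpos j; have : 0 < t j * η := by positivity
                                                                                                             linarith⟩
  set r : ℕ → Euc n → ℝ := fun j => (φ j).normed volume with hr
  have hrc : ∀ j, ContDiff ℝ 1 (r j) := fun j => (φ j).contDiff_normed (n := 1)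
  have hrs : ∀ j, HasCompactSupport (r j) := fun j => (φ j).hasCompactSupport_normed
  have hr0 : ∀ j z, 0 ≤ r j z := fun j z => (φ j).nonneg_normed z
  have hr1 : ∀ j, ∫ z, r j z = 1 := fun j => (φ j).integral_normed
  have hrsupp : ∀ j, Function.support (r j) = ball 0 (t j * η) := fun j => (φ j).support_normed_eq
  set T : ℕ → Euc n → Euc n := fun j x => x - t j • V x with hT
  have hTc : ∀ j, ContDiff ℝ 1 (T j) := fun j => contDiff_id.sub (hV.const_smul (t j))
  set w : ℕ → Euc n → Euc n := fun j x => ∫ z, r j z • g (T j x - z) with hw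
  have hwconv : ∀ j x, w j x = (convolution (r j) g (ContinuousLinearMap.lsmul ℝ ℝ) volume) (T j x) := fun j x => rfl
  have hwC : ∀ j, ContDiff ℝ 1 (w j) := by
    intro j
    have h1 := (hrs j).contDiff_convolution_left (ContinuousLinearMap.lsmul ℝ ℝ) (n := 1) (hrc j) (hgi.locallyIntegrable)
    exact h1.comp (hTc j)
  have hIntg : ∀ j x, Integrable (fun z => r j z • g (T j x - z)) := by
    intro j x
    exact (hrs j).convolutionExists_left (ContinuousLinearMap.lsmul ℝ ℝ) (hrc j).continuous hgi.locallyIntegrable (T j x)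
  have hmaps : ∀ j z, r j z ≠ 0 → Set.MapsTo (fun x => x - t j • V x - z) Ω Ω := by
    intro j z hz x hx
    have h1 : z ∈ ball (0 : Euc n) (t j * η) := by rw [← hrsupp j]; exact hz
    rw [mem_ball_zero_iff] at h1
    have htj := htpos j
    have h2 := hmap x (subset_closure hx) (t j) ⟨htj, htη j⟩ ((t j)⁻¹ • z) (by
      rw [norm_smul, norm_inv, Real.norm_of_nonneg htj.le, inv_mul_lt_iff₀ htj]; exact h1)
    rw [smul_add, smul_smul, mul_inv_cancel₀ htj.ne', one_smul, ← sub_sub] at h2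
    exact h2
  -- energy bounds
  set K : ℕ → NNReal := fun j => Real.toNNReal (1 - t j * Λ)⁻¹ with hK
  set L : ℕ → NNReal := fun j => Real.toNNReal (1 + t j * Λ) with hL
  have hL0 : ∀ j, L j ≠ 0 := fun j => by
    have := htpos j
    have : 0 < 1 + t j * Λ := by positivity
    simpa [hL] using this
  have hen : ∀ j, NL k Ω (w j) ≤ (K j:ENNReal)^n * NL k Ω u ∧ NE k Ω (w j) ≤ ((L j:ENNReal)^(n+k) * ((K j:ENNReal)^n * (K j:ENNReal)^n)) * NE k Ω u := by
    intro j
    refine NN_avg k (r j) (hrc j).continuous (hr0 j) (hr1 j) (T j) (hTc j).continuous g hgm (hIntg j) _ _ ?_ ?_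
    · intro z hz
      obtain ⟨h1, h2⟩ := shift_lip hΛ (htpos j).le (htΛ j) z
      rw [← NL_congr k hΩm hgu]
      exact NL_comp k h2 h1.continuous hΩm (hmaps j z hz) g hgm
    · intro z hz
      obtain ⟨h1, h2⟩ := shift_lip hΛ (htpos j).le (htΛ j) z
      rw [← NE_congr k hΩm hgu, mul_assoc]
      exact NE_comp k (hL0 j) h1 h2 hΩm (hmaps j z hz) g hgm
  have hKlim : Tendsto (fun j => (K j : ENNReal)) atTop (𝓝 1) := by
    have h1 : Tendsto (fun j => (1 - t j * Λ)⁻¹) atTop (𝓝 ((1 - 0 * (Λ:ℝ))⁻¹)) :=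
      (tendsto_const_nhds.sub (ht0.mul_const _)).inv₀ (by norm_num)
    have h2 := ENNReal.tendsto_ofReal h1
    rw [zero_mul, sub_zero, inv_one, ENNReal.ofReal_one] at h2
    exact h2
  have hLlim : Tendsto (fun j => (L j : ENNReal)) atTop (𝓝 1) := by
    have h1 : Tendsto (fun j => (1 + t j * Λ)) atTop (𝓝 ((1 + 0 * (Λ:ℝ)))) :=
      (tendsto_const_nhds.add (ht0.mul_const _))
    have h2 := ENNReal.tendsto_ofReal h1
    rw [zero_mul, add_zero, ENNReal.ofReal_one] at h2
    exact h2
  have hKn : Tendsto (fun j => (K j : ENNReal)^n) atTop (𝓝 1) := by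
    simpa using ENNReal.Tendsto.pow (n := n) hKlim
  have hLn : Tendsto (fun j => (L j : ENNReal)^(n+k)) atTop (𝓝 1) := by
    simpa using ENNReal.Tendsto.pow (n := n+k) hLlim
  have hKK : Tendsto (fun j => (L j:ENNReal)^(n+k) * ((K j:ENNReal)^n * (K j:ENNReal)^n)) atTop (𝓝 1) := by
    have h1 := ENNReal.Tendsto.mul hKn (by simp) hKn (by simp)
    have h2 := ENNReal.Tendsto.mul hLn (by simp) h1 (by simp)
    simpa using h2
  -- pointwise bounds
  have hbd : ∀ j x (c : Euc n) (M : ℝ), 0 ≤ M → (∀ y, dist y x ≤ t j * (B + η) → dist (g y) c ≤ M) → dist (w j x) c ≤ M := by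
    intro j x c M hM h
    rw [hwconv]
    refine dist_convolution_le hM (hrsupp j).le (hr0 j) (hr1 j) hgm.aestronglyMeasurable ?_
    intro y hy
    apply h
    rw [mem_ball] at hy
    have h1 : dist (T j x) x ≤ t j * B := by
      rw [dist_eq_norm]
      simp only [hT, sub_sub_cancel_left, norm_neg, norm_smul, Real.norm_of_nonneg (htpos j).le]
      exact mul_le_mul_of_nonneg_left (hB x) (htpos j).le
    have := dist_triangle y (T j x) x
    linarith
  have hρ : Tendsto (fun j => t j * (B + η)) atTop (𝓝 0) := by simpa using ht0.mul_const (B + η)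
  have hlim : ∀ x ∈ Ω, Tendsto (fun j => w j x) atTop (𝓝 (u x)) := by
    intro x hx
    rw [Metric.tendsto_atTop']
    intro ε hε
    have h1 : ∀ᶠ y in 𝓝 x, dist (g y) (u x) < ε / 2 := by
      have hcu := (hu.continuousAt (hΩ.mem_nhds hx)).eventually (ball_mem_nhds (u x) (half_pos hε))
      filter_upwards [hcu, hΩ.mem_nhds hx] with y hy hyΩ
      rw [hgu y hyΩ]; exact hy
    obtain ⟨δ, hδ, hball⟩ := Metric.eventually_nhds_iff.1 h1
    obtain ⟨N, hN⟩ := (eventually_atTop.1 (hρ.eventually (gt_mem_nhds hδ)))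
    refine ⟨N, fun j hj => ?_⟩
    refine lt_of_le_of_lt (hbd j x (u x) (ε/2) (by positivity) ?_) (by linarith)
    intro y hy
    exact (hball (lt_of_le_of_lt hy (hN j hj.le))).le
  have hconv : Tendsto (fun j => NN k Ω (w j - u)) atTop (𝓝 0) :=
    NN_scheffe k hΩm u hum huf w (fun j => (hwC j).continuous.aestronglyMeasurable) hlim _ _ hKn hKK (fun j => (hen j).1) (fun j => (hen j).2)
  obtain ⟨δ, hδ, hSδ⟩ := hS.exists_cthickening_subset_open hΩ hSΩ
  obtain ⟨M, hM⟩ := (hS.cthickening (r := δ)).exists_bound_of_continuousOn (hu.mono hSδ)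
  obtain ⟨N, hN⟩ := (eventually_atTop.1 (hρ.eventually (gt_mem_nhds hδ)))
  refine ⟨fun j => w (j + N), fun j => hwC _, hconv.comp (tendsto_add_atTop_nat N), fun x hx => (hlim x hx).comp (tendsto_add_atTop_nat N), max M 0, ?_⟩
  intro j x hx
  rw [← dist_zero_right]
  refine hbd _ x 0 _ (le_max_right _ _) ?_
  intro y hy
  have hy2 : y ∈ cthickening δ S := mem_cthickening_of_dist_le y x δ S hx (hy.trans (hN _ (by omega)).le)
  rw [hgu y (hSδ hy2), dist_zero_right]
  exact (hM y hy2).trans (le_max_left _ _)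

end DU

section PI1
variable {n : ℕ}

lemma detF_bound (F : Euc n → Euc n) (K : NNReal) (hFK : LipschitzWith K F) : ∃ M : ℝ, 0 < M ∧ ∀ y, |(jacMat n F y).det| ≤ M := by
  refine ⟨(n.factorial : ℝ) * (K:ℝ)^n + 1, by positivity, fun y => ?_⟩
  have h1 : ∀ i j, AbsoluteValue.abs (jacMat n F y i j) ≤ (K:ℝ) := by
    intro i j
    simp only [jacMat, Matrix.of_apply, AbsoluteValue.abs_apply]
    rw [← Real.norm_eq_abs]
    refine (PiLp.norm_apply_le _ i).trans ?_
    refine ((fderiv ℝ F y).le_opNorm _).trans ?_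
    have : ‖(EuclideanSpace.single j (1:ℝ) : Euc n)‖ = 1 := by simp
    rw [this, mul_one]
    exact norm_fderiv_le_of_lipschitz ℝ hFK
  have h2 := Matrix.det_le h1
  simp only [AbsoluteValue.abs_apply, Fintype.card_fin, nsmul_eq_mul] at h2
  linarith

lemma prod_bound {S : Set (Euc n)} (ψ : Euc n → ℝ) (hψS : ∀ x, x ∉ S → ψ x = 0) (hψ1 : ∀ x, |ψ x| ≤ 1) (Lψ : NNReal) (hLψ : LipschitzWith Lψ ψ)
    (g : Euc n → ℝ) (M : ℝ) (hM : ∀ y, |g y| ≤ M) (R : ℝ) (Lg : NNReal) (hLg : ∀ a b, ‖a‖ ≤ R → ‖b‖ ≤ R → |g a - g b| ≤ Lg * ‖a - b‖)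
    (w : Euc n → Euc n) (hw : ∀ x ∈ S, ‖w x‖ ≤ R) (x y : Euc n) :
    |ψ x * g (w x) - ψ y * g (w y)| ≤ Lg * ‖w x - w y‖ + M * Lψ * dist x y := by
  have hM0 : 0 ≤ M := (abs_nonneg _).trans (hM 0)
  have hd : |ψ x - ψ y| ≤ Lψ * dist x y := by simpa [Real.dist_eq] using hLψ.dist_le_mul x y
  have h0 : 0 ≤ Lg * ‖w x - w y‖ := by positivity
  by_cases hx : x ∈ S
  · by_cases hy : y ∈ S
    · have e : ψ x * g (w x) - ψ y * g (w y) = ψ x * (g (w x) - g (w y)) + (ψ x - ψ y) * g (w y) := by ring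
      rw [e]
      refine (abs_add_le _ _).trans (add_le_add ?_ ?_)
      · rw [abs_mul]
        have := hLg _ _ (hw x hx) (hw y hy)
        calc _ ≤ 1 * |g (w x) - g (w y)| := mul_le_mul_of_nonneg_right (hψ1 x) (abs_nonneg _)
          _ ≤ _ := by linarith
      · rw [abs_mul]
        calc _ ≤ (Lψ * dist x y) * M := mul_le_mul hd (hM _) (abs_nonneg _) (by positivity)
          _ = _ := by ring
    · have e : ψ x * g (w x) - ψ y * g (w y) = (ψ x - ψ y) * g (w x) := by rw [hψS y hy]; ring
      rw [e, abs_mul]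
      have : |ψ x - ψ y| * |g (w x)| ≤ (Lψ * dist x y) * M := mul_le_mul hd (hM _) (abs_nonneg _) (by positivity)
      linarith
  · have e : ψ x * g (w x) - ψ y * g (w y) = (ψ x - ψ y) * g (w y) := by rw [hψS x hx]; ring
    rw [e, abs_mul]
    have : |ψ x - ψ y| * |g (w y)| ≤ (Lψ * dist x y) * M := mul_le_mul hd (hM _) (abs_nonneg _) (by positivity)
    linarith

lemma g_lip (g : Euc n → ℝ) (hg : ContDiff ℝ 1 g) (R : ℝ) : ∃ L : NNReal, ∀ a b, ‖a‖ ≤ R → ‖b‖ ≤ R → |g a - g b| ≤ L * ‖a - b‖ := by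
  obtain ⟨χ, hχ, hχc, -, -, hχ1⟩ := exists_cutoff (isCompact_closedBall (0 : Euc n) R) isOpen_univ (Set.subset_univ _)
  obtain ⟨L, hL⟩ := ContDiff.lipschitzWith_of_hasCompactSupport (n := 1) (f := fun x => χ x * g x) hχc.mul_right (hχ.mul hg) (by norm_num)
  refine ⟨L, fun a b ha hb => ?_⟩
  have ea : χ a = 1 := (hχ1 a (by simpa using ha)).self_of_nhds
  have eb : χ b = 1 := (hχ1 b (by simpa using hb)).self_of_nhds
  have := hL.dist_le_mul a b
  simpa [ea, eb, Real.dist_eq, dist_eq_norm] using this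

lemma phi_conv (hn : 2 ≤ n) {Ω : Set (Euc n)} (hΩ : IsOpen Ω) (hΩb : Bornology.IsBounded Ω) (u : Euc n → Euc n) (hu : ContinuousOn u Ω) (huf : NN n Ω u < ⊤)
    (ψ : Euc n → ℝ) (hψ : Cc1 n Ω ψ) (hψ1 : ∀ x, |ψ x| ≤ 1) (g : Euc n → ℝ) (hg : ContDiff ℝ 1 g) (M : ℝ) (hM : ∀ y, |g y| ≤ M)
    (w : ℕ → Euc n → Euc n) (hw : ∀ j, ContDiff ℝ 1 (w j)) (hwu : Tendsto (fun j => NN n Ω (w j - u)) atTop (𝓝 0))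
    (hlim : ∀ x ∈ Ω, Tendsto (fun j => w j x) atTop (𝓝 (u x))) (R0 : ℝ) (hR0 : ∀ j, ∀ x ∈ tsupport ψ, ‖w j x‖ ≤ R0) :
    Tendsto (fun j => NN n Ω ((fun x => ψ x * g (w j x)) - fun x => ψ x * g (u x))) atTop (𝓝 0) := by
  obtain ⟨hψc, hψs, hψΩ⟩ := hψ
  have hΩm := hΩ.measurableSet
  have hum : AEStronglyMeasurable u (volume.restrict Ω) := hu.aestronglyMeasurable hΩm
  obtain ⟨R1, hR1⟩ := hψs.isCompact.exists_bound_of_continuousOn (hu.mono hψΩ)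
  obtain ⟨Lg, hLg⟩ := g_lip g hg (max R0 R1)
  obtain ⟨Lψ, hLψ⟩ := ContDiff.lipschitzWith_of_hasCompactSupport (n := 1) hψs hψc (by norm_num)
  have hM0 : 0 ≤ M := (abs_nonneg _).trans (hM 0)
  have hψS : ∀ x, x ∉ tsupport ψ → ψ x = 0 := fun x hx => image_eq_zero_of_notMem_tsupport hx
  set C : ℝ := 2 * Lg + 2 * (M * Lψ) + 2 * M with hC
  have hC0 : 0 ≤ C := by positivity
  have hen : ∀ (x y z s : ℝ), 0 ≤ x → 0 ≤ y → 0 ≤ z → s ≤ C * (x + y + z) → ENNReal.ofReal s ≤ (C.toNNReal : ENNReal) * (ENNReal.ofReal x + ENNReal.ofReal y + ENNReal.ofReal z) := by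
    intro x y z s hx hy hz h
    rw [← ENNReal.ofReal_add hx hy, ← ENNReal.ofReal_add (by positivity) hz]
    change _ ≤ ENNReal.ofReal C * _
    rw [← ENNReal.ofReal_mul hC0]
    exact ENNReal.ofReal_le_ofReal h
  refine NN_dom hn n hΩm hΩb u hum huf (fun j => w j - u) (fun j => (hw j).continuous.aestronglyMeasurable.sub hum) hwu _ ?_ C.toNNReal ?_ ?_ ?_
  · intro j
    refine AEStronglyMeasurable.sub ?_ ?_
    · exact (hψc.continuous.mul (hg.continuous.comp (hw j).continuous)).aestronglyMeasurable
    · exact (hψc.continuous.continuousOn.mul (hg.continuous.comp_continuousOn hu)).aestronglyMeasurable hΩm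
  · intro j x _ y _
    rw [← ofReal_norm, ← ofReal_norm, ← ofReal_norm, edist_dist]
    refine hen _ _ _ _ (norm_nonneg _) (norm_nonneg _) dist_nonneg ?_
    have b1 := prod_bound ψ hψS hψ1 Lψ hLψ g M hM _ Lg hLg (w j) (fun x hx => (hR0 j x hx).trans (le_max_left _ _)) x y
    have b2 := prod_bound ψ hψS hψ1 Lψ hLψ g M hM _ Lg hLg u (fun x hx => (hR1 x hx).trans (le_max_right _ _)) x y
    have b3 : ‖w j x - w j y‖ ≤ ‖u x - u y‖ + ‖(w j - u) x - (w j - u) y‖ := by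
      have e : w j x - w j y = (u x - u y) + ((w j - u) x - (w j - u) y) := by simp only [Pi.sub_apply]; abel
      rw [e]; exact norm_add_le _ _
    have b4 : ‖((fun x => ψ x * g (w j x)) - fun x => ψ x * g (u x)) x - ((fun x => ψ x * g (w j x)) - fun x => ψ x * g (u x)) y‖ ≤
        |ψ x * g (w j x) - ψ y * g (w j y)| + |ψ x * g (u x) - ψ y * g (u y)| := by
      rw [Real.norm_eq_abs]
      have e : ((fun x => ψ x * g (w j x)) - fun x => ψ x * g (u x)) x - ((fun x => ψ x * g (w j x)) - fun x => ψ x * g (u x)) y =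
        (ψ x * g (w j x) - ψ y * g (w j y)) - (ψ x * g (u x) - ψ y * g (u y)) := by simp only [Pi.sub_apply]; ring
      rw [e]; exact abs_sub _ _
    have hLg0 : (0:ℝ) ≤ Lg := Lg.2
    have hMψ : 0 ≤ M * (Lψ:ℝ) := by positivity
    have b5 := mul_le_mul_of_nonneg_left b3 hLg0
    have n1 := norm_nonneg (u x - u y)
    have n2 := norm_nonneg ((w j - u) x - (w j - u) y)
    have n3 := dist_nonneg (x := x) (y := y)
    rw [hC]
    have m1 := mul_nonneg hLg0 n1
    have m2 := mul_nonneg hLg0 n2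
    have m3 := mul_nonneg hLg0 n3
    have m4 := mul_nonneg hMψ n1
    have m5 := mul_nonneg hMψ n2
    have m6 := mul_nonneg hMψ n3
    have m7 := mul_nonneg hM0 n1
    have m8 := mul_nonneg hM0 n2
    have m9 := mul_nonneg hM0 n3
    linarith
  · intro j x _
    rw [← ofReal_norm, ← ofReal_norm, ← ofReal_norm, ← ENNReal.ofReal_one]
    refine hen _ _ _ _ (norm_nonneg _) (norm_nonneg _) zero_le_one ?_
    have c1 : ∀ y, |ψ x * g y| ≤ M := fun y => by
      rw [abs_mul]
      calc _ ≤ 1 * M := mul_le_mul (hψ1 x) (hM y) (abs_nonneg _) zero_le_one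
        _ = M := one_mul _
    have c2 : ‖((fun x => ψ x * g (w j x)) - fun x => ψ x * g (u x)) x‖ ≤ 2 * M := by
      rw [Real.norm_eq_abs, Pi.sub_apply]
      have := abs_sub (ψ x * g (w j x)) (ψ x * g (u x))
      linarith [c1 (w j x), c1 (u x)]
    refine c2.trans ?_
    have hLg0 : (0:ℝ) ≤ Lg := Lg.2
    have hMψ : 0 ≤ M * (Lψ:ℝ) := by positivity
    have n1 := norm_nonneg (u x)
    have n2 := norm_nonneg ((w j - u) x)
    have m1 : 0 ≤ C * (‖u x‖ + ‖(w j - u) x‖) := by positivity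
    have : C * (‖u x‖ + ‖(w j - u) x‖ + 1) = C * (‖u x‖ + ‖(w j - u) x‖) + C := by ring
    rw [this, hC]
    rw [hC] at m1
    linarith
  · rw [ae_restrict_iff' hΩm]
    refine Eventually.of_forall fun x hx => ?_
    have h1 := ((hg.continuous.tendsto _).comp (hlim x hx)).const_mul (ψ x)
    have h2 := h1.sub_const (ψ x * g (u x))
    rw [sub_self] at h2
    exact h2

end PI1

section PI2
variable {n : ℕ}

lemma cont_det_jac (w : Euc n → Euc n) (hw : ContDiff ℝ 1 w) : Continuous fun x => (jacMat n w x).det := by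
  simp only [← det_jac]
  exact ContinuousLinearMap.continuous_det.comp (hw.continuous_fderiv (by norm_num))

lemma int_det {Ω : Set (Euc n)} (w : Euc n → Euc n) (hw : ContDiff ℝ 1 w) (φ : Euc n → ℝ) (hφ : Continuous φ) (hφc : HasCompactSupport φ) :
    Integrable (fun x => (jacMat n w x).det * φ x) (volume.restrict Ω) :=
  (((cont_det_jac w hw).mul hφ).integrable_of_hasCompactSupport hφc.mul_left).integrableOn

lemma det_pair_small (hn : 2 ≤ n) {Ω : Set (Euc n)} (hΩ : IsOpen Ω) (u : Euc n → Euc n) (huf : NN n Ω u < ⊤)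
    (w : ℕ → Euc n → Euc n) (hw : ∀ j, ContDiff ℝ 1 (w j)) (hwu : Tendsto (fun j => NN n Ω (w j - u)) atTop (𝓝 0))
    (hum : AEStronglyMeasurable u (volume.restrict Ω))
    (S : Set (Euc n)) (hS : IsCompact S) (hSΩ : S ⊆ Ω) (φ : ℕ → Euc n → ℝ) (φ0 : Euc n → ℝ) (hφ : ∀ j, ContDiff ℝ 1 (φ j))
    (hφS : ∀ j, tsupport (φ j) ⊆ S) (hφ0 : AEStronglyMeasurable φ0 (volume.restrict Ω))
    (hlim : Tendsto (fun j => NN n Ω (φ j - φ0)) atTop (𝓝 0)) (ε : ℝ) (hε : 0 < ε) :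
    ∃ j, ∀ᶠ k in atTop, (∫ x in Ω, (jacMat n (w k) x).det * φ k x) ≤ (∫ x in Ω, (jacMat n (w k) x).det * φ j x) + 2 * ε := by
  have hε' : ENNReal.ofReal ε ≠ 0 := by simp [hε]
  obtain ⟨δ, hδ, hδB⟩ := exists_small (ENNReal.ofReal ε) (3^(n+1) * (1 + NN n Ω u)) hε'
    (ENNReal.mul_lt_top (by finiteness) (ENNReal.add_lt_top.2 ⟨ENNReal.one_lt_top, huf⟩)).ne
  obtain ⟨C, hC, hcore⟩ := core2 hn hΩ S hS hSΩ (ENNReal.ofReal δ) (by simp [hδ])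
  obtain ⟨η, hη, hηC⟩ := exists_small (ENNReal.ofReal ε) (C * (3^(n+1) * 2)) hε' (by finiteness)
  have hη' : 0 < ENNReal.ofReal η := by simp [hη]
  have hev := (ENNReal.tendsto_nhds_zero.1 hlim) _ hη'
  have hev1 := (ENNReal.tendsto_nhds_zero.1 hwu) 1 one_pos
  obtain ⟨j, hj⟩ := hev.exists
  refine ⟨j, ?_⟩
  filter_upwards [hev, hev1] with k hk hk1
  have hwk : NN n Ω (w k) ≤ 3^(n+1) * (1 + NN n Ω u) := by
    have e : w k = (w k - u) + u := by abel
    rw [e]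
    refine (NN_add n u ((hw k).continuous.aestronglyMeasurable.sub hum)).trans ?_
    gcongr
  have hd : NN n Ω (φ k - φ j) ≤ 3^(n+1) * (ENNReal.ofReal η + ENNReal.ofReal η) := by
    have e : φ k - φ j = (φ k - φ0) - (φ j - φ0) := by abel
    rw [e]
    refine (NN_sub n _ ((hφ k).continuous.aestronglyMeasurable.sub hφ0)).trans ?_
    gcongr
  have hsup : tsupport (φ k - φ j) ⊆ S := (tsupport_sub (φ k) (φ j)).trans (Set.union_subset (hφS k) (hφS j))
  have h1 := hcore (w k) (φ k - φ j) (hw k).contDiffOn ((hφ k).sub (hφ j)) hsup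
  have hcs : ∀ i, HasCompactSupport (φ i) := fun i => hS.of_isClosed_subset (isClosed_tsupport _) (hφS i)
  have h2 : ‖∫ x in Ω, (jacMat n (w k) x).det * (φ k - φ j) x‖ₑ ≤ ENNReal.ofReal (2 * ε) := by
    refine h1.trans ?_
    have a1 : ENNReal.ofReal δ * NN n Ω (w k) ≤ ENNReal.ofReal ε := (mul_le_mul' le_rfl hwk).trans hδB
    have a2 : C * NN n Ω (φ k - φ j) ≤ ENNReal.ofReal ε := by
      refine (mul_le_mul' le_rfl hd).trans (le_trans (le_of_eq ?_) hηC)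
      ring
    rw [two_mul, ENNReal.ofReal_add hε.le hε.le]
    exact add_le_add a1 a2
  have h3 : |∫ x in Ω, (jacMat n (w k) x).det * (φ k - φ j) x| ≤ 2 * ε := by
    rw [← ofReal_norm_eq_enorm] at h2
    exact (ENNReal.ofReal_le_ofReal_iff (by positivity)).1 h2
  have h4 : (∫ x in Ω, (jacMat n (w k) x).det * (φ k - φ j) x) =
      (∫ x in Ω, (jacMat n (w k) x).det * φ k x) - (∫ x in Ω, (jacMat n (w k) x).det * φ j x) := by
    rw [← integral_sub (int_det _ (hw k) _ (hφ k).continuous (hcs k)) (int_det _ (hw k) _ (hφ j).continuous (hcs j))]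
    refine integral_congr_ae (Eventually.of_forall fun x => ?_)
    simp only [Pi.sub_apply]; ring
  rw [h4] at h3
  linarith [(abs_le.1 h3).2]

theorem partI (hn : 2 ≤ n) {Ω : Set (Euc n)} (hΩ : IsOpen Ω) (hΩb : Bornology.IsBounded Ω) (hs : SmoothBoundary n Ω)
    (u : Euc n → Euc n) (hu : ContinuousOn u Ω) (huf : NN n Ω u < ⊤) (hTV : BddAbove (TVset n Ω u))
    (F : Euc n → Euc n) (hF : ContDiff ℝ (⊤ : ℕ∞) F) (K : NNReal) (hFK : LipschitzWith K F) :
    BddAbove (TVset n Ω (F ∘ u)) := by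
  obtain ⟨B, hB⟩ := hTV
  obtain ⟨M, hM0, hM⟩ := detF_bound F K hFK
  refine ⟨M * B, ?_⟩
  rintro r ⟨ψ, hψ, hψ1, hr⟩
  have hum : AEStronglyMeasurable u (volume.restrict Ω) := hu.aestronglyMeasurable hΩ.measurableSet
  obtain ⟨w, hw, hwu, hlim, R0, hR0⟩ := density n hΩ hΩb hs u hu huf (tsupport ψ) hψ.2.1.isCompact hψ.2.2
  have hg := contDiff_detF F hF
  set g : Euc n → ℝ := fun y => (jacMat n F y).det with hgd
  set φ : ℕ → Euc n → ℝ := fun j x => ψ x * g (w j x) with hφd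
  have hφ : ∀ j, ContDiff ℝ 1 (φ j) := fun j => hψ.1.mul (hg.comp (hw j))
  have hφS : ∀ j, tsupport (φ j) ⊆ tsupport ψ := fun j => tsupport_mul_subset_left
  have hφM : ∀ j x, |φ j x| ≤ M := by
    intro j x
    rw [hφd]
    simp only [abs_mul]
    calc _ ≤ 1 * M := mul_le_mul (hψ1 x) (hM _) (abs_nonneg _) zero_le_one
      _ = M := one_mul M
  have hconv := phi_conv hn hΩ hΩb u hu huf ψ hψ hψ1 g hg M hM w hw hwu hlim R0 hR0
  have hφ0 : AEStronglyMeasurable (fun x => ψ x * g (u x)) (volume.restrict Ω) :=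
    hψ.1.continuous.aestronglyMeasurable.mul (hg.continuous.comp_aestronglyMeasurable hum)
  obtain ⟨J, hJ, hJlim⟩ := part2 hn hΩ hΩb hs u hum huf F hF K hFK ψ hψ w (fun j => (hw j).contDiffOn) hwu
  have hrJ : r = J := by
    obtain ⟨vk, hvk, hvk1, hvk2⟩ := hJ.1
    exact tendsto_nhds_unique (hr.2 vk hvk hvk1) hvk2
  have hJlim' : Tendsto (fun k => ∫ x in Ω, (jacMat n (w k) x).det * φ k x) atTop (𝓝 r) := by
    rw [hrJ]
    refine hJlim.congr fun k => ?_
    refine setIntegral_congr_fun hΩ.measurableSet fun x hx => ?_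
    simp only [hφd, hgd]
    rw [det_chain hΩ F (hF.differentiable (by simp)) (w k) (hw k).contDiffOn hx]
    ring
  refine le_of_forall_pos_le_add fun ε hε => ?_
  obtain ⟨j, hj⟩ := det_pair_small hn hΩ u huf w hw hwu hum (tsupport ψ) hψ.2.1.isCompact hψ.2.2 φ _ hφ hφS hφ0 hconv (ε/2) (by positivity)
  set θ : Euc n → ℝ := fun x => M⁻¹ * φ j x with hθd
  have hθs : tsupport θ ⊆ tsupport ψ := (tsupport_mul_subset_right (f := fun _ => M⁻¹) (g := φ j)).trans (hφS j)
  have hθ : Cc1 n Ω θ := ⟨contDiff_const.mul (hφ j),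
    hψ.2.1.isCompact.of_isClosed_subset (isClosed_tsupport _) hθs, hθs.trans hψ.2.2⟩
  have hθ1 : ∀ x, |θ x| ≤ 1 := by
    intro x
    rw [hθd]
    simp only [abs_mul, abs_inv, abs_of_pos hM0]
    rw [inv_mul_le_iff₀ hM0, mul_one]
    exact hφM j x
  obtain ⟨Jj, hJj, hJjlim⟩ := jpair_exists hn hΩ hΩb hs θ hθ u hum (embed_fin hn hΩ.measurableSet hΩb huf) w
    (fun j => (hw j).contDiffOn) (embed_tendsto hn hΩ.measurableSet hΩb hwu)
  have hJB : Jj ≤ B := hB ⟨θ, hθ, hθ1, hJj⟩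
  have hlim2 : Tendsto (fun k => (∫ x in Ω, (jacMat n (w k) x).det * φ j x) + 2 * (ε/2)) atTop (𝓝 (M * Jj + 2 * (ε/2))) := by
    refine Tendsto.add_const _ ?_
    refine (hJjlim.const_mul M).congr fun k => ?_
    rw [← integral_const_mul]
    refine integral_congr_ae (Eventually.of_forall fun x => ?_)
    simp only [hθd]
    field_simp
  have h1 := le_of_tendsto_of_tendsto hJlim' hlim2 hj
  have h2 : M * Jj ≤ M * B := mul_le_mul_of_nonneg_left hJB hM0.le
  linarith

end PI2

/-- (Strong chain rule.) -/
theorem strong_chain_rule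
    (n : ℕ) (hn : 2 ≤ n) (Ω : Set (Euc n)) (hΩo : IsOpen Ω)
    (hΩb : Bornology.IsBounded Ω) (hΩs : SmoothBoundary n Ω)
    (u : Euc n → Euc n) (hucont : ContinuousOn u Ω)
    (hu : MemWsp n ((n : ℝ) / ((n : ℝ) + 1)) ((n : ℝ) + 1) Ω u)
    (hTV : BddAbove (TVset n Ω u))
    (F : Euc n → Euc n) (hF : ContDiff ℝ (⊤ : ℕ∞) F) (K : NNReal) (hFK : LipschitzWith K F) :
    BddAbove (TVset n Ω (F ∘ u)) ∧
    ∀ ψ : Euc n → ℝ, Cc1 n Ω ψ →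
      ∀ uk : ℕ → Euc n → Euc n, (∀ k, ContDiffOn ℝ 1 (uk k) (closure Ω)) →
        Tendsto (fun k => sobNorm n ((n : ℝ) / ((n : ℝ) + 1)) ((n : ℝ) + 1) Ω (uk k - u))
          atTop (𝓝 0) →
        ∃ J : ℝ, JPairing n Ω (F ∘ u) ψ J ∧
          Tendsto
            (fun k => -∫ x in Ω, ∑ i, jvec n (uk k) x i *
              fderiv ℝ (fun y => ψ y * (jacMat n F (uk k y)).det) x (EuclideanSpace.single i 1))
            atTop (𝓝 J) := by
  have huf : NN n Ω u < ⊤ := memWsp_NN (by omega) n _ _ rfl hs2 hu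
  refine ⟨partI hn hΩo hΩb hΩs u hucont huf hTV F hF K hFK, ?_⟩
  intro ψ hψ uk huk hlim
  have hm : ∀ k, AEStronglyMeasurable (uk k) (volume.restrict Ω) :=
    fun k => ((huk k).continuousOn.mono subset_closure).aestronglyMeasurable hΩo.measurableSet
  have h := (sob_to_NN (by omega) n _ _ rfl hs2 (fun k => (hm k).sub hu.1) (fun k =>
    lt_of_le_of_lt (NN_sub n u (hm k)) (ENNReal.mul_lt_top (by finiteness)
      (ENNReal.add_lt_top.2 ⟨NN_C1 hn _ hΩo hΩb hΩs (huk k), huf⟩)))).1 hlim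
  obtain ⟨J, hJ, hJlim⟩ := part2 hn hΩo hΩb hΩs u hu.1 huf F hF K hFK ψ hψ uk huk h
  refine ⟨J, hJ, ?_⟩
  refine hJlim.congr fun k => ?_
  exact (part2_formula hn hΩo ψ hψ F hF (uk k) ((huk k).mono subset_closure)).symm

end
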